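/- arXiv:0901.2352 — 6 statements merged into one kernel-verified Lean document; each statement's English description precedes it below -/
import Mathlib

section
/- Let P ∈ ℂ[x] be a polynomial admitting a decomposition of length k. Then the set of linear-equivalence classes of decompositions of P is finite of cardinality at most k!, and for any two decompositions of P, the second is linearly equivalent to a decomposition obtained from the first by a sequence of at most k(k−1)/2 Ritt swaps. -/
open Polynomial

noncomputable section

/-- A linear polynomial `L(x) = Ax + B` with `A ≠ 0`, i.e. of degree exactly 1. -/
def IsLinearPoly (L : ℂ[X]) : Prop := L.natDegree = 1

/-- A polynomial over ℂ is indecomposable if it has degree at least 2 and cannot be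
written as the composition of two polynomials each of degree at least 2. -/
def Indecomposable (f : ℂ[X]) : Prop :=
  2 ≤ f.natDegree ∧ ¬ ∃ g h : ℂ[X], 2 ≤ g.natDegree ∧ 2 ≤ h.natDegree ∧ f = g.comp h

/-- A decomposition of `f` is a nonempty list `[f₁, …, f_k]` (innermost factor first) of
indecomposable polynomials with `f = f_k ∘ ⋯ ∘ f₁`. -/
def IsDecomposition (l : List ℂ[X]) (f : ℂ[X]) : Prop :=
  l ≠ [] ∧ (∀ p ∈ l, Indecomposable p) ∧ l.foldl (fun q p => p.comp q) X = f

/-- `f` is the degree-`n` Chebyshev polynomial: the unique polynomial with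
`f(x + 1/x) = x^n + 1/x^n` for all `x ≠ 0`. -/
def IsChebyshev (n : ℕ) (f : ℂ[X]) : Prop :=
  ∀ x : ℂ, x ≠ 0 → f.eval (x + x⁻¹) = x ^ n + x⁻¹ ^ n

/-- A ritty polynomial: an indecomposable polynomial equal to `x²`, or `x^p` (`p` an odd
prime), or the Chebyshev polynomial `C_p` (`p` an odd prime), or
`x^k · u(x^ℓ)^n` with `k ≥ 1`, `gcd(k,ℓ) = gcd(k,n) = 1`, `u` monic non-constant,
`u(0) ≠ 0`, and `ℓ > 1` or `n > 1`. -/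
def IsRitty (f : ℂ[X]) : Prop :=
  Indecomposable f ∧
  (f = X ^ 2 ∨
   (∃ p : ℕ, p.Prime ∧ Odd p ∧ f = X ^ p) ∨
   (∃ p : ℕ, p.Prime ∧ Odd p ∧ IsChebyshev p f) ∨
   (∃ (k el n : ℕ) (u : ℂ[X]), 1 ≤ k ∧ 1 ≤ el ∧ 1 ≤ n ∧
     Nat.gcd k el = 1 ∧ Nat.gcd k n = 1 ∧
     u.Monic ∧ 0 < u.natDegree ∧ u.eval 0 ≠ 0 ∧ (1 < el ∨ 1 < n) ∧
     f = X ^ k * (u.comp (X ^ el)) ^ n))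

/-- `a ∘ b = c ∘ d` is an instance of a basic Ritt identity:
`x^p ∘ x^q = x^q ∘ x^p` for distinct primes `p ≠ q`;
`C_p ∘ C_q = C_q ∘ C_p` for distinct odd primes;
or `x^p ∘ (x^k·u(x^{ℓp})^n) = (x^k·u(x^ℓ)^{pn}) ∘ x^p` (in either orientation),
with both non-monomial factors ritty. -/
def BasicRittIdentity (a b c d : ℂ[X]) : Prop :=
  a.comp b = c.comp d ∧
  ((∃ p q : ℕ, p.Prime ∧ q.Prime ∧ p ≠ q ∧
      a = X ^ p ∧ b = X ^ q ∧ c = X ^ q ∧ d = X ^ p) ∨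
   (∃ p q : ℕ, p.Prime ∧ q.Prime ∧ Odd p ∧ Odd q ∧ p ≠ q ∧
      IsChebyshev p a ∧ IsChebyshev q b ∧ IsChebyshev q c ∧ IsChebyshev p d) ∨
   (∃ (p k el n : ℕ) (u : ℂ[X]), p.Prime ∧
      a = X ^ p ∧ b = X ^ k * (u.comp (X ^ (el * p))) ^ n ∧
      c = X ^ k * (u.comp (X ^ el)) ^ (p * n) ∧ d = X ^ p ∧
      IsRitty b ∧ IsRitty c) ∨
   (∃ (p k el n : ℕ) (u : ℂ[X]), p.Prime ∧
      a = X ^ k * (u.comp (X ^ el)) ^ (p * n) ∧ b = X ^ p ∧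
      c = X ^ p ∧ d = X ^ k * (u.comp (X ^ (el * p))) ^ n ∧
      IsRitty a ∧ IsRitty d))

/-- `m` is obtained from `l` by a Ritt swap at (0-based) position `j`, i.e. at the pair of
factors in positions `j` and `j+1` (innermost factor first).  This says the other
factors agree and there are linear polynomials `L, M, N` with
`(L⁻¹ ∘ l_{j+1} ∘ M) ∘ (M⁻¹ ∘ l_j ∘ N) = R ∘ S` a basic Ritt identity,
`m_{j+1} = L ∘ R` and `m_j = S ∘ N⁻¹`; inverses are eliminated by cross-multiplying. -/
def RittSwapAt (j : ℕ) (l m : List ℂ[X]) : Prop :=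
  l.length = m.length ∧ j + 1 < l.length ∧
  (∀ i, i ≠ j → i ≠ j + 1 → l.getD i 0 = m.getD i 0) ∧
  ∃ L M N A B R S : ℂ[X],
    IsLinearPoly L ∧ IsLinearPoly M ∧ IsLinearPoly N ∧
    L.comp A = (l.getD (j + 1) 0).comp M ∧
    M.comp B = (l.getD j 0).comp N ∧
    BasicRittIdentity A B R S ∧
    m.getD (j + 1) 0 = L.comp R ∧
    (m.getD j 0).comp N = S

/-- Linear equivalence of decompositions `[l₁,…,l_k]` and `[m₁,…,m_k]` (innermost first):
there are linear polynomials `L₁, …, L_{k-1}` (with `L₀ = L_k = x` the identity) such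
that `m_i = L_i⁻¹ ∘ l_i ∘ L_{i-1}` for each `i`; inverses are eliminated by
cross-multiplying. -/
def LinearEquivalent (l m : List ℂ[X]) : Prop :=
  l.length = m.length ∧
  ∃ L : ℕ → ℂ[X], L 0 = X ∧ L l.length = X ∧
    (∀ i, 0 < i → i < l.length → IsLinearPoly (L i)) ∧
    ∀ i < l.length, (L (i + 1)).comp (m.getD i 0) = (l.getD i 0).comp (L i)

namespace Ritt

theorem comp_right_cancel {g g' h : ℂ[X]} (hh : 0 < h.natDegree) (e : g.comp h = g'.comp h) :
    g = g' := by
  have h0 : (g - g').comp h = 0 := by rw [sub_comp, e, sub_self]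
  rcases comp_eq_zero_iff.mp h0 with h1 | ⟨_, h2⟩
  · exact sub_eq_zero.mp h1
  · rw [h2, natDegree_C] at hh
    exact absurd hh (lt_irrefl _)

theorem IsLinearPoly.exists_inv {L : ℂ[X]} (hL : IsLinearPoly L) :
    ∃ L', IsLinearPoly L' ∧ L.comp L' = X ∧ L'.comp L = X := by
  obtain ⟨a, ha, b, rfl⟩ := natDegree_eq_one.mp hL
  refine ⟨C a⁻¹ * X + C (-(a⁻¹ * b)), ?_, ?_, ?_⟩
  · exact natDegree_linear (inv_ne_zero ha)
  · simp only [add_comp, mul_comp, C_comp, X_comp, mul_add, ← mul_assoc, ← C_mul]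
    rw [mul_inv_cancel₀ ha, add_assoc, ← C_add]
    simp [ha]
  · simp only [add_comp, mul_comp, C_comp, X_comp, mul_add, ← mul_assoc, ← C_mul]
    rw [inv_mul_cancel₀ ha, add_assoc, ← C_add]
    simp

theorem isLinearPoly_X : IsLinearPoly X := natDegree_X

theorem IsLinearPoly.comp {L M : ℂ[X]} (hL : IsLinearPoly L) (hM : IsLinearPoly M) :
    IsLinearPoly (L.comp M) := by
  unfold IsLinearPoly at *
  rw [natDegree_comp, hL, hM]

theorem natDegree_linear_comp {L : ℂ[X]} (hL : IsLinearPoly L) (f : ℂ[X]) :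
    (L.comp f).natDegree = f.natDegree := by
  unfold IsLinearPoly at hL; rw [natDegree_comp, hL, one_mul]

theorem natDegree_comp_linear {L : ℂ[X]} (hL : IsLinearPoly L) (f : ℂ[X]) :
    (f.comp L).natDegree = f.natDegree := by
  unfold IsLinearPoly at hL; rw [natDegree_comp, hL, mul_one]

theorem indecomposable_linear_comp {L f : ℂ[X]} (hL : IsLinearPoly L) (hf : Indecomposable f) :
    Indecomposable (L.comp f) := by
  obtain ⟨L', hL', h1, h2⟩ := IsLinearPoly.exists_inv hL
  refine ⟨by rw [natDegree_linear_comp hL]; exact hf.1, ?_⟩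
  rintro ⟨g, h, hg, hh, e⟩
  refine hf.2 ⟨L'.comp g, h, by rwa [natDegree_linear_comp hL'], hh, ?_⟩
  rw [comp_assoc, ← e, ← comp_assoc, h2, X_comp]

theorem indecomposable_comp_linear {L f : ℂ[X]} (hL : IsLinearPoly L) (hf : Indecomposable f) :
    Indecomposable (f.comp L) := by
  obtain ⟨L', hL', h1, h2⟩ := IsLinearPoly.exists_inv hL
  refine ⟨by rw [natDegree_comp_linear hL]; exact hf.1, ?_⟩
  rintro ⟨g, h, hg, hh, e⟩
  refine hf.2 ⟨g, h.comp L', hg, by rwa [natDegree_comp_linear hL'], ?_⟩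
  rw [← comp_assoc, ← e, comp_assoc, h1, comp_X]

theorem Indecomposable.natDegree_eq_one_or {f g h : ℂ[X]} (hf : Indecomposable f)
    (e : f = g.comp h) : g.natDegree = 1 ∨ h.natDegree = 1 := by
  have h2 := hf.1
  by_contra! hc
  have hd : f.natDegree = g.natDegree * h.natDegree := by rw [e, natDegree_comp]
  have hg0 : g.natDegree ≠ 0 := fun h0 ↦ by rw [h0, zero_mul] at hd; omega
  have hh0 : h.natDegree ≠ 0 := fun h0 ↦ by rw [h0, mul_zero] at hd; omega
  exact hf.2 ⟨g, h, by omega, by omega, e⟩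

/-! ### Right factors and their degrees -/

theorem geom_sum_degree {p q : ℂ[X]} {n M : ℕ} (hp : p.Monic) (hq : q.Monic)
    (hpn : p.natDegree = n) (hqn : q.natDegree = n) (hM : 1 ≤ M) :
    (∑ i ∈ Finset.range M, p ^ i * q ^ (M - 1 - i)).natDegree = (M - 1) * n ∧
    (∑ i ∈ Finset.range M, p ^ i * q ^ (M - 1 - i)).coeff ((M - 1) * n) = M := by
  have hdeg : ∀ i ∈ Finset.range M, (p ^ i * q ^ (M - 1 - i)).natDegree = (M - 1) * n := by
    intro i hi
    have hi' := Finset.mem_range.mp hi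
    rw [(hp.pow i).natDegree_mul (hq.pow _), hp.natDegree_pow, hq.natDegree_pow, hpn, hqn,
      ← add_mul]
    congr 1
    omega
  have hc : (∑ i ∈ Finset.range M, p ^ i * q ^ (M - 1 - i)).coeff ((M - 1) * n) = M := by
    rw [finsetSum_coeff, Finset.sum_congr rfl (g := fun _ ↦ (1 : ℂ))]
    · simp
    · intro i hi
      rw [← hdeg i hi]
      exact ((hp.pow i).mul (hq.pow _)).coeff_natDegree
  refine ⟨le_antisymm (natDegree_sum_le_of_forall_le _ _ fun i hi ↦ (hdeg i hi).le) ?_, hc⟩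
  apply le_natDegree_of_ne_zero
  rw [hc]
  exact_mod_cast (by omega : M ≠ 0)

theorem monic_sub_const {p q : ℂ[X]} {n M : ℕ} (hp : p.Monic) (hq : q.Monic)
    (hpn : p.natDegree = n) (hqn : q.natDegree = n) (hM : 1 ≤ M)
    (h : (p ^ M - q ^ M).natDegree ≤ (M - 1) * n) : (p - q).natDegree = 0 := by
  obtain ⟨h1, h2⟩ := geom_sum_degree hp hq hpn hqn hM
  rw [← (Commute.all p q).geom_sum₂_mul] at h
  set S := ∑ i ∈ Finset.range M, p ^ i * q ^ (M - 1 - i)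
  by_cases h0 : p - q = 0
  · rw [h0, natDegree_zero]
  · have hS : S ≠ 0 := by
      intro hS
      rw [hS, coeff_zero] at h2
      exact (by exact_mod_cast (by omega : M ≠ 0) : (M : ℂ) ≠ 0) h2.symm
    rw [natDegree_mul hS h0, h1] at h
    omega

theorem natDegree_sub_leading_pow {g : ℂ[X]} {M : ℕ} (hg : g.natDegree = M) :
    (g - C g.leadingCoeff * X ^ M).natDegree ≤ M - 1 := by
  rw [← hg]
  have := g.eraseLead_natDegree_le
  rwa [← self_sub_monomial_natDegree_leadingCoeff, ← C_mul_X_pow_eq_monomial] at this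

/-- Two left composites which nearly agree have linearly equivalent right factors. -/
theorem exists_linear_of_natDegree_comp_sub {g g' p q : ℂ[X]} {n M : ℕ} (hM : 1 ≤ M) (hn : 1 ≤ n)
    (hg : g.natDegree = M) (hg' : g'.natDegree = M) (hp : p.natDegree = n) (hq : q.natDegree = n)
    (h : (g.comp p - g'.comp q).natDegree ≤ (M - 1) * n) :
    ∃ L, IsLinearPoly L ∧ q = L.comp p := by
  have hp0 : p ≠ 0 := by rintro rfl; simp at hp; omega
  have hq0 : q ≠ 0 := by rintro rfl; simp at hq; omega
  have hg0 : g ≠ 0 := by rintro rfl; simp at hg; omega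
  have key : ∀ (g p : ℂ[X]), g.natDegree = M → p.natDegree = n →
      (g.comp p - C g.leadingCoeff * p ^ M).natDegree ≤ (M - 1) * n := by
    intro g p hg hp
    have : g.comp p - C g.leadingCoeff * p ^ M = (g - C g.leadingCoeff * X ^ M).comp p := by simp
    rw [this, natDegree_comp, hp]
    exact Nat.mul_le_mul_right _ (natDegree_sub_leading_pow hg)
  have hd : (C g.leadingCoeff * p ^ M - C g'.leadingCoeff * q ^ M).natDegree ≤ (M - 1) * n := by
    have e : C g.leadingCoeff * p ^ M - C g'.leadingCoeff * q ^ M =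
        (g.comp p - g'.comp q) - (g.comp p - C g.leadingCoeff * p ^ M) +
          (g'.comp q - C g'.leadingCoeff * q ^ M) := by ring
    rw [e]
    refine (natDegree_add_le _ _).trans (max_le ((natDegree_sub_le _ _).trans
      (max_le h (key g p hg hp))) (key g' q hg' hq))
  have norm : ∀ p : ℂ[X], p ≠ 0 → ∃ p1 : ℂ[X], p1.Monic ∧ p1.natDegree = p.natDegree ∧
      p = C p.leadingCoeff * p1 := by
    intro p hp
    have hl := leadingCoeff_ne_zero.mpr hp
    refine ⟨p * C p.leadingCoeff⁻¹, monic_mul_leadingCoeff_inv hp, ?_, ?_⟩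
    · rw [natDegree_mul_C (inv_ne_zero hl)]
    · rw [mul_left_comm, ← C_mul, mul_inv_cancel₀ hl, C_1, mul_one]
  obtain ⟨p1, hp1, hp1n, ep⟩ := norm p hp0
  obtain ⟨q1, hq1, hq1n, eq⟩ := norm q hq0
  have hlp := leadingCoeff_ne_zero.mpr hp0
  have hlq := leadingCoeff_ne_zero.mpr hq0
  have hlg := leadingCoeff_ne_zero.mpr hg0
  set α := p.leadingCoeff
  set β := q.leadingCoeff
  have hd2 : (C (g.leadingCoeff * α ^ M) * p1 ^ M - C (g'.leadingCoeff * β ^ M) * q1 ^ M).natDegree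
      ≤ (M - 1) * n := by
    rw [ep, eq, mul_pow, mul_pow, ← C_pow, ← C_pow, ← mul_assoc, ← mul_assoc, ← C_mul, ← C_mul]
      at hd
    exact hd
  have hpc : (p1 ^ M).coeff (M * n) = 1 := by
    have := (hp1.pow M).coeff_natDegree
    rwa [hp1.natDegree_pow, hp1n, hp] at this
  have hqc : (q1 ^ M).coeff (M * n) = 1 := by
    have := (hq1.pow M).coeff_natDegree
    rwa [hq1.natDegree_pow, hq1n, hq] at this
  have hlt : (M - 1) * n < M * n := Nat.mul_lt_mul_of_pos_right (by omega) (by omega)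
  have hcc : g.leadingCoeff * α ^ M = g'.leadingCoeff * β ^ M := by
    have := coeff_eq_zero_of_natDegree_lt (hd2.trans_lt hlt)
    rw [coeff_sub, coeff_C_mul, coeff_C_mul, hpc, hqc, mul_one, mul_one] at this
    exact sub_eq_zero.mp this
  rw [← hcc, ← mul_sub, natDegree_C_mul (mul_ne_zero hlg (pow_ne_zero _ hlp))] at hd2
  have h0 := monic_sub_const hp1 hq1 (hp1n.trans hp) (hq1n.trans hq) hM hd2
  obtain ⟨c, hc⟩ := natDegree_eq_zero.mp h0
  refine ⟨C (β / α) * X + C (- (β * c)), natDegree_linear (div_ne_zero hlq hlp), ?_⟩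
  have hq1' : q1 = p1 - C c := by rw [hc]; ring
  rw [eq, hq1', add_comp, mul_comp, C_comp, X_comp, C_comp, ep, ← mul_assoc, ← C_mul,
    div_mul_cancel₀ _ hlp]
  simp only [C_neg, C_mul]
  ring

/-- In characteristic zero a right factor is determined by its degree, up to linear
equivalence. -/
theorem exists_linear_of_comp_eq {g g' h h' : ℂ[X]} (hg : 0 < g.natDegree) (hh : 0 < h.natDegree)
    (hd : h.natDegree = h'.natDegree) (e : g.comp h = g'.comp h') :
    ∃ L, IsLinearPoly L ∧ h' = L.comp h := by
  have hdeg := congrArg natDegree e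
  rw [natDegree_comp, natDegree_comp, ← hd] at hdeg
  exact exists_linear_of_natDegree_comp_sub hg hh rfl (Nat.eq_of_mul_eq_mul_right hh hdeg).symm rfl
    hd.symm (by rw [e, sub_self]; simp)

/-- Existence of approximate roots. -/
theorem exists_approx_root {g : ℂ[X]} {M s : ℕ} (hM : 1 ≤ M) (hs : 1 ≤ s)
    (hg : g.natDegree = M * s) :
    ∃ u : ℂ[X], u.Monic ∧ u.natDegree = s ∧
      (g - C g.leadingCoeff * u ^ M).natDegree ≤ (M - 1) * s := by
  have hg0 : g ≠ 0 := by
    rintro rfl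
    have : 1 ≤ M * s := Nat.mul_pos hM hs
    simp at hg; omega
  have hc := leadingCoeff_ne_zero.mpr hg0
  set c := g.leadingCoeff with hcdef
  have hMs : M * s = (M - 1) * s + s := by
    obtain ⟨M, rfl⟩ : ∃ k, M = k + 1 := ⟨M - 1, by omega⟩
    simp [add_mul]
  have step : ∀ k, k < s → ∃ u : ℂ[X], u.Monic ∧ u.natDegree = s ∧
      (g - C c * u ^ M).natDegree ≤ (M - 1) * s + (s - 1 - k) := by
    intro k
    induction k with
    | zero =>
      intro _
      refine ⟨X ^ s, monic_X_pow s, natDegree_X_pow s, ?_⟩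
      rw [← pow_mul, mul_comm s M, ← hg]
      refine (natDegree_sub_leading_pow rfl).trans ?_
      omega
    | succ k ih =>
      intro hk
      obtain ⟨u, hu, hus, hud⟩ := ih (by omega)
      set i := s - 1 - k with hi
      set t := (g - C c * u ^ M).coeff ((M - 1) * s + i) / (c * M)
      have hlt : (C t * X ^ i).degree < u.degree := by
        rw [degree_eq_natDegree hu.ne_zero, hus]
        refine (degree_C_mul_X_pow_le i t).trans_lt ?_
        exact_mod_cast (by omega : i < s)
      have hu' : (u + C t * X ^ i).Monic := hu.add_of_left hlt
      have hus' : (u + C t * X ^ i).natDegree = s := by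
        rw [natDegree_add_eq_left_of_degree_lt hlt, hus]
      refine ⟨u + C t * X ^ i, hu', hus', ?_⟩
      obtain ⟨h1, h2⟩ := geom_sum_degree hu' hu hus' hus hM
      have e := (Commute.all (u + C t * X ^ i) u).geom_sum₂_mul M
      set S := ∑ j ∈ Finset.range M, (u + C t * X ^ i) ^ j * u ^ (M - 1 - j)
      have e2 : g - C c * (u + C t * X ^ i) ^ M =
          (g - C c * u ^ M) - C (c * t) * (S * X ^ i) := by
        rw [C_mul]; linear_combination C c * e
      have hle : (g - C c * (u + C t * X ^ i) ^ M).natDegree ≤ (M - 1) * s + i := by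
        rw [e2]
        refine (natDegree_sub_le _ _).trans (max_le hud ((natDegree_C_mul_le _ _).trans
          (natDegree_mul_le.trans ?_)))
        rw [h1, natDegree_X_pow]
      have hco : (g - C c * (u + C t * X ^ i) ^ M).coeff ((M - 1) * s + i) = 0 := by
        rw [e2, coeff_sub, coeff_C_mul, coeff_mul_X_pow, h2]
        have hM0 : (M : ℂ) ≠ 0 := by exact_mod_cast (by omega : M ≠ 0)
        simp only [t]
        field_simp
        ring
      have hne : (g - C c * (u + C t * X ^ i) ^ M).natDegree ≠ (M - 1) * s + i := by
        intro h
        have h3 : (g - C c * (u + C t * X ^ i) ^ M) = 0 := by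
          rw [← leadingCoeff_eq_zero, leadingCoeff, h, hco]
        rw [h3, natDegree_zero] at h
        omega
      omega
  obtain ⟨u, hu, hus, hud⟩ := step (s - 1) (by omega)
  exact ⟨u, hu, hus, by simpa using hud⟩

theorem exists_comp_of_common {h h' Q u v : ℂ[X]} (hh : 0 < h.natDegree) (hh' : 0 < h'.natDegree)
    (hu : Q = u.comp h) (hv : Q = v.comp h') (hQ : Q.natDegree = Nat.lcm h.natDegree h'.natDegree)
    (N : ℕ) : ∀ g g' : ℂ[X], g.natDegree ≤ N → g.comp h = g'.comp h' →
      ∃ w : ℂ[X], g.comp h = w.comp Q := by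
  have hl : 0 < Nat.lcm h.natDegree h'.natDegree := Nat.lcm_pos hh hh'
  have hQ0 : Q ≠ 0 := by rintro rfl; simp at hQ; omega
  have hu0 : u ≠ 0 := by rintro rfl; simp at hu; exact hQ0 hu
  have hv0 : v ≠ 0 := by rintro rfl; simp at hv; exact hQ0 hv
  have hun : 0 < u.natDegree := by
    rw [hu, natDegree_comp] at hQ
    exact Nat.pos_of_ne_zero fun h0 ↦ by rw [h0, zero_mul] at hQ; omega
  have hvn : 0 < v.natDegree := by
    rw [hv, natDegree_comp] at hQ
    exact Nat.pos_of_ne_zero fun h0 ↦ by rw [h0, zero_mul] at hQ; omega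
  induction N using Nat.strong_induction_on with
  | _ N ih =>
    intro g g' hg e
    have eg := EuclideanDomain.div_add_mod g u
    have eg' := EuclideanDomain.div_add_mod g' v
    have hr : (g % u).natDegree < u.natDegree := natDegree_mod_lt g hun.ne'
    have hr' : (g' % v).natDegree < v.natDegree := natDegree_mod_lt g' hvn.ne'
    have hrl : ((g % u).comp h).natDegree < Q.natDegree := by
      rw [hu, natDegree_comp, natDegree_comp]; exact Nat.mul_lt_mul_of_pos_right hr hh
    have hrl' : ((g' % v).comp h').natDegree < Q.natDegree := by
      rw [hv, natDegree_comp, natDegree_comp]; exact Nat.mul_lt_mul_of_pos_right hr' hh'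
    have E1 : g.comp h = Q * (g / u).comp h + (g % u).comp h := by
      conv_lhs => rw [← eg]
      rw [add_comp, mul_comp, ← hu]
    have E2 : g.comp h = Q * (g' / v).comp h' + (g' % v).comp h' := by
      rw [e]
      conv_lhs => rw [← eg']
      rw [add_comp, mul_comp, ← hv]
    have E3 : Q * ((g / u).comp h - (g' / v).comp h') = (g' % v).comp h' - (g % u).comp h := by
      linear_combination E2 - E1
    have hz : (g / u).comp h - (g' / v).comp h' = 0 := by
      by_contra hne
      have := congrArg natDegree E3
      rw [natDegree_mul hQ0 hne] at this
      have h3 := natDegree_sub_le ((g' % v).comp h') ((g % u).comp h)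
      have h4 := max_lt hrl' hrl
      omega
    rw [hz, mul_zero] at E3
    have hrr : ((g % u).comp h).natDegree = 0 := by
      by_contra hne
      have hd : Nat.lcm h.natDegree h'.natDegree ∣ ((g % u).comp h).natDegree := by
        apply Nat.lcm_dvd
        · rw [natDegree_comp]; exact dvd_mul_left _ _
        · rw [← sub_eq_zero.mp E3.symm, natDegree_comp]; exact dvd_mul_left _ _
      have := Nat.le_of_dvd (Nat.pos_of_ne_zero hne) hd
      omega
    obtain ⟨c, hc⟩ := natDegree_eq_zero.mp hrr
    by_cases hgu : g.natDegree < u.natDegree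
    · refine ⟨C c, ?_⟩
      rw [C_comp, hc, (mod_eq_self_iff hu0).mpr (degree_lt_degree hgu)]
    · have hdd : (g / u).natDegree < N := by
        have hg0 : g ≠ 0 := by rintro rfl; simp at hgu; omega
        by_cases hz' : g / u = 0
        · rw [hz', natDegree_zero]; omega
        · exact (natDegree_lt_natDegree hz'
            (degree_div_lt hg0 (natDegree_pos_iff_degree_pos.mp hun))).trans_le hg
      obtain ⟨w, hw⟩ := ih _ hdd (g / u) (g' / v) le_rfl (sub_eq_zero.mp hz)
      refine ⟨X * w + C c, ?_⟩
      rw [E1, hw, ← hc, add_comp, mul_comp, X_comp, C_comp]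

/-- Two right factors of a polynomial have a common left multiple whose degree is the least
common multiple of their degrees. -/
theorem exists_lcm_factor {P g g' h h' : ℂ[X]} (hP : 0 < P.natDegree) (e : P = g.comp h)
    (e' : P = g'.comp h') :
    ∃ u v w : ℂ[X], u.comp h = v.comp h' ∧
      (u.comp h).natDegree = Nat.lcm h.natDegree h'.natDegree ∧ P = w.comp (u.comp h) := by
  have hd : P.natDegree = g.natDegree * h.natDegree := by rw [e, natDegree_comp]
  have hd' : P.natDegree = g'.natDegree * h'.natDegree := by rw [e', natDegree_comp]
  have hh : 0 < h.natDegree := Nat.pos_of_ne_zero fun h0 ↦ by rw [h0, mul_zero] at hd; omega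
  have hh' : 0 < h'.natDegree := Nat.pos_of_ne_zero fun h0 ↦ by rw [h0, mul_zero] at hd'; omega
  obtain ⟨M, hM⟩ : Nat.lcm h.natDegree h'.natDegree ∣ P.natDegree :=
    Nat.lcm_dvd ⟨_, hd.trans (mul_comm _ _)⟩ ⟨_, hd'.trans (mul_comm _ _)⟩
  have hl : 0 < Nat.lcm h.natDegree h'.natDegree := Nat.lcm_pos hh hh'
  obtain ⟨s, hs⟩ := Nat.dvd_lcm_left h.natDegree h'.natDegree
  obtain ⟨s', hs'⟩ := Nat.dvd_lcm_right h.natDegree h'.natDegree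
  set l := Nat.lcm h.natDegree h'.natDegree
  have hM1 : 1 ≤ M := Nat.pos_of_ne_zero fun h0 ↦ by rw [h0, mul_zero] at hM; omega
  have hs1 : 1 ≤ s := Nat.pos_of_ne_zero fun h0 ↦ by rw [h0, mul_zero] at hs; omega
  have hs1' : 1 ≤ s' := Nat.pos_of_ne_zero fun h0 ↦ by rw [h0, mul_zero] at hs'; omega
  have hgM : g.natDegree = M * s := by
    apply Nat.eq_of_mul_eq_mul_right hh
    rw [← hd, hM, hs]; ring
  have hgM' : g'.natDegree = M * s' := by
    apply Nat.eq_of_mul_eq_mul_right hh'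
    rw [← hd', hM, hs']; ring
  obtain ⟨u, hu, hus, hud⟩ := exists_approx_root hM1 hs1 hgM
  obtain ⟨v, hv, hvs, hvd⟩ := exists_approx_root hM1 hs1' hgM'
  have hg0 : g.leadingCoeff ≠ 0 := leadingCoeff_ne_zero.mpr (by rintro rfl; simp at e; simp [e] at hP)
  have hg0' : g'.leadingCoeff ≠ 0 :=
    leadingCoeff_ne_zero.mpr (by rintro rfl; simp at e'; simp [e'] at hP)
  have hul : (u.comp h).natDegree = l := by rw [natDegree_comp, hus, hs, mul_comm]
  have hvl : (v.comp h').natDegree = l := by rw [natDegree_comp, hvs, hs', mul_comm]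
  have key : ∀ (g h u : ℂ[X]) (s : ℕ), P = g.comp h → l = h.natDegree * s →
      (g - C g.leadingCoeff * u ^ M).natDegree ≤ (M - 1) * s →
      (P - (C g.leadingCoeff * X ^ M).comp (u.comp h)).natDegree ≤ (M - 1) * l := by
    intro g h u s e hs hud
    have : P - (C g.leadingCoeff * X ^ M).comp (u.comp h) =
        (g - C g.leadingCoeff * u ^ M).comp h := by rw [e]; simp
    rw [this, natDegree_comp, hs, mul_comm h.natDegree, ← mul_assoc]
    exact Nat.mul_le_mul_right _ hud
  obtain ⟨L, hL, hLe⟩ := exists_linear_of_natDegree_comp_sub (g := C g.leadingCoeff * X ^ M)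
    (g' := C g'.leadingCoeff * X ^ M) hM1 hl (natDegree_C_mul_X_pow _ _ hg0)
    (natDegree_C_mul_X_pow _ _ hg0') hul hvl (by
      have e3 : (C g.leadingCoeff * X ^ M).comp (u.comp h) -
          (C g'.leadingCoeff * X ^ M).comp (v.comp h') =
          (P - (C g'.leadingCoeff * X ^ M).comp (v.comp h')) -
          (P - (C g.leadingCoeff * X ^ M).comp (u.comp h)) := by ring
      rw [e3]
      exact (natDegree_sub_le _ _).trans (max_le (key _ _ _ _ e' hs' hvd) (key _ _ _ _ e hs hud)))
  have hQ : (L.comp u).comp h = v.comp h' := by rw [comp_assoc, hLe]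
  obtain ⟨w, hw⟩ := exists_comp_of_common hh hh' (Q := v.comp h') hQ.symm rfl hvl _ g g' le_rfl
    (e.symm.trans e')
  exact ⟨L.comp u, v, w, hQ, by rw [hQ, hvl], by rw [hQ, ← hw, e]⟩

theorem exists_eval_eq {f : ℂ[X]} (hf : 0 < f.natDegree) (v : ℂ) : ∃ x, f.eval x = v := by
  obtain ⟨x, hx⟩ := IsAlgClosed.exists_root (f - C v)
    (degree_ne_of_natDegree_ne (by rw [natDegree_sub_C]; exact hf.ne'))
  exact ⟨x, by simpa [sub_eq_zero] using hx⟩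

theorem natDegree_lt_of_coeff_eq_zero {f : ℂ[X]} {n : ℕ} (hn : 0 < n)
    (h : ∀ m, n ≤ m → f.coeff m = 0) : f.natDegree < n := by
  by_contra hle
  have h1 := h _ (not_lt.mp hle)
  rw [coeff_natDegree, leadingCoeff_eq_zero] at h1
  rw [h1, natDegree_zero] at hle
  exact hle hn

/-- The homogenisation of `S`, in degree `N`, evaluated at the pair `(p, q)`. -/
def homogEval (p q S : ℂ[X]) (N : ℕ) : ℂ[X] :=
  ∑ i ∈ Finset.range (N + 1), C (S.coeff i) * p ^ i * q ^ (N - i)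

theorem algebraMap_homogEval {p q S : ℂ[X]} {N : ℕ} (hq : q ≠ 0) (hN : S.natDegree ≤ N) :
    algebraMap ℂ[X] (RatFunc ℂ) (homogEval p q S N) =
      algebraMap ℂ[X] (RatFunc ℂ) q ^ N *
        aeval (algebraMap ℂ[X] (RatFunc ℂ) p / algebraMap ℂ[X] (RatFunc ℂ) q) S := by
  have hq' : algebraMap ℂ[X] (RatFunc ℂ) q ≠ 0 := by simpa using hq
  rw [aeval_eq_sum_range' (Nat.lt_succ_of_le hN), homogEval, map_sum, Finset.mul_sum]
  refine Finset.sum_congr rfl fun i hi ↦ ?_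
  have hi' : i ≤ N := Nat.lt_succ_iff.mp (Finset.mem_range.mp hi)
  rw [map_mul, map_mul, map_pow, map_pow, div_pow, Algebra.smul_def,
    IsScalarTower.algebraMap_apply ℂ ℂ[X] (RatFunc ℂ), Polynomial.algebraMap_eq]
  have : algebraMap ℂ[X] (RatFunc ℂ) q ^ N =
      algebraMap ℂ[X] (RatFunc ℂ) q ^ i * algebraMap ℂ[X] (RatFunc ℂ) q ^ (N - i) := by
    rw [← pow_add]; congr 1; omega
  rw [this]
  field_simp

theorem eval_homogEval {p q S : ℂ[X]} {N : ℕ} {x : ℂ} (hq : q.eval x ≠ 0)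
    (hN : S.natDegree ≤ N) :
    (homogEval p q S N).eval x = q.eval x ^ N * S.eval (p.eval x / q.eval x) := by
  rw [eval_eq_sum_range' (Nat.lt_succ_of_le hN), homogEval, eval_finsetSum, Finset.mul_sum]
  refine Finset.sum_congr rfl fun i hi ↦ ?_
  have hi' : i ≤ N := Nat.lt_succ_iff.mp (Finset.mem_range.mp hi)
  have : q.eval x ^ N = q.eval x ^ i * q.eval x ^ (N - i) := by
    rw [← pow_add]; congr 1; omega
  simp only [eval_mul, eval_C, eval_pow, this, div_pow]
  field_simp

/-- A polynomial which is a rational function of a fraction `p / q` with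
`deg q < deg p` is a polynomial in that fraction. -/
theorem exists_aeval_of_mem_adjoin {p q h : ℂ[X]} (hq : q ≠ 0) (hpq : IsCoprime p q)
    (hdeg : q.natDegree < p.natDegree) (hh : h ≠ 0)
    (hmem : algebraMap ℂ[X] (RatFunc ℂ) h ∈ IntermediateField.adjoin ℂ
      {algebraMap ℂ[X] (RatFunc ℂ) p / algebraMap ℂ[X] (RatFunc ℂ) q}) :
    ∃ S : ℂ[X], algebraMap ℂ[X] (RatFunc ℂ) h =
      aeval (algebraMap ℂ[X] (RatFunc ℂ) p / algebraMap ℂ[X] (RatFunc ℂ) q) S := by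
  obtain ⟨r, s, hrs⟩ := IntermediateField.mem_adjoin_simple_iff _ _ |>.mp hmem
  set z := algebraMap ℂ[X] (RatFunc ℂ) p / algebraMap ℂ[X] (RatFunc ℂ) q with hz
  have hh' : algebraMap ℂ[X] (RatFunc ℂ) h ≠ 0 := by simpa using hh
  have hs0 : aeval z s ≠ 0 := fun h0 ↦ hh' (by rw [hrs, h0, div_zero])
  have hsne : s ≠ 0 := by rintro rfl; simp at hs0
  obtain ⟨g, hg⟩ : ∃ g, g = EuclideanDomain.gcd r s := ⟨_, rfl⟩
  obtain ⟨r1, hr1⟩ : g ∣ r := hg ▸ EuclideanDomain.gcd_dvd_left r s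
  obtain ⟨s1, hs1⟩ : g ∣ s := hg ▸ EuclideanDomain.gcd_dvd_right r s
  have hg0 : g ≠ 0 := by rintro rfl; simp at hs1; exact hsne hs1
  have hcop : IsCoprime r1 s1 := by
    have hb := EuclideanDomain.gcd_eq_gcd_ab r s
    refine ⟨EuclideanDomain.gcdA r s, EuclideanDomain.gcdB r s, mul_left_cancel₀ hg0 ?_⟩
    rw [← hg] at hb
    linear_combination -hb + EuclideanDomain.gcdA r s * (-hr1) + EuclideanDomain.gcdB r s * (-hs1)
  have hgz : aeval z g ≠ 0 := fun h0 ↦ hs0 (by rw [hs1, map_mul, h0, zero_mul])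
  have hsz : aeval z s1 ≠ 0 := fun h0 ↦ hs0 (by rw [hs1, map_mul, h0, mul_zero])
  have hrs1 : algebraMap ℂ[X] (RatFunc ℂ) h * aeval z s1 = aeval z r1 := by
    rw [hrs, hr1, hs1, map_mul, map_mul]; field_simp
  have hpoly : h * homogEval p q s1 (max r1.natDegree s1.natDegree) =
      homogEval p q r1 (max r1.natDegree s1.natDegree) := by
    apply RatFunc.algebraMap_injective ℂ
    rw [map_mul, algebraMap_homogEval hq (le_max_right _ _),
      algebraMap_homogEval hq (le_max_left _ _), ← hz, ← hrs1]
    ring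
  have hconst : s1.natDegree = 0 := by
    by_contra hne
    obtain ⟨t, ht⟩ := exists_eval_eq (Nat.pos_of_ne_zero hne) 0
    have hpt : 0 < (p - C t * q).natDegree := by
      rw [natDegree_sub_eq_left_of_natDegree_lt
        ((natDegree_C_mul_le _ _).trans_lt hdeg)]
      omega
    obtain ⟨x, hx⟩ := exists_eval_eq hpt 0
    rw [eval_sub, eval_mul, eval_C, sub_eq_zero] at hx
    have hqx : q.eval x ≠ 0 := by
      intro h0
      obtain ⟨a, b, hab⟩ := hpq
      have := congrArg (eval x) hab
      simp [hx, h0] at this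
    have hpx : p.eval x / q.eval x = t := by rw [hx]; field_simp
    have := congrArg (eval x) hpoly
    rw [eval_mul, eval_homogEval hqx (le_max_right _ _), eval_homogEval hqx (le_max_left _ _), hpx,
      ht, mul_zero, mul_zero, zero_eq_mul] at this
    have hrt := this.resolve_left (pow_ne_zero _ hqx)
    obtain ⟨a, b, hab⟩ := hcop
    have := congrArg (eval t) hab
    simp [hrt, ht] at this
  obtain ⟨c, hc⟩ := natDegree_eq_zero.mp hconst
  have hc0 : c ≠ 0 := by rintro rfl; simp [← hc] at hsz
  refine ⟨C c⁻¹ * r1, ?_⟩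
  rw [map_mul, ← hrs1, ← hc, mul_left_comm, ← map_mul, ← C_mul, inv_mul_cancel₀ hc0]
  simp

/-- A polynomial in `ℂ(ρ)` is a polynomial in `ρ`. -/
theorem exists_comp_of_mem_adjoin {ρ h : ℂ[X]} (hρ : 0 < ρ.natDegree) (hh : h ≠ 0)
    (hmem : algebraMap ℂ[X] (RatFunc ℂ) h ∈ IntermediateField.adjoin ℂ
      {algebraMap ℂ[X] (RatFunc ℂ) ρ}) : ∃ S : ℂ[X], h = S.comp ρ := by
  obtain ⟨S, hS⟩ := exists_aeval_of_mem_adjoin (p := ρ) one_ne_zero isCoprime_one_right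
    (by simpa using hρ) hh (by simpa using hmem)
  refine ⟨S, RatFunc.algebraMap_injective ℂ ?_⟩
  rw [hS, map_one, div_one, aeval_algebraMap_apply, comp, aeval_def, Polynomial.algebraMap_eq]

/-- An intermediate field of `ℂ(x)/ℂ` containing a nonconstant polynomial is generated by a
polynomial. -/
theorem exists_polynomial_generator (E : IntermediateField ℂ (RatFunc ℂ)) {h : ℂ[X]}
    (hh : 0 < h.natDegree) (hE : algebraMap ℂ[X] (RatFunc ℂ) h ∈ E) :
    ∃ ρ : ℂ[X], 0 < ρ.natDegree ∧
      E = IntermediateField.adjoin ℂ {algebraMap ℂ[X] (RatFunc ℂ) ρ} := by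
  have hh0 : h ≠ 0 := by rintro rfl; simp at hh
  obtain ⟨p, q, hq, hpq, hdeg, hEz⟩ : ∃ p q : ℂ[X], q ≠ 0 ∧ IsCoprime p q ∧
      q.natDegree < p.natDegree ∧ E = IntermediateField.adjoin ℂ
        {algebraMap ℂ[X] (RatFunc ℂ) p / algebraMap ℂ[X] (RatFunc ℂ) q} := by
    have hbot : E ≠ ⊥ := by
      rintro rfl
      obtain ⟨c, hc⟩ := IntermediateField.mem_bot.mp hE
      rw [IsScalarTower.algebraMap_apply ℂ ℂ[X] (RatFunc ℂ)] at hc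
      rw [← RatFunc.algebraMap_injective ℂ hc] at hh
      simp at hh
    have hgen := RatFunc.Luroth.eq_adjoin_generator (E := E)
    have hnc := RatFunc.Luroth.generator_ne_C hbot
    have hg0 := RatFunc.Luroth.generator_ne_zero hbot
    generalize RatFunc.Luroth.generator E = r at hgen hnc hg0
    have hr := RatFunc.num_div_denom r
    have hcop := RatFunc.isCoprime_num_denom r
    have hd0 := RatFunc.denom_ne_zero r
    have hn0 := RatFunc.num_ne_zero hg0
    generalize r.num = n at *
    generalize r.denom = d at *
    have hd0' : algebraMap ℂ[X] (RatFunc ℂ) d ≠ 0 := by simpa using hd0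
    rcases lt_or_ge d.natDegree n.natDegree with hlt | hge
    · exact ⟨n, d, hd0, hcop, hlt, by rw [hr]; exact hgen⟩
    obtain ⟨c, hc⟩ : ∃ c : ℂ, (n - C c * d).natDegree < d.natDegree := by
      have hdpos : 0 < d.natDegree := by
        by_contra h0
        obtain ⟨b, rfl⟩ := natDegree_eq_zero.mp (Nat.eq_zero_of_not_pos h0)
        obtain ⟨a, rfl⟩ := natDegree_eq_zero.mp (Nat.eq_zero_of_le_zero (hge.trans (by simp)))
        exact hnc ⟨a / b, by rw [← hr]; simp⟩
      refine ⟨n.coeff d.natDegree / d.leadingCoeff, ?_⟩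
      refine natDegree_lt_of_coeff_eq_zero hdpos fun m hm ↦ ?_
      rcases hm.eq_or_lt with rfl | hm
      · rw [coeff_sub, coeff_C_mul, ← leadingCoeff,
          div_mul_cancel₀ _ (leadingCoeff_ne_zero.mpr hd0), sub_self]
      · rw [coeff_sub, coeff_C_mul, coeff_eq_zero_of_natDegree_lt hm,
          coeff_eq_zero_of_natDegree_lt (hge.trans_lt hm)]; simp
    have hrc : r - RatFunc.C c =
        algebraMap ℂ[X] (RatFunc ℂ) (n - C c * d) / algebraMap ℂ[X] (RatFunc ℂ) d := by
      rw [map_sub, map_mul, sub_div, hr, mul_div_cancel_right₀ _ hd0', RatFunc.algebraMap_C]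
    have hne : n - C c * d ≠ 0 := by
      intro h0
      rw [h0, map_zero, zero_div, sub_eq_zero] at hrc
      exact hnc ⟨c, hrc⟩
    refine ⟨d, n - C c * d, hne, ?_, by omega, ?_⟩
    · have := IsCoprime.add_mul_right_left hcop (-C c)
      rw [neg_mul, ← sub_eq_add_neg] at this
      exact this.symm
    · rw [← inv_div, ← hrc]
      have hC : ∀ F : IntermediateField ℂ (RatFunc ℂ), RatFunc.C c ∈ F :=
        fun F ↦ F.algebraMap_mem c
      refine le_antisymm (hgen.le.trans ?_) ?_
      · rw [IntermediateField.adjoin_simple_le_iff]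
        have h1 := inv_mem (IntermediateField.mem_adjoin_simple_self ℂ (r - RatFunc.C c)⁻¹)
        rw [inv_inv] at h1
        simpa using add_mem h1 (hC _)
      · rw [IntermediateField.adjoin_simple_le_iff]
        exact inv_mem (sub_mem (hgen ▸ IntermediateField.mem_adjoin_simple_self ℂ r) (hC _))
  have hq' : algebraMap ℂ[X] (RatFunc ℂ) q ≠ 0 := by simpa using hq
  obtain ⟨S, hS⟩ := exists_aeval_of_mem_adjoin hq hpq hdeg hh0 (hEz ▸ hE)
  have hpoly : h * q ^ S.natDegree = homogEval p q S S.natDegree := by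
    apply RatFunc.algebraMap_injective ℂ
    rw [algebraMap_homogEval hq le_rfl, ← hS, map_mul, map_pow, mul_comm]
  have hSd : 0 < S.natDegree := by
    by_contra h0
    obtain ⟨c, rfl⟩ := natDegree_eq_zero.mp (Nat.eq_zero_of_not_pos h0)
    simp [homogEval] at hpoly
    simp [hpoly] at hh
  have hS0 : S.leadingCoeff ≠ 0 := leadingCoeff_ne_zero.mpr (by rintro rfl; simp at hSd)
  have hdvd : q ∣ p ^ S.natDegree := by
    have h1 : q ∣ ∑ i ∈ Finset.range S.natDegree,
        C (S.coeff i) * p ^ i * q ^ (S.natDegree - i) :=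
      Finset.dvd_sum fun i hi ↦ Dvd.dvd.mul_left
        (dvd_pow_self q (by have := Finset.mem_range.mp hi; omega)) _
    rw [homogEval, Finset.sum_range_succ, Nat.sub_self, pow_zero, mul_one] at hpoly
    have h2 := (dvd_add_right h1).mp (hpoly ▸ Dvd.dvd.mul_left (dvd_pow_self q hSd.ne') h)
    exact (isUnit_C.mpr (Ne.isUnit hS0)).dvd_mul_left.mp h2
  obtain ⟨c, hcu, hc⟩ := isUnit_iff.mp ((hpq.symm.pow_right).isUnit_of_dvd' dvd_rfl hdvd)
  have hc0 : c ≠ 0 := hcu.ne_zero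
  refine ⟨C c⁻¹ * p, ?_, ?_⟩
  · rw [natDegree_C_mul (inv_ne_zero hc0)]; omega
  · rw [hEz, ← hc]
    congr 2
    rw [div_eq_iff (by simpa using hc0), ← map_mul, mul_right_comm, ← C_mul, inv_mul_cancel₀ hc0]
    simp

theorem natDegree_eq_finrank (ρ : ℂ[X]) :
    Module.finrank (IntermediateField.adjoin ℂ {algebraMap ℂ[X] (RatFunc ℂ) ρ}) (RatFunc ℂ) =
      ρ.natDegree := by
  rw [RatFunc.finrank_eq_max_natDegree, RatFunc.num_algebraMap, RatFunc.denom_algebraMap]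
  simp

/-- If `h` is an indecomposable right factor and `h'` another right factor of a polynomial, then
either their degrees are coprime or `deg h ∣ deg h'`. -/
theorem gcd_eq_one_or_dvd {h h' Q Q' : ℂ[X]} (hi : Indecomposable h) (hh' : 0 < h'.natDegree)
    (hQ : 0 < Q.natDegree) (e : Q.comp h = Q'.comp h') :
    Nat.gcd h.natDegree h'.natDegree = 1 ∨ h.natDegree ∣ h'.natDegree := by
  have hh : 0 < h.natDegree := by have := hi.1; omega
  have hP : 0 < (Q.comp h).natDegree := by rw [natDegree_comp]; exact Nat.mul_pos hQ hh
  have hh0 : h ≠ 0 := by rintro rfl; simp at hh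
  have hh0' : h' ≠ 0 := by rintro rfl; simp at hh'
  by_contra! hcon
  obtain ⟨hg1, hndvd⟩ := hcon
  obtain ⟨u, v, -, huv, hl, -⟩ := exists_lcm_factor hP rfl e
  obtain ⟨ρ, hρ, hE⟩ := exists_polynomial_generator (IntermediateField.adjoin ℂ
    {algebraMap ℂ[X] (RatFunc ℂ) h, algebraMap ℂ[X] (RatFunc ℂ) h'}) hh
    (IntermediateField.subset_adjoin _ _ (by simp))
  obtain ⟨s, hs⟩ := exists_comp_of_mem_adjoin hρ hh0
    (hE ▸ IntermediateField.subset_adjoin _ _ (by simp))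
  obtain ⟨s', hs'⟩ := exists_comp_of_mem_adjoin hρ hh0'
    (hE ▸ IntermediateField.subset_adjoin _ _ (by simp))
  have hsd : h.natDegree = s.natDegree * ρ.natDegree := by rw [hs, natDegree_comp]
  have hsd' : h'.natDegree = s'.natDegree * ρ.natDegree := by rw [hs', natDegree_comp]
  rcases (le_or_gt 2 ρ.natDegree) with hρ2 | hρ1
  · have hs1 : s.natDegree = 1 := by
      by_contra hne
      refine hi.2 ⟨s, ρ, ?_, hρ2, hs⟩
      have : s.natDegree ≠ 0 := by intro h0; rw [h0, zero_mul] at hsd; omega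
      omega
    apply hndvd
    rw [hsd, hs1, one_mul, hsd']
    exact dvd_mul_left _ _
  have hρe : ρ.natDegree = 1 := by omega
  set F := IntermediateField.adjoin ℂ {algebraMap ℂ[X] (RatFunc ℂ) h} with hF
  have htop : IntermediateField.adjoin F {algebraMap ℂ[X] (RatFunc ℂ) h'} = ⊤ := by
    have h1 := IntermediateField.adjoin_simple_adjoin_simple ℂ (algebraMap ℂ[X] (RatFunc ℂ) h)
      (algebraMap ℂ[X] (RatFunc ℂ) h')
    rw [hE] at h1
    have h2 := natDegree_eq_finrank ρ
    rw [hρe] at h2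
    rw [IntermediateField.finrank_eq_one_iff_eq_top.mp h2] at h1
    exact IntermediateField.restrictScalars_eq_top_iff.mp h1
  have hfin : Module.finrank F (RatFunc ℂ) = h.natDegree := natDegree_eq_finrank h
  let hgen : F := ⟨algebraMap ℂ[X] (RatFunc ℂ) h, IntermediateField.mem_adjoin_simple_self _ _⟩
  let f : F[X] := v.map (algebraMap ℂ F) - C (aeval hgen u)
  have hfr : aeval (algebraMap ℂ[X] (RatFunc ℂ) h') f = 0 := by
    have h1 : ∀ a b : ℂ[X], algebraMap ℂ[X] (RatFunc ℂ) (a.comp b) =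
        aeval (algebraMap ℂ[X] (RatFunc ℂ) b) a := fun a b ↦ by
      rw [aeval_algebraMap_apply, comp, aeval_def, Polynomial.algebraMap_eq]
    rw [map_sub, aeval_map_algebraMap, aeval_C, ← aeval_algebraMap_apply, ← h1, ← huv, h1]
    exact sub_self _
  have hgv : Nat.gcd h.natDegree h'.natDegree * v.natDegree = h.natDegree := by
    apply Nat.eq_of_mul_eq_mul_right hh'
    rw [mul_assoc, ← natDegree_comp, ← huv, hl, Nat.gcd_mul_lcm]
  have hvpos : 0 < v.natDegree := Nat.pos_of_ne_zero fun h0 ↦ by rw [h0] at hgv; omega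
  have hfd : f.natDegree = v.natDegree := by
    rw [natDegree_sub_C, natDegree_map]
  have hf0 : f ≠ 0 := by intro h0; rw [h0, natDegree_zero] at hfd; omega
  have hint : IsIntegral F (algebraMap ℂ[X] (RatFunc ℂ) h') :=
    (IsAlgebraic.isIntegral ⟨f, hf0, hfr⟩)
  have hle := IntermediateField.adjoin.finrank hint
  rw [htop, IntermediateField.finrank_top', hfin] at hle
  have hle2 := natDegree_le_of_dvd (minpoly.dvd F _ hfr) hf0
  rw [← hle, hfd] at hle2
  have : 2 ≤ Nat.gcd h.natDegree h'.natDegree := by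
    have := Nat.gcd_pos_of_pos_left h'.natDegree hh
    omega
  nlinarith

theorem eq_zero_of_sum_comp_mul_pow {b d : ℂ[X]} {m : ℕ} (hd : d.natDegree = m)
    (hcop : Nat.Coprime m b.natDegree) (hm : 0 < m) (hb : b ≠ 0) (h : ℕ → ℂ[X])
    (e : ∑ i ∈ Finset.range m, (h i).comp d * b ^ i = 0) : ∀ i < m, h i = 0 := by
  have hcomp : ∀ i, h i ≠ 0 → (h i).comp d ≠ 0 := fun i hi h0 ↦ by
    rcases comp_eq_zero_iff.mp h0 with h1 | ⟨_, h2⟩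
    · exact hi h1
    · rw [h2, natDegree_C] at hd; omega
  have hdeg : ∀ i, h i ≠ 0 → ((h i).comp d * b ^ i).natDegree =
      (h i).natDegree * m + i * b.natDegree := fun i hi ↦ by
    rw [natDegree_mul (hcomp i hi) (pow_ne_zero _ hb), natDegree_comp, hd, natDegree_pow]
  have hne : ∀ i, (h i).comp d * b ^ i ≠ 0 → h i ≠ 0 := by
    rintro i hi h0
    simp [h0] at hi
  have hsup := degree_sum_eq_of_disjoint (fun i ↦ (h i).comp d * b ^ i) (Finset.range m) (by
    rintro i ⟨hi, hi0⟩ j ⟨hj, hj0⟩ hij hdd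
    have := natDegree_eq_of_degree_eq hdd
    rw [hdeg i (hne i hi0), hdeg j (hne j hj0)] at this
    apply hij
    have h1 : i * b.natDegree ≡ j * b.natDegree [MOD m] := by
      have h2 : (h i).natDegree * m + i * b.natDegree ≡
        (h j).natDegree * m + j * b.natDegree [MOD m] := congrArg (· % m) this
      simpa [Nat.ModEq] using h2
    have h3 := Nat.ModEq.cancel_right_of_coprime hcop h1
    exact Nat.ModEq.eq_of_lt_of_lt h3 (Finset.mem_range.mp hi) (Finset.mem_range.mp hj))
  rw [e, degree_zero] at hsup
  intro i hi
  by_contra h0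
  have hle := Finset.le_sup (f := fun i ↦ degree ((h i).comp d * b ^ i)) (Finset.mem_range.mpr hi)
  rw [← hsup, le_bot_iff, degree_eq_bot] at hle
  exact mul_ne_zero (hcomp i h0) (pow_ne_zero _ hb) hle

/-- There is a bivariate polynomial whose value at `V = v` is, up to a constant,
`∏ (U - b(x))` over the roots `x` of `d - v`. -/
theorem exists_bivariate_prod (b d : ℂ[X]) (hd : 0 < d.natDegree) :
    ∃ F : ℂ[X][X], ∀ v : ℂ, F.map (evalRingHom v) = C (d.leadingCoeff ^ b.natDegree) *
      ((d - C v).roots.map fun x ↦ X - C (b.eval x)).prod := by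
  refine ⟨resultant (d.map ((C : ℂ[X] →+* ℂ[X][X]).comp C) - C (C X))
    (C X - b.map ((C : ℂ[X] →+* ℂ[X][X]).comp C)) d.natDegree b.natDegree, fun v ↦ ?_⟩
  refine Polynomial.funext fun u ↦ ?_
  have hdv : (d - C v).natDegree = d.natDegree := natDegree_sub_C
  have hlc : (d - C v).leadingCoeff = d.leadingCoeff :=
    leadingCoeff_sub_of_degree_lt (degree_C_le.trans_lt (natDegree_pos_iff_degree_pos.mp hd))
  have h1 := resultant_eq_prod_eval (d - C v) (C u - b) b.natDegree
    ((natDegree_sub_le _ _).trans (by simp)) (IsAlgClosed.splits _)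
  rw [hdv, hlc] at h1
  have h2 : eval u (C (d.leadingCoeff ^ b.natDegree) *
      ((d - C v).roots.map fun x ↦ X - C (b.eval x)).prod) =
      d.leadingCoeff ^ b.natDegree * ((d - C v).roots.map (C u - b).eval).prod := by
    rw [eval_mul, eval_C, eval_multiset_prod, Multiset.map_map]
    simp
  rw [h2, ← h1, ← coe_evalRingHom, ← coe_mapRingHom, ← RingHom.comp_apply, ← resultant_map_map]
  have hid : ((evalRingHom u).comp (mapRingHom (evalRingHom v))).comp
      ((C : ℂ[X] →+* ℂ[X][X]).comp C) = RingHom.id ℂ := by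
    ext z; simp
  congr 1
  · rw [Polynomial.map_sub, Polynomial.map_map, hid]; simp
  · rw [Polynomial.map_sub, Polynomial.map_map, hid]; simp

/-- The resultant identity behind Ritt's second theorem: the polynomial `a - c(v)` is, up to a
constant, the product of `U - b(x)` over the roots `x` of `d - v`. -/
theorem sub_eq_prod_roots {a b c d : ℂ[X]} (e : a.comp b = c.comp d)
    (had : a.natDegree = d.natDegree) (ha : 0 < a.natDegree)
    (hcop : Nat.Coprime a.natDegree b.natDegree) (hb : b ≠ 0) (v : ℂ) :
    a - C (c.eval v) = C a.leadingCoeff *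
      ((d - C v).roots.map fun x ↦ X - C (b.eval x)).prod := by
  obtain ⟨F, hF⟩ := exists_bivariate_prod b d (had ▸ ha)
  set l := d.leadingCoeff ^ b.natDegree with hl
  have hd0 : d ≠ 0 := by rintro rfl; simp at had; omega
  have hl0 : l ≠ 0 := pow_ne_zero _ (leadingCoeff_ne_zero.mpr hd0)
  have ha0 : a ≠ 0 := by rintro rfl; simp at ha
  have hcard : ∀ v, Multiset.card (d - C v).roots = a.natDegree := fun v ↦ by
    rw [← (IsAlgClosed.splits (d - C v)).natDegree_eq_card_roots, natDegree_sub_C, had]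
  have hmon : ∀ v, ((d - C v).roots.map fun x ↦ X - C (b.eval x)).prod.Monic := fun v ↦
    monic_multiset_prod_of_monic _ _ fun x _ ↦ monic_X_sub_C _
  have hdegp : ∀ v, ((d - C v).roots.map fun x ↦ X - C (b.eval x)).prod.natDegree =
      a.natDegree := fun v ↦ by
    have := natDegree_multiset_prod_X_sub_C_eq_card ((d - C v).roots.map b.eval)
    rw [Multiset.map_map, Multiset.card_map, hcard] at this
    exact this
  let H : ℂ[X][X] := C (C l) * a.map C - C (C l * c) - C (C a.leadingCoeff) * F
  have hHv : ∀ v, H.map (evalRingHom v) = C l * (a - C (c.eval v)) -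
      C a.leadingCoeff * F.map (evalRingHom v) := fun v ↦ by
    have hid : (evalRingHom v).comp (C : ℂ →+* ℂ[X]) = RingHom.id ℂ := by ext z; simp
    simp only [H, Polynomial.map_sub, Polynomial.map_mul, Polynomial.map_C, Polynomial.map_map, hid,
      Polynomial.map_id, coe_evalRingHom, eval_C, C_mul]
    ring
  have hHdeg : ∀ i, a.natDegree ≤ i → H.coeff i = 0 := by
    intro i hi
    refine Polynomial.funext fun v ↦ ?_
    have h1 := congrArg (coeff · i) (hHv v)
    simp only [coeff_map, coe_evalRingHom] at h1
    rw [h1, eval_zero, hF, coeff_sub, coeff_C_mul, coeff_C_mul, coeff_C_mul, coeff_sub, coeff_C,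
      if_neg (by omega)]
    rcases hi.eq_or_lt with rfl | hi
    · have h2 := (hmon v).coeff_natDegree
      rw [hdegp] at h2
      rw [h2, ← leadingCoeff]; ring
    · rw [coeff_eq_zero_of_natDegree_lt hi, coeff_eq_zero_of_natDegree_lt ((hdegp v).trans_lt hi)]
      ring
  have hHlt : H.natDegree < a.natDegree := by
    by_contra hle
    have h1 := hHdeg _ (not_lt.mp hle)
    rw [coeff_natDegree, leadingCoeff_eq_zero] at h1
    rw [h1, natDegree_zero] at hle
    exact hle ha
  have hHz : H = 0 := by
    have hz := eq_zero_of_sum_comp_mul_pow had.symm hcop ha hb H.coeff (by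
      refine Polynomial.funext fun x ↦ ?_
      have h1 : (H.map (evalRingHom (d.eval x))).eval (b.eval x) = 0 := by
        have hx : x ∈ (d - C (d.eval x)).roots := by
          rw [mem_roots']
          refine ⟨?_, by simp⟩
          intro h0
          have := hcard (d.eval x)
          rw [h0, roots_zero, Multiset.card_zero] at this
          omega
        have h2 : ((d - C (d.eval x)).roots.map fun x ↦ X - C (b.eval x)).prod.eval (b.eval x)
            = 0 := by
          rw [eval_multiset_prod, Multiset.map_map]
          exact Multiset.prod_eq_zero (Multiset.mem_map.mpr ⟨x, hx, by simp⟩)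
        have h3 := congrArg (eval x) e
        rw [eval_comp, eval_comp] at h3
        rw [hHv, hF]
        simp [h2, h3]
      rw [eval_map, eval₂_eq_sum_range' _ hHlt] at h1
      rw [eval_finsetSum, eval_zero, ← h1]
      simp [eval_comp])
    ext1 i
    rcases lt_or_ge i a.natDegree with hi | hi
    · rw [hz i hi, coeff_zero]
    · rw [hHdeg i hi, coeff_zero]
  have h4 := hHv v
  rw [hHz, Polynomial.map_zero, hF, eq_comm, sub_eq_zero] at h4
  apply mul_left_cancel₀ (C_ne_zero.mpr hl0)
  rw [h4]; ring

/-- The fibre of `f` over `v`. -/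
def fib (f : ℂ[X]) (v : ℂ) : Finset ℂ := (f - C v).roots.toFinset

/-- The ramification index of `f` at `x`. -/
def ram (f : ℂ[X]) (x : ℂ) : ℕ := (f - C (f.eval x)).rootMultiplicity x

theorem sub_C_ne_zero {f : ℂ[X]} (hf : 0 < f.natDegree) (v : ℂ) : f - C v ≠ 0 := by
  intro h0
  rw [← natDegree_sub_C (a := v), h0, natDegree_zero] at hf
  exact hf.ne rfl

theorem mem_fib {f : ℂ[X]} (hf : 0 < f.natDegree) {v x : ℂ} : x ∈ fib f v ↔ f.eval x = v := by
  rw [fib, Multiset.mem_toFinset, mem_roots (sub_C_ne_zero hf v)]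
  simp [sub_eq_zero]

theorem ram_pos {f : ℂ[X]} (hf : 0 < f.natDegree) (x : ℂ) : 0 < ram f x :=
  (rootMultiplicity_pos (sub_C_ne_zero hf _)).mpr (by simp)

theorem ram_eq {f : ℂ[X]} {x v : ℂ} (h : f.eval x = v) :
    ram f x = (f - C v).rootMultiplicity x := by rw [ram, h]

theorem sum_ram {f : ℂ[X]} (hf : 0 < f.natDegree) (v : ℂ) :
    ∑ x ∈ fib f v, ram f x = f.natDegree := by
  have h1 := (IsAlgClosed.splits (f - C v)).natDegree_eq_card_roots
  rw [natDegree_sub_C, ← Multiset.toFinset_sum_count_eq] at h1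
  rw [h1]
  refine Finset.sum_congr rfl fun x hx ↦ ?_
  rw [count_roots, ram_eq ((mem_fib hf).mp hx)]

theorem card_fib_le {f : ℂ[X]} (hf : 0 < f.natDegree) (v : ℂ) :
    (fib f v).card ≤ f.natDegree := by
  rw [← sum_ram hf v, Finset.card_eq_sum_ones]
  exact Finset.sum_le_sum fun x _ ↦ ram_pos hf x

theorem card_fib_pos {f : ℂ[X]} (hf : 0 < f.natDegree) (v : ℂ) : 0 < (fib f v).card := by
  obtain ⟨x, hx⟩ := exists_eval_eq hf v
  exact Finset.card_pos.mpr ⟨x, (mem_fib hf).mpr hx⟩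

theorem rootMultiplicity_derivative {f : ℂ[X]} (x : ℂ) :
    (derivative f).rootMultiplicity x = ram f x - 1 := by
  have := derivative_rootMultiplicity_of_root (p := f - C (f.eval x)) (t := x) (by simp)
  rw [ram, ← this]; simp

theorem card_add_sum_derivative {f : ℂ[X]} (hf : 0 < f.natDegree) (v : ℂ) :
    (fib f v).card + ∑ x ∈ fib f v, (derivative f).roots.count x = f.natDegree := by
  rw [← sum_ram hf v, Finset.card_eq_sum_ones, ← Finset.sum_add_distrib]
  refine Finset.sum_congr rfl fun x _ ↦ ?_
  rw [count_roots, rootMultiplicity_derivative]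
  have := ram_pos hf x
  omega

theorem card_roots_derivative {f : ℂ[X]} :
    Multiset.card (derivative f).roots = f.natDegree - 1 := by
  rw [← (IsAlgClosed.splits _).natDegree_eq_card_roots, natDegree_derivative]

theorem sum_defect_eq_sum {f : ℂ[X]} (hf : 0 < f.natDegree) (T : Finset ℂ) :
    ∑ v ∈ T, (f.natDegree - (fib f v).card) =
      ∑ x ∈ T.biUnion (fib f), (derivative f).roots.count x := by
  rw [Finset.sum_biUnion]
  · exact Finset.sum_congr rfl fun v _ ↦ by
      have := card_add_sum_derivative hf v; omega
  · intro v _ v' _ hne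
    refine Finset.disjoint_left.mpr fun x hx hx' ↦ hne ?_
    rw [← (mem_fib hf).mp hx, ← (mem_fib hf).mp hx']

theorem sum_defect_le {f : ℂ[X]} (hf : 0 < f.natDegree) (T : Finset ℂ) :
    ∑ v ∈ T, (f.natDegree - (fib f v).card) ≤ f.natDegree - 1 := by
  rw [sum_defect_eq_sum hf, ← card_roots_derivative, ← Multiset.toFinset_sum_count_eq]
  rw [← Finset.sum_inter_add_sum_sdiff _ (derivative f).roots.toFinset]
  have h1 : ∑ x ∈ T.biUnion (fib f) \ (derivative f).roots.toFinset,
      (derivative f).roots.count x = 0 := Finset.sum_eq_zero fun x hx ↦ by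
    rw [Finset.mem_sdiff, Multiset.mem_toFinset] at hx
    exact Multiset.count_eq_zero.mpr hx.2
  rw [h1, add_zero]
  exact Finset.sum_le_sum_of_subset Finset.inter_subset_right

theorem sum_defect_eq {f : ℂ[X]} (hf : 0 < f.natDegree) (T : Finset ℂ)
    (hT : ∀ v ∉ T, (fib f v).card = f.natDegree) :
    ∑ v ∈ T, (f.natDegree - (fib f v).card) = f.natDegree - 1 := by
  refine (sum_defect_le hf T).antisymm ?_
  rw [sum_defect_eq_sum hf, ← card_roots_derivative, ← Multiset.toFinset_sum_count_eq]
  refine Finset.sum_le_sum_of_subset fun x hx ↦ ?_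
  rw [Finset.mem_biUnion]
  refine ⟨f.eval x, ?_, (mem_fib hf).mpr rfl⟩
  by_contra hv
  have h1 := card_add_sum_derivative hf (f.eval x)
  rw [hT _ hv, Nat.add_eq_left, Finset.sum_eq_zero_iff] at h1
  exact Multiset.count_ne_zero.mpr (Multiset.mem_toFinset.mp hx) (h1 x ((mem_fib hf).mpr rfl))

theorem ram_comp {f g : ℂ[X]} (hf : 0 < f.natDegree) (hg : 0 < g.natDegree) (x : ℂ) :
    ram (f.comp g) x = ram f (g.eval x) * ram g x := by
  obtain ⟨q, hq, hqr⟩ := exists_eq_pow_rootMultiplicity_mul_and_not_dvd _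
    (sub_C_ne_zero hf (f.eval (g.eval x))) (g.eval x)
  rw [dvd_iff_isRoot, IsRoot.def] at hqr
  have h1 : f.comp g - C ((f.comp g).eval x) =
      (g - C (g.eval x)) ^ ram f (g.eval x) * q.comp g := by
    have := congrArg (comp · g) hq
    simpa [ram] using this
  have h2 : f.comp g - C ((f.comp g).eval x) ≠ 0 :=
    sub_C_ne_zero (by rw [natDegree_comp]; exact Nat.mul_pos hf hg) _
  have h3 : (q.comp g).rootMultiplicity x = 0 := rootMultiplicity_eq_zero (by simpa using hqr)
  have h4 : rootMultiplicity x ((g - C (g.eval x)) ^ ram f (g.eval x)) =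
      ram f (g.eval x) * ram g x := by
    rw [← count_roots, roots_pow, Multiset.count_nsmul, count_roots]; rfl
  rw [ram, h1, rootMultiplicity_mul (h1 ▸ h2), h3, h4, add_zero]

/-- A polynomial all of whose root multiplicities are divisible by `k` is a `k`-th power. -/
theorem exists_eq_pow_of_dvd {f : ℂ[X]} {k : ℕ} (hk : 0 < k)
    (h : ∀ x, k ∣ f.rootMultiplicity x) : ∃ s : ℂ[X], f = s ^ k := by
  obtain ⟨z, hz⟩ := IsAlgClosed.exists_pow_nat_eq f.leadingCoeff hk
  refine ⟨C z * ∏ x ∈ f.roots.toFinset, (X - C x) ^ (f.rootMultiplicity x / k), ?_⟩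
  rw [mul_pow, ← C_pow, hz, ← Finset.prod_pow]
  conv_lhs => rw [(IsAlgClosed.splits f).eq_prod_roots]
  rw [Finset.prod_multiset_map_count]
  congr 1
  refine Finset.prod_congr rfl fun x _ ↦ ?_
  rw [← pow_mul, Nat.div_mul_cancel (h x), count_roots]

section Square
variable {a b c d : ℂ[X]}

/-- The hypotheses of Ritt's second theorem, except for indecomposability. -/
structure CoprimeSquare (a b c d : ℂ[X]) : Prop where
  comp_eq : a.comp b = c.comp d
  deg_eq : a.natDegree = d.natDegree
  deg_pos : 0 < a.natDegree
  deg_pos' : 0 < b.natDegree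
  coprime : Nat.Coprime a.natDegree b.natDegree

theorem CoprimeSquare.natDegree_d_pos (h : CoprimeSquare a b c d) : 0 < d.natDegree :=
  h.deg_eq ▸ h.deg_pos

theorem CoprimeSquare.deg_eq' (h : CoprimeSquare a b c d) : c.natDegree = b.natDegree := by
  have := congrArg natDegree h.comp_eq
  rw [natDegree_comp, natDegree_comp, h.deg_eq, mul_comm] at this
  exact (Nat.eq_of_mul_eq_mul_right h.natDegree_d_pos this).symm

theorem CoprimeSquare.natDegree_c_pos (h : CoprimeSquare a b c d) : 0 < c.natDegree :=
  h.deg_eq' ▸ h.deg_pos'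

theorem CoprimeSquare.ram_mul (h : CoprimeSquare a b c d) (x : ℂ) :
    ram a (b.eval x) * ram b x = ram c (d.eval x) * ram d x := by
  rw [← ram_comp h.deg_pos h.deg_pos', h.comp_eq, ram_comp h.natDegree_c_pos h.natDegree_d_pos]

/-- The points of the curve `a(u) = c(v)`, parametrised by `x ↦ (b(x), d(x))`, lying over
`(u, v)`. -/
theorem CoprimeSquare.sum_ram_d (h : CoprimeSquare a b c d) {u v : ℂ} (huv : a.eval u = c.eval v) :
    ∑ x ∈ (fib d v).filter (fun x ↦ b.eval x = u), ram d x = ram a u := by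
  have hb0 : b ≠ 0 := by rintro rfl; exact absurd h.deg_pos' (by simp)
  have ha0 : a ≠ 0 := by rintro rfl; exact absurd h.deg_pos (by simp)
  have h1 := congrArg (rootMultiplicity u)
    (sub_eq_prod_roots h.comp_eq h.deg_eq h.deg_pos h.coprime hb0 v)
  rw [← ram_eq huv, ← count_roots, roots_C_mul _ (leadingCoeff_ne_zero.mpr ha0)] at h1
  have h2 := roots_multiset_prod_X_sub_C ((d - C v).roots.map b.eval)
  rw [Multiset.map_map] at h2
  simp only [Function.comp_def] at h2
  rw [h2, Multiset.count_map, ← Multiset.toFinset_sum_count_eq] at h1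
  rw [h1, Multiset.toFinset_filter]
  simp only [eq_comm (a := u)]
  refine Finset.sum_congr rfl fun x hx ↦ ?_
  have hx' := Finset.mem_filter.mp hx
  rw [Multiset.count_filter, if_pos hx'.2, count_roots,
    ram_eq ((mem_fib h.natDegree_d_pos).mp hx'.1)]

theorem CoprimeSquare.eval_eq (h : CoprimeSquare a b c d) {v x : ℂ} (hx : x ∈ fib d v) :
    a.eval (b.eval x) = c.eval v := by
  have := congrArg (eval x) h.comp_eq
  rwa [eval_comp, eval_comp, (mem_fib h.natDegree_d_pos).mp hx] at this

theorem CoprimeSquare.ram_d_le (h : CoprimeSquare a b c d) (x : ℂ) :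
    ram d x ≤ ram a (b.eval x) := by
  have hx : x ∈ fib d (d.eval x) := (mem_fib h.natDegree_d_pos).mpr rfl
  rw [← h.sum_ram_d (h.eval_eq hx)]
  exact Finset.single_le_sum (f := ram d) (fun _ _ ↦ Nat.zero_le _)
    (Finset.mem_filter.mpr ⟨hx, rfl⟩)

theorem CoprimeSquare.div_gcd_dvd (h : CoprimeSquare a b c d) (x : ℂ) :
    ram a (b.eval x) / Nat.gcd (ram a (b.eval x)) (ram c (d.eval x)) ∣ ram d x := by
  have hp := Nat.gcd_pos_of_pos_left (ram c (d.eval x)) (ram_pos h.deg_pos (b.eval x))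
  refine (Nat.coprime_div_gcd_div_gcd hp).dvd_of_dvd_mul_left ⟨ram b x, ?_⟩
  apply Nat.eq_of_mul_eq_mul_left hp
  rw [← mul_assoc, ← mul_assoc, Nat.mul_div_cancel' (Nat.gcd_dvd_left _ _),
    Nat.mul_div_cancel' (Nat.gcd_dvd_right _ _), h.ram_mul]

/-- A lower bound, in terms of `a` and `c`, for the contribution of a point in the target of `d` to
the total ramification of `d`. -/
def cost (a : ℂ[X]) (l : ℂ) (g : ℕ) : ℕ := ∑ u ∈ fib a l, (ram a u - Nat.gcd (ram a u) g)

theorem cost_add_sum_gcd (ha : 0 < a.natDegree) (l : ℂ) (g : ℕ) :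
    cost a l g + ∑ u ∈ fib a l, Nat.gcd (ram a u) g = a.natDegree := by
  rw [cost, ← Finset.sum_add_distrib, ← sum_ram ha l]
  refine Finset.sum_congr rfl fun u _ ↦ Nat.sub_add_cancel ?_
  exact Nat.gcd_le_left _ (ram_pos ha u)

theorem CoprimeSquare.card_fib_d_le (h : CoprimeSquare a b c d) (v : ℂ) :
    (fib d v).card ≤ ∑ u ∈ fib a (c.eval v), Nat.gcd (ram a u) (ram c v) := by
  rw [Finset.card_eq_sum_card_fiberwise (f := b.eval) (t := fib a (c.eval v))
    fun x hx ↦ (mem_fib h.deg_pos).mpr (h.eval_eq hx)]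
  refine Finset.sum_le_sum fun u hu ↦ ?_
  have hp := Nat.gcd_pos_of_pos_left (ram c v) (ram_pos h.deg_pos u)
  have hq : 0 < ram a u / Nat.gcd (ram a u) (ram c v) :=
    Nat.div_pos (Nat.gcd_le_left _ (ram_pos h.deg_pos u)) hp
  apply Nat.le_of_mul_le_mul_right _ hq
  rw [Nat.mul_div_cancel' (Nat.gcd_dvd_left _ _), ← h.sum_ram_d ((mem_fib h.deg_pos).mp hu),
    ← smul_eq_mul, h.sum_ram_d ((mem_fib h.deg_pos).mp hu)]
  refine (Finset.card_nsmul_le_sum _ (ram d) _ fun x hx ↦ ?_).trans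
    (h.sum_ram_d ((mem_fib h.deg_pos).mp hu)).le
  rw [Finset.mem_filter] at hx
  have := h.div_gcd_dvd x
  rw [hx.2, (mem_fib h.natDegree_d_pos).mp hx.1] at this
  exact Nat.le_of_dvd (ram_pos h.natDegree_d_pos x) this

theorem CoprimeSquare.sum_cost_le (h : CoprimeSquare a b c d) (T : Finset ℂ) :
    ∑ v ∈ T, cost a (c.eval v) (ram c v) ≤ a.natDegree - 1 := by
  rw [h.deg_eq]
  refine (Finset.sum_le_sum fun v _ ↦ ?_).trans (sum_defect_le h.natDegree_d_pos T)
  have h1 := h.card_fib_d_le v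
  have h2 := cost_add_sum_gcd h.deg_pos (c.eval v) (ram c v)
  rw [h.deg_eq] at h2
  omega

end Square

/-- The critical values of a non-constant polynomial. -/
def critVal (f : ℂ[X]) : Finset ℂ := (derivative f).roots.toFinset.image f.eval

theorem card_fib_of_notMem_critVal {f : ℂ[X]} (hf : 0 < f.natDegree) {v : ℂ}
    (hv : v ∉ critVal f) : (fib f v).card = f.natDegree := by
  have h1 := card_add_sum_derivative hf v
  rwa [Finset.sum_eq_zero, add_zero] at h1
  intro x hx
  by_contra h0
  exact hv (Finset.mem_image.mpr ⟨x, Multiset.mem_toFinset.mpr (Multiset.count_ne_zero.mp h0),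
    (mem_fib hf).mp hx⟩)

theorem card_fib_lt_of_mem_critVal {f : ℂ[X]} (hf : 0 < f.natDegree) {v : ℂ}
    (hv : v ∈ critVal f) : (fib f v).card < f.natDegree := by
  obtain ⟨x, hx, rfl⟩ := Finset.mem_image.mp hv
  have h1 := card_add_sum_derivative hf (f.eval x)
  have h2 := Finset.single_le_sum (f := fun x ↦ (derivative f).roots.count x)
    (fun _ _ ↦ Nat.zero_le _) ((mem_fib hf).mpr (rfl : f.eval x = f.eval x))
  have h3 := Multiset.count_pos.mpr (Multiset.mem_toFinset.mp hx)
  omega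

/-- The number of simple points of `f` over `l`. -/
def numSimple (f : ℂ[X]) (l : ℂ) : ℕ := ((fib f l).filter fun v ↦ ram f v = 1).card

theorem two_mul_card_fib_le {f : ℂ[X]} (hf : 0 < f.natDegree) (l : ℂ) :
    2 * (fib f l).card ≤ f.natDegree + numSimple f l := by
  rw [numSimple, Finset.card_filter, ← sum_ram hf l, ← Finset.sum_add_distrib, mul_comm,
    ← smul_eq_mul]
  refine Finset.card_nsmul_le_sum _ _ _ fun v _ ↦ ?_
  have := ram_pos hf v
  split_ifs <;> omega

/-- All points of `f` over `q` are double, except `p`, which is simple. -/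
structure DoubledExceptAt (f : ℂ[X]) (q p : ℂ) : Prop where
  eval_eq : f.eval p = q
  ram_eq_one : ram f p = 1
  ram_eq_two : ∀ x, f.eval x = q → x ≠ p → ram f x = 2

theorem exists_doubledExceptAt {f : ℂ[X]} (hf : 0 < f.natDegree) {l : ℂ}
    (h1 : numSimple f l = 1) (h2 : 2 * (fib f l).card = f.natDegree + 1) :
    ∃ p, DoubledExceptAt f l p := by
  obtain ⟨p, hp⟩ := Finset.card_eq_one.mp h1
  have hp' : p ∈ (fib f l).filter fun v ↦ ram f v = 1 := hp ▸ Finset.mem_singleton_self p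
  rw [Finset.mem_filter] at hp'
  have huniq : ∀ x ∈ fib f l, ram f x = 1 → x = p := fun x hx hx1 ↦
    Finset.mem_singleton.mp (hp ▸ Finset.mem_filter.mpr ⟨hx, hx1⟩)
  have hge : ∀ x ∈ (fib f l).erase p, 2 ≤ ram f x := fun x hx ↦ by
    have := ram_pos hf x
    have := mt (huniq x (Finset.mem_of_mem_erase hx)) (Finset.ne_of_mem_erase hx)
    omega
  have hsum := Finset.add_sum_erase _ (ram f) hp'.1
  have hcard := Finset.card_erase_of_mem hp'.1
  have hpos := card_fib_pos hf l
  rw [sum_ram hf, hp'.2] at hsum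
  have heq := (Finset.sum_eq_sum_iff_of_le hge).mp (by
    rw [Finset.sum_const, smul_eq_mul]; omega)
  exact ⟨p, (mem_fib hf).mp hp'.1, hp'.2, fun x hx hxp ↦
    (heq x (Finset.mem_erase.mpr ⟨hxp, (mem_fib hf).mpr hx⟩)).symm⟩

theorem cost_one (a : ℂ[X]) (ha : 0 < a.natDegree) (l : ℂ) :
    cost a l 1 + (fib a l).card = a.natDegree := by
  rw [← cost_add_sum_gcd ha l 1, Finset.card_eq_sum_ones]
  simp

theorem ram_dvd_of_cost_eq_zero {a : ℂ[X]} (ha : 0 < a.natDegree) {l : ℂ} {g : ℕ}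
    (h : cost a l g = 0) {u : ℂ} (hu : u ∈ fib a l) : ram a u ∣ g := by
  have h1 := (Finset.sum_eq_zero_iff.mp h) u hu
  have h2 := Nat.gcd_le_left g (ram_pos ha u)
  rw [← Nat.gcd_eq_left_iff_dvd]
  omega

theorem natDegree_le_cost_add {a : ℂ[X]} (ha : 0 < a.natDegree) (l : ℂ) {g : ℕ} (hg : 0 < g) :
    a.natDegree ≤ cost a l g + (fib a l).card * g := by
  rw [← cost_add_sum_gcd ha l g]
  refine Nat.add_le_add_left ?_ _
  rw [← smul_eq_mul]
  exact Finset.sum_le_card_nsmul _ _ _ fun u _ ↦ Nat.gcd_le_right _ hg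

/-- The total cost of the points over `l`. -/
def totalCost (a c : ℂ[X]) (l : ℂ) : ℕ := ∑ v ∈ fib c l, cost a l (ram c v)

theorem numSimple_mul_le (a c : ℂ[X]) (l : ℂ) :
    numSimple c l * cost a l 1 ≤ totalCost a c l := by
  rw [totalCost, numSimple, ← smul_eq_mul, ← Finset.sum_const]
  refine le_trans (le_of_eq ?_) (Finset.sum_le_sum_of_subset
    (Finset.filter_subset (fun v ↦ ram c v = 1) _))
  exact Finset.sum_congr rfl fun v hv ↦ by rw [(Finset.mem_filter.mp hv).2]

theorem CoprimeSquare.sum_totalCost_le {a b c d : ℂ[X]} (h : CoprimeSquare a b c d)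
    (T : Finset ℂ) : ∑ l ∈ T, totalCost a c l ≤ a.natDegree - 1 := by
  refine le_trans (le_of_eq ?_) (h.sum_cost_le (T.biUnion (fib c)))
  rw [Finset.sum_biUnion]
  · exact Finset.sum_congr rfl fun l _ ↦ Finset.sum_congr rfl fun v hv ↦ by
      rw [(mem_fib h.natDegree_c_pos).mp hv]
  · intro v _ v' _ hne
    refine Finset.disjoint_left.mpr fun x hx hx' ↦ hne ?_
    rw [← (mem_fib h.natDegree_c_pos).mp hx, ← (mem_fib h.natDegree_c_pos).mp hx']

theorem CoprimeSquare.card_critVal_le {a b c d : ℂ[X]} (h : CoprimeSquare a b c d)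
    (hlt : a.natDegree < c.natDegree) : (critVal a).card ≤ 2 := by
  have h1 := sum_defect_le h.natDegree_c_pos (critVal a)
  have h2 : ∑ l ∈ critVal a, c.natDegree ≤
      ∑ l ∈ critVal a, (2 * (c.natDegree - (fib c l).card) + totalCost a c l) := by
    refine Finset.sum_le_sum fun l hl ↦ ?_
    have h3 := two_mul_card_fib_le h.natDegree_c_pos l
    have h4 := card_fib_le h.natDegree_c_pos l
    have h5 := numSimple_mul_le a c l
    have h6 := card_fib_lt_of_mem_critVal h.deg_pos hl
    have h7 := cost_one a h.deg_pos l
    have h8 := Nat.le_mul_of_pos_right (numSimple c l) (show 0 < cost a l 1 by omega)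
    omega
  rw [Finset.sum_add_distrib, ← Finset.mul_sum, Finset.sum_const, smul_eq_mul] at h2
  have h3 := h.sum_totalCost_le (critVal a)
  by_contra! h4
  have := Nat.mul_le_mul_right c.natDegree h4
  omega

/-- If two points over `l` have different ramification, the total cost is too big. -/
theorem eq_of_sum_cost_le {F : Finset ℂ} {γ K : ℂ → ℕ} {m D : ℕ} (h2 : ∀ v ∈ F, 2 ≤ γ v)
    (hK : ∑ v ∈ F, K v + D * ∑ v ∈ F, γ v + 2 * D + 1 ≤ m + 2 * D * F.card) (hD : 0 < D)
    (hlow : ∀ v ∈ F, m ≤ K v + (1 + D) * γ v)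
    (hzero : ∀ v ∈ F, ∀ v' ∈ F, γ v' = γ v + 1 → K v' = 0 → m ≤ K v + (1 + D)) :
    ∀ v ∈ F, ∀ v' ∈ F, ¬ γ v < γ v' := by
  intro v hv v' hv' hlt
  have hne : v' ≠ v := by rintro rfl; omega
  have hv'' : v' ∈ F.erase v := Finset.mem_erase.mpr ⟨hne, hv'⟩
  have e1 := Finset.add_sum_erase _ K hv
  have e2 := Finset.add_sum_erase _ K hv''
  have e3 := Finset.add_sum_erase _ γ hv
  have e4 := Finset.add_sum_erase _ γ hv''
  have e5 := Finset.card_erase_add_one hv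
  have e6 := Finset.card_erase_add_one hv''
  have e7 : 2 * ((F.erase v).erase v').card ≤ ∑ x ∈ (F.erase v).erase v', γ x := by
    rw [mul_comm, ← smul_eq_mul]
    exact Finset.card_nsmul_le_sum _ _ _ fun x hx ↦
      h2 x (Finset.mem_of_mem_erase (Finset.mem_of_mem_erase hx))
  have e8 := Nat.mul_le_mul_left D e7
  have e9 : K v + K v' + D * (γ v + γ v') + 1 ≤ m + 2 * D := by
    rw [← e3, ← e4, ← e1, ← e2, ← e5, ← e6] at hK
    generalize ∑ x ∈ (F.erase v).erase v', K x = k at hK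
    generalize ∑ x ∈ (F.erase v).erase v', γ x = g at hK e8
    generalize ((F.erase v).erase v').card = r at hK e8
    nlinarith
  have e10 := hlow v hv
  have e11 := h2 v hv
  obtain ⟨t, ht⟩ : ∃ t, γ v' = γ v + 1 + t := ⟨γ v' - (γ v + 1), by omega⟩
  obtain ⟨g, hg⟩ : ∃ g, γ v = g + 2 := ⟨γ v - 2, by omega⟩
  obtain ⟨D', rfl⟩ : ∃ D', D = D' + 1 := ⟨D - 1, by omega⟩
  rw [ht, hg] at e9
  rw [hg] at e10
  have e12 : K v' + D' * (g + 1) + (D' + 1) * t = 0 := by nlinarith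
  have e13 : D' = 0 := by
    have : D' * (g + 1) = 0 := by omega
    simpa using this
  subst e13
  have e14 : t = 0 := by omega
  have e15 := hzero v hv v' hv' (by omega) (by omega)
  omega

theorem CoprimeSquare.numSimple_pos {a b c d : ℂ[X]} (h : CoprimeSquare a b c d)
    (hc : Indecomposable c) (hlt : a.natDegree < c.natDegree) {l l' : ℂ} (hne : l ≠ l')
    (hl' : (fib a l').card < a.natDegree)
    (hsum : cost a l 1 + cost a l' 1 + 1 = a.natDegree) : 0 < numSimple c l := by
  by_contra! h0
  have hcp := h.natDegree_c_pos
  have hcl := cost_one a h.deg_pos l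
  have hcl' := cost_one a h.deg_pos l'
  have h1 := sum_defect_le hcp {l, l'}
  have h2 := h.sum_totalCost_le {l, l'}
  rw [Finset.sum_pair hne] at h1 h2
  have h3 := two_mul_card_fib_le hcp l'
  have h4 := card_fib_le hcp l'
  have h5 := card_fib_le hcp l
  have h6 := numSimple_mul_le a c l'
  have h7 : c.natDegree + 2 ≤ numSimple c l' + 2 * (fib c l).card := by omega
  have h8 := Nat.mul_le_mul_left (cost a l' 1) h7
  have hD : 0 < cost a l' 1 := by omega
  have h2s : totalCost a c l + totalCost a c l' + 1 ≤ a.natDegree := by omega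
  have hfl : (fib a l).card = 1 + cost a l' 1 := by omega
  have h2' : ∀ v ∈ fib c l, 2 ≤ ram c v := fun v hv ↦ by
    have := ram_pos hcp v
    by_contra! hv2
    exact absurd (Finset.card_pos.mpr ⟨v, Finset.mem_filter.mpr ⟨hv, (by omega : ram c v = 1)⟩⟩)
      h0.not_gt
  have hconst := eq_of_sum_cost_le (F := fib c l) (γ := ram c) (K := fun v ↦ cost a l (ram c v))
    (m := a.natDegree) h2' (by
      rw [sum_ram hcp]
      change totalCost a c l + _ + _ + _ ≤ _
      nlinarith) hD
    (fun v hv ↦ by rw [← hfl]; exact natDegree_le_cost_add h.deg_pos l (ram_pos hcp v))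
    (fun v hv v' hv' hvv h0 ↦ by
      rw [← hfl, ← cost_add_sum_gcd h.deg_pos l (ram c v), Finset.card_eq_sum_ones]
      refine Nat.add_le_add_left (Finset.sum_le_sum fun u hu ↦ ?_) _
      have hdvd := ram_dvd_of_cost_eq_zero h.deg_pos h0 hu
      rw [hvv] at hdvd
      have hcop : Nat.Coprime (ram c v + 1) (ram c v) := by simp
      exact (Nat.Coprime.coprime_dvd_left hdvd hcop).le)
  obtain ⟨v, hv⟩ := Finset.card_pos.mp (card_fib_pos hcp l)
  have hall : ∀ v' ∈ fib c l, ram c v' = ram c v := fun v' hv' ↦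
    le_antisymm (not_lt.mp (hconst v hv v' hv')) (not_lt.mp (hconst v' hv' v hv))
  obtain ⟨s, hs⟩ := exists_eq_pow_of_dvd (f := c - C l) (ram_pos hcp v) (fun x ↦ by
    by_cases hx : x ∈ fib c l
    · rw [← ram_eq ((mem_fib hcp).mp hx), hall x hx]
    · rw [rootMultiplicity_eq_zero]
      · exact dvd_zero _
      · rw [mem_fib hcp] at hx
        simpa [sub_eq_zero] using hx)
  have hdeg := congrArg natDegree hs
  rw [natDegree_sub_C, natDegree_pow] at hdeg
  have hsd : (fib c l).card * ram c v = c.natDegree := by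
    rw [← sum_ram hcp l, Finset.sum_congr rfl hall, Finset.sum_const, smul_eq_mul]
  have hsc : s.natDegree = (fib c l).card := by
    apply Nat.eq_of_mul_eq_mul_left (ram_pos hcp v)
    rw [← hdeg, ← hsd, mul_comm]
  rcases Indecomposable.natDegree_eq_one_or hc (g := X ^ ram c v + C l) (h := s) (by simp [← hs]) with h9 | h9
  · rw [natDegree_add_C, natDegree_X_pow] at h9
    have := h2' v hv
    omega
  · rw [hsc] at h9
    have h10 := Nat.le_mul_of_pos_right (numSimple c l') hD
    omega

theorem Indecomposable.natDegree_eq_two_of_sq {a s : ℂ[X]} {l : ℂ} (ha : Indecomposable a)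
    (hs : a - C l = s ^ 2) : a.natDegree = 2 := by
  have hdeg := congrArg natDegree hs
  rw [natDegree_sub_C, natDegree_pow] at hdeg
  rcases Indecomposable.natDegree_eq_one_or ha (g := X ^ 2 + C l) (h := s) (by simp [← hs]) with h9 | h9
  · rw [natDegree_add_C, natDegree_X_pow] at h9
    omega
  · omega

theorem CoprimeSquare.doubledExceptAt {a b c d : ℂ[X]} (h : CoprimeSquare a b c d)
    {l u v : ℂ} (hu : DoubledExceptAt a l u) (hv : DoubledExceptAt c l v) :
    ∃ x, DoubledExceptAt d v x := by
  have hdp := h.natDegree_d_pos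
  have key := h.sum_ram_d (hu.eval_eq.trans hv.eval_eq.symm)
  rw [hu.ram_eq_one] at key
  obtain ⟨x, hx⟩ : ((fib d v).filter fun x ↦ b.eval x = u).Nonempty := by
    rw [Finset.nonempty_iff_ne_empty]
    intro h0
    rw [h0, Finset.sum_empty] at key
    omega
  obtain ⟨hx1, hx2⟩ := Finset.mem_filter.mp hx
  have hle := fun y ↦ h.ram_d_le y
  refine ⟨x, (mem_fib hdp).mp hx1, ?_, fun y hy hyx ↦ ?_⟩
  · have := hle x
    rw [hx2, hu.ram_eq_one] at this
    have := ram_pos hdp x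
    omega
  · have hyf : y ∈ fib d v := (mem_fib hdp).mpr hy
    have h1 := h.eval_eq hyf
    rw [hv.eval_eq] at h1
    by_cases hby : b.eval y = u
    · exfalso
      have h3 := Finset.sum_le_sum_of_subset (f := ram d)
        (show {x, y} ⊆ (fib d v).filter fun x ↦ b.eval x = u by
          intro z hz
          rcases Finset.mem_insert.mp hz with rfl | hz
          · exact hx
          · rw [Finset.mem_singleton.mp hz]
            exact Finset.mem_filter.mpr ⟨hyf, hby⟩)
      rw [key, Finset.sum_pair hyx.symm] at h3
      have := ram_pos hdp x
      have := ram_pos hdp y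
      omega
    · have h2 := hu.ram_eq_two _ h1 hby
      have h3 := h.ram_mul y
      rw [h2, hy, hv.ram_eq_one] at h3
      have h4 := hle y
      have := ram_pos h.deg_pos' y
      omega

theorem CoprimeSquare.critical_cases {a b c d : ℂ[X]} (h : CoprimeSquare a b c d)
    (ha : Indecomposable a) (hc : Indecomposable c) (hlt : a.natDegree < c.natDegree) :
    (∃ l, (fib a l).card = 1) ∨ ∃ l l' v v' x x', l ≠ l' ∧ DoubledExceptAt c l v ∧
      DoubledExceptAt c l' v' ∧ DoubledExceptAt d v x ∧ DoubledExceptAt d v' x' := by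
  have hm := ha.1
  have hcp := h.natDegree_c_pos
  have hS := h.card_critVal_le hlt
  have hsum := sum_defect_eq h.deg_pos (critVal a) fun v hv ↦
    card_fib_of_notMem_critVal h.deg_pos hv
  obtain hS | hS | hS : (critVal a).card = 0 ∨ (critVal a).card = 1 ∨ (critVal a).card = 2 := by
    omega
  · rw [Finset.card_eq_zero.mp hS, Finset.sum_empty] at hsum
    omega
  · obtain ⟨l, hl⟩ := Finset.card_eq_one.mp hS
    rw [hl, Finset.sum_singleton] at hsum
    have := card_fib_pos h.deg_pos l
    exact Or.inl ⟨l, by omega⟩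
  right
  obtain ⟨l, l', hne, hl⟩ := Finset.card_eq_two.mp hS
  rw [hl, Finset.sum_pair hne] at hsum
  have hd1 := card_fib_lt_of_mem_critVal h.deg_pos (v := l) (by simp [hl])
  have hd2 := card_fib_lt_of_mem_critVal h.deg_pos (v := l') (by simp [hl])
  have hc1 := cost_one a h.deg_pos l
  have hc2 := cost_one a h.deg_pos l'
  have w1 := h.numSimple_pos hc hlt hne hd2 (by omega)
  have w2 := h.numSimple_pos hc hlt hne.symm hd1 (by omega)
  have h1 := sum_defect_le hcp {l, l'}
  have h2 := h.sum_totalCost_le {l, l'}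
  rw [Finset.sum_pair hne] at h1 h2
  have k1 := numSimple_mul_le a c l
  have k2 := numSimple_mul_le a c l'
  have t1 := two_mul_card_fib_le hcp l
  have t2 := two_mul_card_fib_le hcp l'
  have u1 := card_fib_le hcp l
  have u2 := card_fib_le hcp l'
  have w1' : numSimple c l = 1 := by
    by_contra hw
    have := Nat.mul_le_mul_right (cost a l 1) (show 2 ≤ numSimple c l by omega)
    have := Nat.mul_le_mul_right (cost a l' 1) w2
    omega
  have w2' : numSimple c l' = 1 := by
    by_contra hw
    have := Nat.mul_le_mul_right (cost a l' 1) (show 2 ≤ numSimple c l' by omega)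
    rw [w1'] at k1
    omega
  rw [w1', one_mul] at k1
  rw [w2', one_mul] at k2
  obtain ⟨v, hv⟩ := exists_doubledExceptAt hcp w1' (by omega)
  obtain ⟨v', hv'⟩ := exists_doubledExceptAt hcp w2' (by omega)
  have step : ∀ {l v}, DoubledExceptAt c l v → 1 < (fib c l).card →
      totalCost a c l ≤ cost a l 1 → (∀ u, a.eval u = l → ram a u ∣ 2) := by
    intro l v hv hs hk u hu
    have hvf : v ∈ fib c l := (mem_fib hcp).mpr hv.eval_eq
    obtain ⟨y, hy, hyv⟩ := Finset.exists_mem_ne hs v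
    have e1 := Finset.add_sum_erase _ (fun v ↦ cost a l (ram c v)) hvf
    have e2 := Finset.single_le_sum (f := fun v ↦ cost a l (ram c v))
      (fun _ _ ↦ Nat.zero_le _) (Finset.mem_erase.mpr ⟨hyv, hy⟩)
    simp only [hv.ram_eq_one] at e1 e2
    rw [hv.ram_eq_two y ((mem_fib hcp).mp hy) hyv] at e2
    rw [totalCost] at hk
    exact ram_dvd_of_cost_eq_zero h.deg_pos (by omega) ((mem_fib h.deg_pos).mpr hu)
  have s1 := step hv (by omega) (by omega)
  have s2 := step hv' (by omega) (by omega)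
  have step2 : ∀ {l}, (∀ u, a.eval u = l → ram a u ∣ 2) →
      2 * (fib a l).card = a.natDegree + numSimple a l := by
    intro l hl
    rw [numSimple, Finset.card_filter, ← sum_ram h.deg_pos l, ← Finset.sum_add_distrib, mul_comm,
      ← smul_eq_mul, ← Finset.sum_const]
    refine Finset.sum_congr rfl fun u hu ↦ ?_
    have := (Nat.dvd_prime Nat.prime_two).mp (hl u ((mem_fib h.deg_pos).mp hu))
    split_ifs <;> omega
  have step3 : ∀ {l}, (∀ u, a.eval u = l → ram a u ∣ 2) → a.natDegree ≠ 2 →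
      0 < numSimple a l := by
    intro l hl h2
    by_contra! h0
    obtain ⟨s, hs⟩ := exists_eq_pow_of_dvd (f := a - C l) two_pos (fun x ↦ by
      by_cases hx : a.eval x = l
      · rw [← ram_eq hx]
        rcases (Nat.dvd_prime Nat.prime_two).mp (hl x hx) with h3 | h3
        · exact absurd (Finset.card_pos.mpr ⟨x, Finset.mem_filter.mpr
            ⟨(mem_fib h.deg_pos).mpr hx, h3⟩⟩) h0.not_gt
        · rw [h3]
      · rw [rootMultiplicity_eq_zero]
        · exact dvd_zero _
        · simpa [sub_eq_zero] using hx)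
    exact h2 (Indecomposable.natDegree_eq_two_of_sq ha hs)
  have a1 := step2 s1
  have a2 := step2 s2
  have b1 := step3 s1 (by omega)
  have b2 := step3 s2 (by omega)
  obtain ⟨u, hu⟩ := exists_doubledExceptAt h.deg_pos (l := l) (by omega) (by omega)
  obtain ⟨u', hu'⟩ := exists_doubledExceptAt h.deg_pos (l := l') (by omega) (by omega)
  obtain ⟨x, hx⟩ := h.doubledExceptAt hu hv
  obtain ⟨x', hx'⟩ := h.doubledExceptAt hu' hv'
  exact ⟨l, l', v, v', x, x', hne, hv, hv', hx, hx'⟩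

theorem Indecomposable.of_linear_eq {f g L N : ℂ[X]} (hg : Indecomposable g)
    (hL : IsLinearPoly L) (hN : IsLinearPoly N) (e : L.comp f = g.comp N) :
    Indecomposable f := by
  obtain ⟨L', hL', -, h⟩ := IsLinearPoly.exists_inv hL
  have h1 := indecomposable_linear_comp hL' (indecomposable_comp_linear hN hg)
  rwa [← e, ← comp_assoc, h, X_comp] at h1

theorem isLinearPoly_C_mul_X_add {s : ℂ} (hs : s ≠ 0) (t : ℂ) : IsLinearPoly (C s * X + C t) :=
  natDegree_linear hs

/-- The commutative square `a ∘ b = c ∘ d` is linearly equivalent to a basic Ritt identity. -/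
def IsBasicSquare (a b c d : ℂ[X]) : Prop :=
  ∃ L M N K A B R S : ℂ[X], IsLinearPoly L ∧ IsLinearPoly M ∧ IsLinearPoly N ∧ IsLinearPoly K ∧
    L.comp A = a.comp M ∧ M.comp B = b.comp N ∧ L.comp R = c.comp K ∧ K.comp S = d.comp N ∧
    BasicRittIdentity A B R S

theorem BasicRittIdentity.symm {a b c d : ℂ[X]} (h : BasicRittIdentity a b c d) :
    BasicRittIdentity c d a b := by
  refine ⟨h.1.symm, ?_⟩
  rcases h.2 with ⟨p, q, hp, hq, hne, ha, hb, hc, hd⟩ |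
    ⟨p, q, hp, hq, hpo, hqo, hne, ha, hb, hc, hd⟩ |
    ⟨p, k, el, n, u, hp, ha, hb, hc, hd, hbr, hcr⟩ | ⟨p, k, el, n, u, hp, ha, hb, hc, hd, har, hdr⟩
  · exact Or.inl ⟨q, p, hq, hp, hne.symm, hc, hd, ha, hb⟩
  · exact Or.inr (Or.inl ⟨q, p, hq, hp, hqo, hpo, hne.symm, hc, hd, ha, hb⟩)
  · exact Or.inr (Or.inr (Or.inr ⟨p, k, el, n, u, hp, hc, hd, ha, hb, hcr, hbr⟩))
  · exact Or.inr (Or.inr (Or.inl ⟨p, k, el, n, u, hp, hc, hd, ha, hb, hdr, har⟩))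

theorem IsBasicSquare.symm {a b c d : ℂ[X]} (h : IsBasicSquare a b c d) :
    IsBasicSquare c d a b := by
  obtain ⟨L, M, N, K, A, B, R, S, hL, hM, hN, hK, h1, h2, h3, h4, h⟩ := h
  exact ⟨L, K, N, M, R, S, A, B, hL, hK, hN, hM, h3, h4, h1, h2, BasicRittIdentity.symm h⟩

/-- It suffices to recognise one side of the square. -/
theorem exists_linear_of_square {a b c d L N K A B R S : ℂ[X]} (e : a.comp b = c.comp d)
    (hN : IsLinearPoly N) (e1 : A.comp B = R.comp S)
    (e2 : L.comp R = c.comp K) (e3 : K.comp S = d.comp N) (hB : B.natDegree = b.natDegree)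
    (hb : 0 < b.natDegree) (hLA : 0 < (L.comp A).natDegree) :
    ∃ M, IsLinearPoly M ∧ L.comp A = a.comp M ∧ M.comp B = b.comp N := by
  have key : (L.comp A).comp B = a.comp (b.comp N) := by
    rw [comp_assoc, e1, ← comp_assoc, e2, comp_assoc, e3, ← comp_assoc, ← e, comp_assoc]
  obtain ⟨M, hM, h⟩ := exists_linear_of_comp_eq hLA (hB ▸ hb)
    (by rw [natDegree_comp_linear hN, hB]) key
  refine ⟨M, hM, ?_, h.symm⟩
  rw [h, ← comp_assoc] at key
  exact comp_right_cancel (hB ▸ hb) key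

theorem eq_of_card_fib_eq_one {f : ℂ[X]} (hf : 0 < f.natDegree) {l : ℂ}
    (h : (fib f l).card = 1) :
    ∃ u, f.eval u = l ∧ ram f u = f.natDegree ∧
      f = C f.leadingCoeff * (X - C u) ^ f.natDegree + C l := by
  obtain ⟨u, hu⟩ := Finset.card_eq_one.mp h
  have h1 := sum_ram hf l
  rw [hu, Finset.sum_singleton] at h1
  have h2 : f.eval u = l := (mem_fib hf).mp (by simp [hu])
  refine ⟨u, h2, h1, ?_⟩
  have h3 := (IsAlgClosed.splits (f - C l)).eq_prod_roots
  have h4 : (f - C l).leadingCoeff = f.leadingCoeff := by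
    rw [leadingCoeff, natDegree_sub_C, coeff_sub, coeff_C_of_ne_zero hf.ne', sub_zero]
    rfl
  rw [Finset.prod_multiset_map_count, h4] at h3
  change f - C l = C f.leadingCoeff * ∏ x ∈ fib f l, _ at h3
  rw [hu, Finset.prod_singleton, count_roots, ← ram_eq h2, h1] at h3
  rw [← h3, sub_add_cancel]

theorem prime_of_indecomposable_X_pow {n : ℕ} (h : Indecomposable (X ^ n : ℂ[X])) : n.Prime := by
  have h1 := h.1
  rw [natDegree_X_pow] at h1
  by_contra hn
  obtain ⟨x, hxn, hx2, hx⟩ := Nat.exists_dvd_of_not_prime2 h1 hn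
  obtain ⟨y, rfl⟩ := hxn
  refine h.2 ⟨X ^ x, X ^ y, by rwa [natDegree_X_pow], ?_, by rw [X_pow_comp, ← pow_mul, mul_comm]⟩
  rw [natDegree_X_pow]
  by_contra! hy
  interval_cases y <;> omega

theorem CoprimeSquare.exists_ram_factor {a b c d : ℂ[X]} (h : CoprimeSquare a b c d)
    (hm : 2 ≤ a.natDegree) {l u : ℂ} (hl : fib a l = {u}) (hu : ram a u = a.natDegree) :
    ∃ (v : ℂ) (k : ℕ) (s : ℂ[X]), 0 < k ∧ Nat.Coprime k a.natDegree ∧ s.eval v ≠ 0 ∧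
      c - C l = (X - C v) ^ k * s ^ a.natDegree ∧ c.eval v = l ∧ ram c v = k := by
  have hcp := h.natDegree_c_pos
  have hcost : ∀ g, cost a l g = a.natDegree - Nat.gcd a.natDegree g := fun g ↦ by
    rw [cost, hl, Finset.sum_singleton, hu]
  obtain ⟨v, hv, hvd⟩ : ∃ v ∈ fib c l, ¬ a.natDegree ∣ ram c v := by
    by_contra! hall
    have h1 := Finset.dvd_sum hall
    rw [Ritt.sum_ram hcp, h.deg_eq'] at h1
    have := Nat.eq_one_of_dvd_coprimes h.coprime dvd_rfl h1
    omega
  have hhalf : ∀ g, ¬ a.natDegree ∣ g → a.natDegree ≤ 2 * cost a l g := fun g hg ↦ by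
    rw [hcost]
    obtain ⟨t, ht⟩ := Nat.gcd_dvd_left a.natDegree g
    have h1 : t ≠ 1 := by
      rintro rfl
      rw [mul_one] at ht
      exact hg (ht ▸ Nat.gcd_dvd_right _ _)
    have h0 : t ≠ 0 := by rintro rfl; omega
    have h2 := Nat.mul_le_mul_left (Nat.gcd a.natDegree g) (show 2 ≤ t by omega)
    omega
  have huniq : ∀ v' ∈ fib c l, v' ≠ v → a.natDegree ∣ ram c v' := fun v' hv' hne ↦ by
    by_contra hvd'
    have h1 := h.sum_cost_le {v', v}
    rw [Finset.sum_pair hne, (mem_fib hcp).mp hv, (mem_fib hcp).mp hv'] at h1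
    have h2 := hhalf _ hvd
    have h3 := hhalf _ hvd'
    omega
  have hevl := (mem_fib hcp).mp hv
  obtain ⟨q, hq, hqr⟩ := exists_eq_pow_rootMultiplicity_mul_and_not_dvd _ (sub_C_ne_zero hcp l) v
  rw [dvd_iff_isRoot, IsRoot.def] at hqr
  rw [← ram_eq hevl] at hq
  have hq0 : (X - C v) ^ ram c v * q ≠ 0 := hq ▸ sub_C_ne_zero hcp l
  obtain ⟨s, hs⟩ := exists_eq_pow_of_dvd (f := q) h.deg_pos (fun x ↦ by
    by_cases hxv : x = v
    · rw [hxv, rootMultiplicity_eq_zero hqr]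
      exact dvd_zero _
    have h1 := rootMultiplicity_mul (x := x) hq0
    have h0 : rootMultiplicity x ((X - C v) ^ ram c v) = 0 :=
      rootMultiplicity_eq_zero (by simp [sub_eq_zero, hxv])
    rw [h0, zero_add, ← hq] at h1
    rw [← h1]
    by_cases hx : x ∈ fib c l
    · rw [← ram_eq ((mem_fib hcp).mp hx)]
      exact huniq x hx hxv
    · rw [rootMultiplicity_eq_zero]
      · exact dvd_zero _
      · rw [mem_fib hcp] at hx
        simpa [sub_eq_zero] using hx)
  refine ⟨v, ram c v, s, ram_pos hcp v, ?_, ?_, by rw [hq, hs], hevl, rfl⟩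
  · have h1 := congrArg natDegree hq
    have hX : (X - C v) ^ ram c v ≠ 0 := left_ne_zero_of_mul hq0
    have hq' : q ≠ 0 := right_ne_zero_of_mul hq0
    rw [natDegree_sub_C, natDegree_mul hX hq', hs, natDegree_pow, natDegree_pow,
      natDegree_X_sub_C, mul_one] at h1
    have h2 := h.coprime.symm
    rw [← h.deg_eq', h1] at h2
    simpa using h2
  · intro h0
    apply hqr
    rw [hs, eval_pow, h0, zero_pow h.deg_pos.ne']

theorem CoprimeSquare.isBasicSquare_of_card_fib_eq_one {a b c d : ℂ[X]}
    (h : CoprimeSquare a b c d) (ha : Indecomposable a) (hb : Indecomposable b)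
    (hc : Indecomposable c) {l : ℂ} (hl : (fib a l).card = 1) : IsBasicSquare a b c d := by
  have hdp := h.natDegree_d_pos
  obtain ⟨u, hul, hur, -⟩ := eq_of_card_fib_eq_one h.deg_pos hl
  have hfu : fib a l = {u} := by
    obtain ⟨u', hu'⟩ := Finset.card_eq_one.mp hl
    have h1 : u ∈ fib a l := (mem_fib h.deg_pos).mpr hul
    rw [hu', Finset.mem_singleton] at h1
    rw [hu', h1]
  obtain ⟨v, k, s, hk, hkm, hsv, hs, hvl, hvk⟩ := h.exists_ram_factor ha.1 hfu hur
  have hdv : (fib d v).card = 1 := by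
    refine le_antisymm ?_ (card_fib_pos hdp v)
    apply Nat.le_of_mul_le_mul_right _ h.deg_pos
    rw [one_mul, ← smul_eq_mul]
    conv_rhs => rw [h.deg_eq, ← Ritt.sum_ram hdp v]
    refine Finset.card_nsmul_le_sum _ _ _ fun x hx ↦ ?_
    have h1 : b.eval x ∈ fib a l := (mem_fib h.deg_pos).mpr ((h.eval_eq hx).trans hvl)
    rw [hfu, Finset.mem_singleton] at h1
    have h2 := h.ram_mul x
    rw [h1, hur, (mem_fib hdp).mp hx, hvk] at h2
    exact Nat.le_of_dvd (ram_pos hdp x) (hkm.symm.dvd_of_dvd_mul_left ⟨_, h2.symm⟩)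
  obtain ⟨x, -, -, hd⟩ := eq_of_card_fib_eq_one hdp hdv
  rw [← h.deg_eq] at hd
  generalize hm : a.natDegree = m at *
  have hd0 : d.leadingCoeff ≠ 0 := by
    rw [leadingCoeff_ne_zero]; rintro rfl; simp at hdp
  obtain ⟨t, ht⟩ := IsAlgClosed.exists_pow_nat_eq d.leadingCoeff h.deg_pos
  rw [hm] at ht
  have hm0 : m ≠ 0 := hm ▸ h.deg_pos.ne'
  have ht0 : t ≠ 0 := by rintro rfl; rw [zero_pow hm0] at ht; exact hd0 ht.symm
  have hs0 : s ≠ 0 := by rintro rfl; simp at hsv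
  have hσ : s.leadingCoeff ≠ 0 := leadingCoeff_ne_zero.mpr hs0
  set w : ℂ[X] := C s.leadingCoeff⁻¹ * s.comp (X + C v) with hw
  have hwm : w.Monic := by
    rw [Monic, hw, leadingCoeff_mul, leadingCoeff_C,
      leadingCoeff_comp (by rw [natDegree_X_add_C]; exact one_ne_zero), leadingCoeff_X_add_C,
      one_pow, mul_one, inv_mul_cancel₀ hσ]
  have hw0 : w.eval 0 ≠ 0 := by
    rw [hw, eval_mul, eval_C, eval_comp]
    exact mul_ne_zero (inv_ne_zero hσ) (by simpa using hsv)
  have hsw : s.comp (X + C v) = C s.leadingCoeff * w := by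
    rw [hw, ← mul_assoc, ← C_mul, mul_inv_cancel₀ hσ, C_1, one_mul]
  have hL : IsLinearPoly (C (s.leadingCoeff ^ m) * X + C l) :=
    isLinearPoly_C_mul_X_add (pow_ne_zero _ hσ) _
  have hN : IsLinearPoly (C t⁻¹ * X + C x) := isLinearPoly_C_mul_X_add (inv_ne_zero ht0) _
  have hK : IsLinearPoly (X + C v) := natDegree_X_add_C v
  have e1 : (X ^ m : ℂ[X]).comp (X ^ k * w.comp (X ^ m)) = (X ^ k * w ^ m).comp (X ^ m) := by
    simp only [mul_comp, pow_comp, X_comp, mul_pow]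
    rw [← pow_mul, ← pow_mul, mul_comm k]
  have e2 : (C (s.leadingCoeff ^ m) * X + C l).comp (X ^ k * w ^ m) = c.comp (X + C v) := by
    have := congrArg (fun p ↦ p.comp (X + C v)) (sub_eq_iff_eq_add.mp hs)
    simp only [add_comp, mul_comp, pow_comp, sub_comp, X_comp, C_comp, add_sub_cancel_right,
      hsw] at this ⊢
    rw [this, mul_pow, C_pow]
    ring
  have e3 : (X + C v).comp (X ^ m) = d.comp (C t⁻¹ * X + C x) := by
    conv_rhs => rw [hd]
    simp only [add_comp, mul_comp, pow_comp, sub_comp, X_comp, C_comp, add_sub_cancel_right,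
      mul_pow]
    rw [← ht, ← mul_assoc, C_pow, ← mul_pow, ← C_mul, mul_inv_cancel₀ ht0, C_1, one_pow, one_mul]
  have hRdeg : (X ^ k * w ^ m).natDegree = k + m * w.natDegree := by
    rw [natDegree_mul (pow_ne_zero _ X_ne_zero) (pow_ne_zero _ hwm.ne_zero), natDegree_X_pow,
      natDegree_pow]
  have hRc : (X ^ k * w ^ m).natDegree = c.natDegree := by
    have := congrArg natDegree e2
    rwa [natDegree_linear_comp hL, natDegree_comp_linear hK] at this
  have hwX : w.comp (X ^ m) ≠ 0 := by
    intro h0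
    have := congrArg (eval 0) h0
    rw [eval_comp, eval_pow, eval_X, zero_pow hm0, eval_zero] at this
    exact hw0 this
  have hBdeg : (X ^ k * w.comp (X ^ m)).natDegree = b.natDegree := by
    rw [natDegree_mul (pow_ne_zero _ X_ne_zero) hwX, natDegree_X_pow, natDegree_comp,
      natDegree_X_pow, mul_comm, ← hRdeg, hRc, h.deg_eq']
  obtain ⟨M, hM, e4, e5⟩ := exists_linear_of_square h.comp_eq hN e1 e2 e3 hBdeg
    h.deg_pos' (by rw [natDegree_linear_comp hL, natDegree_X_pow]; omega)
  refine ⟨_, M, _, _, X ^ m, X ^ k * w.comp (X ^ m), X ^ k * w ^ m, X ^ m, hL, hM, hN, hK, e4, e5,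
    e2, e3, e1, ?_⟩
  have hmp := prime_of_indecomposable_X_pow (Indecomposable.of_linear_eq ha hL hM e4)
  have hBi := Indecomposable.of_linear_eq hb hM hN e5
  have hRi := Indecomposable.of_linear_eq hc hL hK e2
  rcases Nat.eq_zero_or_pos w.natDegree with hw1 | hw1
  · left
    have hw1' : w = 1 := hwm.natDegree_eq_zero.mp hw1
    rw [hw1', one_pow, mul_one] at hRi
    have hkp := prime_of_indecomposable_X_pow hRi
    refine ⟨m, k, hmp, hkp, ?_, rfl, by simp [hw1'], by simp [hw1'], rfl⟩
    rintro rfl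
    rw [Nat.coprime_self] at hkm
    exact hmp.one_lt.ne' hkm
  · right; right; left
    refine ⟨m, k, 1, 1, w, hmp, rfl, by simp, by simp, rfl, ⟨hBi, ?_⟩, ⟨hRi, ?_⟩⟩
    · exact Or.inr (Or.inr (Or.inr ⟨k, m, 1, w, hk, hmp.one_lt.le, le_rfl, hkm, by simp, hwm, hw1,
        hw0, Or.inl hmp.one_lt, by simp⟩))
    · exact Or.inr (Or.inr (Or.inr ⟨k, 1, m, w, hk, le_rfl, hmp.one_lt.le, by simp, hkm, hwm, hw1,
        hw0, Or.inr hmp.one_lt, by simp⟩))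

theorem isChebyshev_C (n : ℕ) : IsChebyshev n (Chebyshev.C ℂ n) := by
  intro x hx
  induction n using Nat.twoStepInduction with
  | zero => norm_num
  | one => simp
  | more n ih1 ih2 =>
    push_cast at ih2 ⊢
    rw [Chebyshev.C_add_two, eval_sub, eval_mul, ih1, ih2, eval_X]
    have h := mul_inv_cancel₀ hx
    linear_combination (x ^ n + x⁻¹ ^ n) * h

/-- A polynomial solution of Chebyshev's differential equation is determined by its value
at `1`. -/
theorem eq_T_of_ode {g : ℂ[X]} {n : ℕ} (hg : g.natDegree = n) (h1 : g.eval 1 = 1)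
    (ode : (1 - X ^ 2) * derivative (derivative g) = X * derivative g - (n : ℂ[X]) ^ 2 * g) :
    g = Chebyshev.T ℂ n := by
  have odeT := Chebyshev.one_sub_X_sq_mul_derivative_derivative_T_eq_poly_in_T (R := ℂ) n
  have hTd : (Chebyshev.T ℂ n).natDegree = n := by simp
  have hTl : (Chebyshev.T ℂ n).leadingCoeff ≠ 0 :=
    leadingCoeff_ne_zero.mpr (Chebyshev.T_ne_zero ℂ n)
  set κ := g.leadingCoeff / (Chebyshev.T ℂ n).leadingCoeff with hκ
  set F := g - C κ * Chebyshev.T ℂ n with hF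
  have odeF : (1 - X ^ 2) * derivative (derivative F) =
      X * derivative F - (n : ℂ[X]) ^ 2 * F := by
    simp only [hF, derivative_sub, derivative_C_mul]
    simp only [Function.iterate_succ, Function.iterate_zero, Function.comp_apply, id] at odeT
    push_cast at odeT
    linear_combination ode - C κ * odeT
  have hF0 : F = 0 := by
    by_contra hF0
    set r := F.natDegree with hr
    have hFn : F.coeff n = 0 := by
      rw [hF, coeff_sub, coeff_C_mul, hκ]
      have e1 : g.coeff n = g.leadingCoeff := by rw [leadingCoeff, hg]
      have e2 : (Chebyshev.T ℂ n).coeff n = (Chebyshev.T ℂ n).leadingCoeff := by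
        rw [leadingCoeff, hTd]
      rw [e1, e2, div_mul_cancel₀ _ hTl, sub_self]
    have hFr : F.coeff r ≠ 0 := by
      rw [hr, coeff_natDegree]
      exact leadingCoeff_ne_zero.mpr hF0
    have hF1 : F.coeff (r + 1) = 0 := coeff_eq_zero_of_natDegree_lt (by omega)
    have hF2 : F.coeff (r + 2) = 0 := coeff_eq_zero_of_natDegree_lt (by omega)
    have key := congrArg (coeff · r) odeF
    have c1 : (X * derivative F).coeff r = r * F.coeff r := by
      rcases Nat.eq_zero_or_pos r with h0 | h0
      · rw [h0]; simp
      · obtain ⟨t, ht⟩ : ∃ t, r = t + 1 := ⟨r - 1, by omega⟩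
        rw [ht, coeff_X_mul, coeff_derivative]
        push_cast
        ring
    have c2 : (X ^ 2 * derivative (derivative F)).coeff r = r * (r - 1) * F.coeff r := by
      rcases Nat.lt_or_ge r 2 with h0 | h0
      · rw [coeff_X_pow_mul']
        rw [if_neg (by omega)]
        interval_cases r <;> simp
      · obtain ⟨t, ht⟩ : ∃ t, r = t + 2 := ⟨r - 2, by omega⟩
        rw [ht, coeff_X_pow_mul, coeff_derivative, coeff_derivative]
        push_cast
        ring
    have c3 : (derivative (derivative F)).coeff r = 0 := by
      rw [coeff_derivative, coeff_derivative]
      rw [hF2]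
      simp
    have c4 : ((n : ℂ[X]) ^ 2 * F).coeff r = (n : ℂ) ^ 2 * F.coeff r := by
      rw [← C_eq_natCast, ← C_pow, coeff_C_mul]
    simp only [sub_mul, one_mul, coeff_sub] at key
    rw [c1, c2, c3, c4] at key
    have h3 : ((n : ℂ) ^ 2 - (r : ℂ) ^ 2) * F.coeff r = 0 := by linear_combination key
    rcases mul_eq_zero.mp h3 with h4 | h4
    · have h5 : n ^ 2 = r ^ 2 := by exact_mod_cast sub_eq_zero.mp h4
      have h6 : n = r := by
        have := Nat.pow_left_injective (n := 2) (by norm_num) h5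
        exact this
      exact hFr (h6 ▸ hFn)
    · exact hFr h4
  have h2 : g = C κ * Chebyshev.T ℂ n := sub_eq_zero.mp hF0
  have h3 := congrArg (eval 1) h2
  rw [h1, eval_mul, eval_C, Chebyshev.T_eval_one, mul_one] at h3
  rw [h2, ← h3, C_1, one_mul]

theorem eq_T_of_sq {g s t : ℂ[X]} (hg : 0 < g.natDegree) (hs : g - 1 = (X - 1) * s ^ 2)
    (ht : g + 1 = (X + 1) * t ^ 2) : g = Chebyshev.T ℂ g.natDegree := by
  have h1 : g.eval 1 = 1 := by
    have := congrArg (eval 1) hs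
    simpa [sub_eq_zero] using this
  have pell : g ^ 2 - 1 = (X ^ 2 - 1) * (s * t) ^ 2 := by linear_combination (g + 1) * hs +
    (X - 1) * s ^ 2 * ht
  have hst0 : s * t ≠ 0 := by
    intro h0
    rw [h0] at pell
    have h2 := congrArg natDegree (sub_eq_iff_eq_add.mp pell)
    rw [natDegree_pow] at h2
    simp at h2
    omega
  have hX1 : (X ^ 2 - 1 : ℂ[X]) = X ^ 2 - C 1 := by simp
  have hXd : (X ^ 2 - 1 : ℂ[X]).natDegree = 2 := by rw [hX1, natDegree_X_pow_sub_C]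
  have hX0 : (X ^ 2 - 1 : ℂ[X]) ≠ 0 := by intro h0; rw [h0] at hXd; simp at hXd
  have hdeg : g.natDegree = (s * t).natDegree + 1 := by
    have h2 := congrArg natDegree pell
    rw [natDegree_mul hX0 (pow_ne_zero _ hst0), hXd, natDegree_pow, ← C_1, natDegree_sub_C,
      natDegree_pow] at h2
    omega
  have hcop : IsCoprime (s * t) g := by
    refine ⟨-(X ^ 2 - 1) * (s * t), g, ?_⟩
    linear_combination pell
  have hder := congrArg derivative pell
  simp only [derivative_sub, derivative_pow, derivative_mul, derivative_X, derivative_one,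
    Nat.cast_ofNat, Nat.add_one_sub_one, pow_one] at hder
  have hder2 : g * derivative g = (s * t) * (X * (s * t) + (X ^ 2 - 1) * derivative (s * t)) := by
    have h2 : (2 : ℂ[X]) ≠ 0 := two_ne_zero
    apply mul_left_cancel₀ h2
    simp only [derivative_mul]
    simp only [map_ofNat] at hder
    linear_combination hder
  obtain ⟨q, hq⟩ := hcop.dvd_of_dvd_mul_left ⟨_, hder2⟩
  have hq0 : q ≠ 0 := by
    rintro rfl
    rw [mul_zero] at hq
    have h2 := natDegree_derivative g
    have := derivative_eq_zero.mp hq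
    omega
  have hqd : q.natDegree = 0 := by
    have h2 := congrArg natDegree hq
    rw [natDegree_derivative, natDegree_mul hst0 hq0] at h2
    omega
  obtain ⟨κ, rfl⟩ : ∃ κ, q = C κ := ⟨_, eq_C_of_natDegree_eq_zero hqd⟩
  have hpell2 : (X ^ 2 - 1) * derivative g ^ 2 = C κ ^ 2 * (g ^ 2 - 1) := by
    rw [hq, pell]; ring
  have hlc : (g.natDegree : ℂ) ^ 2 = κ ^ 2 := by
    have h2 := congrArg leadingCoeff hpell2
    have h3 : (X ^ 2 - 1 : ℂ[X]).leadingCoeff = 1 := by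
      rw [hX1]; exact leadingCoeff_X_pow_sub_C two_pos
    have h4 : (g ^ 2 - 1).leadingCoeff = g.leadingCoeff ^ 2 := by
      rw [← leadingCoeff_pow, leadingCoeff_sub_of_degree_lt]
      rw [degree_one, ← natDegree_pos_iff_degree_pos, natDegree_pow]
      omega
    rw [leadingCoeff_mul, leadingCoeff_mul, h3, h4, leadingCoeff_pow, leadingCoeff_pow,
      leadingCoeff_C, leadingCoeff_derivative] at h2
    have h5 : g.leadingCoeff ^ 2 ≠ 0 := by
      apply pow_ne_zero
      rw [leadingCoeff_ne_zero]
      rintro rfl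
      simp at hg
    apply mul_right_cancel₀ h5
    linear_combination h2
  refine eq_T_of_ode rfl h1 ?_
  have hg'0 : derivative g ≠ 0 := by rw [hq]; exact mul_ne_zero hst0 hq0
  have hder3 := congrArg derivative hpell2
  simp only [derivative_sub, derivative_pow, derivative_mul, derivative_X, derivative_one,
    derivative_C, Nat.cast_ofNat, Nat.add_one_sub_one, pow_one, map_ofNat] at hder3
  apply mul_left_cancel₀ (mul_ne_zero (two_ne_zero : (2 : ℂ[X]) ≠ 0) hg'0)
  have hlc' : (g.natDegree : ℂ[X]) ^ 2 = C κ ^ 2 := by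
    rw [← C_eq_natCast, ← C_pow, hlc, C_pow]
  rw [hlc']
  linear_combination -hder3

/-- The linear polynomial taking `1` to `p` and `-1` to `q`. -/
def interp (p q : ℂ) : ℂ[X] := C ((p - q) / 2) * X + C ((p + q) / 2)

theorem isLinearPoly_interp {p q : ℂ} (h : p ≠ q) : IsLinearPoly (interp p q) :=
  isLinearPoly_C_mul_X_add (div_ne_zero (sub_ne_zero.mpr h) two_ne_zero) _

theorem DoubledExceptAt.exists_sq {f : ℂ[X]} {q p : ℂ} (h : DoubledExceptAt f q p)
    (hf : 0 < f.natDegree) : ∃ s : ℂ[X], f - C q = (X - C p) * s ^ 2 := by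
  obtain ⟨r, hr, hrp⟩ := exists_eq_pow_rootMultiplicity_mul_and_not_dvd _ (sub_C_ne_zero hf q) p
  rw [dvd_iff_isRoot, IsRoot.def] at hrp
  rw [← ram_eq h.eval_eq, h.ram_eq_one, pow_one] at hr
  have hr0 : (X - C p) * r ≠ 0 := hr ▸ sub_C_ne_zero hf q
  obtain ⟨s, hs⟩ := exists_eq_pow_of_dvd (f := r) two_pos (fun x ↦ by
    by_cases hxp : x = p
    · rw [hxp, rootMultiplicity_eq_zero hrp]
      exact dvd_zero _
    have h1 := rootMultiplicity_mul (x := x) hr0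
    have h0 : rootMultiplicity x (X - C p) = 0 :=
      rootMultiplicity_eq_zero (by simp [sub_eq_zero, hxp])
    rw [h0, zero_add, ← hr] at h1
    rw [← h1]
    by_cases hx : f.eval x = q
    · rw [← ram_eq hx, h.ram_eq_two x hx hxp]
    · rw [rootMultiplicity_eq_zero]
      · exact dvd_zero _
      · simpa [sub_eq_zero] using hx)
  exact ⟨s, by rw [hr, hs]⟩

theorem DoubledExceptAt.odd_natDegree {f : ℂ[X]} {q p : ℂ} (h : DoubledExceptAt f q p)
    (hf : 0 < f.natDegree) : Odd f.natDegree := by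
  obtain ⟨s, hs⟩ := h.exists_sq hf
  have h1 := congrArg natDegree hs
  have hs0 : s ≠ 0 := by
    rintro rfl
    exact sub_C_ne_zero hf q (by simpa using hs)
  rw [natDegree_sub_C, natDegree_mul (X_sub_C_ne_zero p) (pow_ne_zero _ hs0), natDegree_X_sub_C,
    natDegree_pow] at h1
  exact ⟨s.natDegree, by omega⟩

theorem comp_interp_eq {f : ℂ[X]} (hf : 0 < f.natDegree) {p p' q q' : ℂ} (hq : q ≠ q')
    (h : DoubledExceptAt f q p) (h' : DoubledExceptAt f q' p') :
    f.comp (interp p p') = (interp q q').comp (Chebyshev.T ℂ f.natDegree) := by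
  have hp : p ≠ p' := by
    rintro rfl
    exact hq (h.eval_eq.symm.trans h'.eval_eq)
  obtain ⟨s, hs⟩ := h.exists_sq hf
  obtain ⟨t, ht⟩ := h'.exists_sq hf
  have hq2 : (q - q') / 2 ≠ 0 := div_ne_zero (sub_ne_zero.mpr hq) two_ne_zero
  obtain ⟨z, hz⟩ := IsAlgClosed.exists_pow_nat_eq (((p - p') / 2) * ((q - q') / 2)⁻¹) two_pos
  set g := C ((q - q') / 2)⁻¹ * (f.comp (interp p p') - C ((q + q') / 2)) with hg
  have hgf : f.comp (interp p p') = C ((q - q') / 2) * g + C ((q + q') / 2) := by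
    rw [hg, ← mul_assoc, ← C_mul, mul_inv_cancel₀ hq2, C_1, one_mul, sub_add_cancel]
  have hgd : g.natDegree = f.natDegree := by
    rw [hg, natDegree_C_mul (inv_ne_zero hq2), natDegree_sub_C,
      natDegree_comp_linear (isLinearPoly_interp hp)]
  have hcomp : ∀ {y x r}, f - C y = (X - C x) * r ^ 2 →
      f.comp (interp p p') = (interp p p' - C x) * (r.comp (interp p p')) ^ 2 + C y := by
    intro y x r hr
    have := congrArg (fun u ↦ u.comp (interp p p')) (sub_eq_iff_eq_add.mp hr)
    simpa using this
  have hinv : (C ((q - q') / 2)⁻¹ : ℂ[X]) * C ((q - q') / 2) = 1 := by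
    rw [← C_mul, inv_mul_cancel₀ hq2, C_1]
  have hzC : (C z : ℂ[X]) ^ 2 = C ((p - p') / 2) * C ((q - q') / 2)⁻¹ := by
    rw [← C_pow, hz, C_mul]
  have hp1 : interp p p' - C p = C ((p - p') / 2) * (X - 1) := by
    have : (C p : ℂ[X]) = C ((p - p') / 2) + C ((p + p') / 2) := by rw [← C_add]; congr 1; ring
    rw [interp, this]; ring
  have hp2 : interp p p' - C p' = C ((p - p') / 2) * (X + 1) := by
    have : (C p' : ℂ[X]) = C ((p + p') / 2) - C ((p - p') / 2) := by rw [← C_sub]; congr 1; ring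
    rw [interp, this]; ring
  have hq1 : (C q : ℂ[X]) = C ((q - q') / 2) + C ((q + q') / 2) := by rw [← C_add]; congr 1; ring
  have hq2' : (C q' : ℂ[X]) = C ((q + q') / 2) - C ((q - q') / 2) := by
    rw [← C_sub]; congr 1; ring
  have key := eq_T_of_sq (g := g) (s := C z * s.comp (interp p p'))
    (t := C z * t.comp (interp p p')) (hgd ▸ hf)
    (by
      have h1 := hcomp hs
      rw [hp1, hq1] at h1
      rw [hg, h1, mul_pow, hzC]
      linear_combination hinv)
    (by
      have h1 := hcomp ht
      rw [hp2, hq2'] at h1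
      rw [hg, h1, mul_pow, hzC]
      linear_combination -hinv)
  rw [hgf, key, hgd, interp]
  simp

theorem half_comp_chebyshev (n : ℕ) :
    (C (2⁻¹ : ℂ) * X).comp (Chebyshev.C ℂ n) =
      (Chebyshev.T ℂ n).comp (C (2⁻¹ : ℂ) * X) := by
  have h := congrArg (fun u ↦ u.comp (C (2⁻¹ : ℂ) * X)) (Chebyshev.C_comp_two_mul_X ℂ n)
  rw [← map_ofNat (C : ℂ →+* ℂ[X]) 2] at h
  have e : (C (2 : ℂ) * X).comp (C (2⁻¹ : ℂ) * X) = X := by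
    rw [mul_comp, X_comp, C_comp, ← mul_assoc, ← C_mul]
    norm_num
  simp only [comp_assoc, e, comp_X, mul_comp (p := C (2 : ℂ)), C_comp] at h
  rw [mul_comp, X_comp, C_comp, h, ← mul_assoc, ← C_mul]
  norm_num

theorem natDegree_chebyshev (n : ℕ) : (Chebyshev.C ℂ n).natDegree = n := by
  have hL : IsLinearPoly (C (2⁻¹ : ℂ) * X) := by
    simpa using isLinearPoly_C_mul_X_add (s := 2⁻¹) (by norm_num) 0
  have h := congrArg natDegree (half_comp_chebyshev n)
  rw [natDegree_linear_comp hL, natDegree_comp_linear hL] at h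
  simpa using h

theorem prime_of_indecomposable_chebyshev {n : ℕ} (h : Indecomposable (Chebyshev.C ℂ n)) :
    n.Prime := by
  have h1 := h.1
  rw [natDegree_chebyshev] at h1
  by_contra hn
  obtain ⟨x, hxn, hx2, hx⟩ := Nat.exists_dvd_of_not_prime2 h1 hn
  obtain ⟨y, rfl⟩ := hxn
  refine h.2 ⟨Chebyshev.C ℂ x, Chebyshev.C ℂ y, by rwa [natDegree_chebyshev], ?_, by
    push_cast; exact Chebyshev.C_mul ℂ x y⟩
  rw [natDegree_chebyshev]
  by_contra! hy
  interval_cases y <;> omega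

theorem CoprimeSquare.isBasicSquare_of_doubled {a b c d : ℂ[X]} (h : CoprimeSquare a b c d)
    (ha : Indecomposable a) (hb : Indecomposable b) {l l' v v' x x' : ℂ} (hl : l ≠ l')
    (h1 : DoubledExceptAt c l v) (h2 : DoubledExceptAt c l' v') (h3 : DoubledExceptAt d v x)
    (h4 : DoubledExceptAt d v' x') : IsBasicSquare a b c d := by
  have hv : v ≠ v' := by
    rintro rfl
    exact hl (h1.eval_eq.symm.trans h2.eval_eq)
  have hx : x ≠ x' := by
    rintro rfl
    exact hv (h3.eval_eq.symm.trans h4.eval_eq)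
  have hcp := h.natDegree_c_pos
  have hdp := h.natDegree_d_pos
  have e1 := comp_interp_eq hcp hl h1 h2
  have e2 := comp_interp_eq hdp hv h3 h4
  have hno := h1.odd_natDegree hcp
  have hmo := h3.odd_natDegree hdp
  have hH : IsLinearPoly (C (2⁻¹ : ℂ) * X) := by
    simpa using isLinearPoly_C_mul_X_add (s := 2⁻¹) (by norm_num) 0
  rw [h.deg_eq'] at e1 hno
  rw [← h.deg_eq] at e2 hmo
  set H : ℂ[X] := C (2⁻¹ : ℂ) * X
  have hL := IsLinearPoly.comp (isLinearPoly_interp hl) hH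
  have hK := IsLinearPoly.comp (isLinearPoly_interp hv) hH
  have hN := IsLinearPoly.comp (isLinearPoly_interp hx) hH
  have f1 : ((interp l l').comp H).comp (Chebyshev.C ℂ b.natDegree) =
      c.comp ((interp v v').comp H) := by
    rw [comp_assoc, half_comp_chebyshev, ← comp_assoc, ← comp_assoc, e1]
  have f2 : ((interp v v').comp H).comp (Chebyshev.C ℂ a.natDegree) =
      d.comp ((interp x x').comp H) := by
    rw [comp_assoc, half_comp_chebyshev, ← comp_assoc, ← comp_assoc, e2]
  have f3 : (Chebyshev.C ℂ a.natDegree).comp (Chebyshev.C ℂ b.natDegree) =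
      (Chebyshev.C ℂ b.natDegree).comp (Chebyshev.C ℂ a.natDegree) := by
    rw [← Chebyshev.C_mul, ← Chebyshev.C_mul, mul_comm]
  obtain ⟨M, hM, f4, f5⟩ := exists_linear_of_square h.comp_eq hN f3 f1 f2
    (natDegree_chebyshev _) h.deg_pos'
    (by rw [natDegree_linear_comp hL, natDegree_chebyshev]; exact h.deg_pos)
  have hmp := prime_of_indecomposable_chebyshev (Indecomposable.of_linear_eq ha hL hM f4)
  have hnp := prime_of_indecomposable_chebyshev (Indecomposable.of_linear_eq hb hM hN f5)
  refine ⟨_, M, _, _, _, _, _, _, hL, hM, hN, hK, f4, f5, f1, f2, f3, Or.inr (Or.inl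
    ⟨_, _, hmp, hnp, hmo, hno, ?_, isChebyshev_C _, isChebyshev_C _, isChebyshev_C _,
      isChebyshev_C _⟩)⟩
  intro hmn
  have := h.coprime
  rw [← hmn, Nat.coprime_self] at this
  exact hmp.one_lt.ne' this

theorem CoprimeSquare.isBasicSquare {a b c d : ℂ[X]} (h : CoprimeSquare a b c d)
    (ha : Indecomposable a) (hb : Indecomposable b) (hc : Indecomposable c)
    (hlt : a.natDegree < c.natDegree) : IsBasicSquare a b c d := by
  rcases h.critical_cases ha hc hlt with ⟨l, hl⟩ | ⟨l, l', v, v', x, x', hl, h1, h2, h3, h4⟩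
  · exact h.isBasicSquare_of_card_fib_eq_one ha hb hc hl
  · exact h.isBasicSquare_of_doubled ha hb hl h1 h2 h3 h4

/-- **Ritt's second theorem.** -/
theorem exists_basicRittIdentity {a b c d : ℂ[X]} (ha : Indecomposable a) (hb : Indecomposable b)
    (hc : Indecomposable c) (hd : Indecomposable d) (e : a.comp b = c.comp d)
    (hcop : Nat.Coprime a.natDegree b.natDegree) (had : a.natDegree = d.natDegree) :
    ∃ L M N A B R S : ℂ[X], IsLinearPoly L ∧ IsLinearPoly M ∧ IsLinearPoly N ∧
      L.comp A = a.comp M ∧ M.comp B = b.comp N ∧ BasicRittIdentity A B R S ∧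
      S.natDegree = d.natDegree := by
  have ha2 := ha.1
  have hb2 := hb.1
  have h : CoprimeSquare a b c d := ⟨e, had, by omega, by omega, hcop⟩
  have hcb := h.deg_eq'
  have key : IsBasicSquare a b c d := by
    rcases lt_trichotomy a.natDegree b.natDegree with hlt | heq | hlt
    · exact h.isBasicSquare ha hb hc (hcb ▸ hlt)
    · rw [heq, Nat.coprime_self] at hcop
      omega
    · have h' : CoprimeSquare c d a b :=
        ⟨e.symm, hcb, by omega, by omega, by rw [hcb, ← had]; exact hcop.symm⟩
      exact (h'.isBasicSquare hc hd ha (hcb ▸ hlt)).symm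
  obtain ⟨L, M, N, K, A, B, R, S, hL, hM, hN, hK, h1, h2, h3, h4, h5⟩ := key
  refine ⟨L, M, N, A, B, R, S, hL, hM, hN, h1, h2, h5, ?_⟩
  rw [← natDegree_linear_comp hK S, h4, natDegree_comp_linear hN]

theorem natDegree_eq_of_comp_eq {u v f h : ℂ[X]} (e : u.comp f = v.comp h)
    (hu : u.natDegree = h.natDegree) (hh : 0 < h.natDegree) : v.natDegree = f.natDegree := by
  have := congrArg natDegree e
  rw [natDegree_comp, natDegree_comp, hu, mul_comm] at this
  exact (Nat.eq_of_mul_eq_mul_right hh this).symm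

theorem indecomposable_of_comp_eq {u v f h : ℂ[X]} (hf : 0 < f.natDegree) (hi : Indecomposable h)
    (hcop : Nat.Coprime h.natDegree f.natDegree) (e : u.comp f = v.comp h)
    (hu : u.natDegree = h.natDegree) : Indecomposable u := by
  have hh := hi.1
  refine ⟨by omega, ?_⟩
  rintro ⟨u1, u2, h1, h2, rfl⟩
  rw [natDegree_comp] at hu
  have hv := natDegree_eq_of_comp_eq e (by rwa [natDegree_comp]) (by omega)
  have h3 := gcd_eq_one_or_dvd (h' := u2.comp f) (Q' := u1) hi
    (by rw [natDegree_comp]; exact Nat.mul_pos (by omega) hf) (by omega)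
    (Q := v) (by rw [← e, comp_assoc])
  rw [natDegree_comp] at h3
  rcases h3 with h3 | h3
  · have : u2.natDegree ∣ 1 := h3 ▸ Nat.dvd_gcd ⟨u1.natDegree, by rw [← hu, mul_comm]⟩ ⟨_, rfl⟩
    have := Nat.le_of_dvd one_pos this
    omega
  · have := Nat.le_of_dvd (by omega) (hcop.dvd_of_dvd_mul_right h3)
    nlinarith

/-- Two indecomposable right factors of different degrees complete to a commutative square. -/
theorem exists_square {P g g' f h : ℂ[X]} (hf : Indecomposable f) (hh : Indecomposable h)
    (hP : 0 < P.natDegree) (e : P = g.comp f) (e' : P = g'.comp h)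
    (hne : f.natDegree ≠ h.natDegree) :
    ∃ u v w : ℂ[X], u.comp f = v.comp h ∧ u.natDegree = h.natDegree ∧
      v.natDegree = f.natDegree ∧ P = w.comp (u.comp f) ∧ Indecomposable u ∧ Indecomposable v ∧
      Nat.Coprime h.natDegree f.natDegree := by
  have hf2 := hf.1
  have hh2 := hh.1
  have hgpos : 0 < g.natDegree := Nat.pos_of_ne_zero fun h0 ↦ by
    rw [e, natDegree_comp, h0, zero_mul] at hP; omega
  have hgpos' : 0 < g'.natDegree := Nat.pos_of_ne_zero fun h0 ↦ by
    rw [e', natDegree_comp, h0, zero_mul] at hP; omega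
  have hcop : Nat.Coprime h.natDegree f.natDegree := by
    have h1 := gcd_eq_one_or_dvd hf (by omega) hgpos (e.symm.trans e')
    have h2 := gcd_eq_one_or_dvd hh (by omega) hgpos' (e'.symm.trans e)
    rcases h2 with h2 | h2
    · exact h2
    · rcases h1 with h1 | h1
      · rw [Nat.gcd_comm] at h1; exact h1
      · exact absurd (Nat.dvd_antisymm h1 h2) hne
  obtain ⟨u, v, w, huv, hl, hw⟩ := exists_lcm_factor hP e e'
  have hu : u.natDegree = h.natDegree := by
    rw [natDegree_comp, Nat.lcm_comm, hcop.lcm_eq_mul] at hl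
    exact Nat.eq_of_mul_eq_mul_right (by omega) hl
  have hv := natDegree_eq_of_comp_eq huv hu (by omega)
  exact ⟨u, v, w, huv, hu, hv, hw, indecomposable_of_comp_eq (by omega) hh hcop huv hu,
    indecomposable_of_comp_eq (by omega) hf hcop.symm huv.symm hv, hcop⟩

/-- The composition of a list of polynomials, innermost factor first. -/
def compList (l : List ℂ[X]) : ℂ[X] := l.foldr (fun p q ↦ q.comp p) X

theorem compList_cons (a : ℂ[X]) (l : List ℂ[X]) : compList (a :: l) = (compList l).comp a := rfl

theorem foldl_comp (l : List ℂ[X]) (q : ℂ[X]) :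
    l.foldl (fun q p ↦ p.comp q) q = (compList l).comp q := by
  induction l generalizing q with
  | nil => simp [compList]
  | cons a l ih => rw [List.foldl_cons, ih, compList_cons, comp_assoc]

theorem isDecomposition_iff {l : List ℂ[X]} {P : ℂ[X]} :
    IsDecomposition l P ↔ l ≠ [] ∧ (∀ p ∈ l, Indecomposable p) ∧ compList l = P := by
  rw [IsDecomposition, foldl_comp, comp_X]

theorem natDegree_compList_pos {l : List ℂ[X]} (hl : ∀ p ∈ l, Indecomposable p) :
    0 < (compList l).natDegree := by
  induction l with
  | nil => simp [compList]
  | cons a l ih =>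
    rw [compList_cons, natDegree_comp]
    have := (hl a (by simp)).1
    exact Nat.mul_pos (ih fun p hp ↦ hl p (by simp [hp])) (by omega)

theorem linearEquivalent_aux : ∀ (l m : List ℂ[X]) (K : ℂ[X]), IsLinearPoly K →
    (∀ p ∈ l, Indecomposable p) → (∀ p ∈ m, Indecomposable p) →
    l.map natDegree = m.map natDegree → compList m = (compList l).comp K →
    ∃ L : ℕ → ℂ[X], L 0 = K ∧ L l.length = X ∧ (∀ i, IsLinearPoly (L i)) ∧
      ∀ i < l.length, (L (i + 1)).comp (m.getD i 0) = (l.getD i 0).comp (L i)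
  | [], [], K, hK, _, _, _, e => by
    rw [compList, List.foldr_nil, X_comp] at e
    exact ⟨fun _ ↦ K, rfl, e.symm, fun _ ↦ hK, by simp⟩
  | [], y :: m, K, hK, _, _, hd, e => by simp at hd
  | x :: l, [], K, hK, _, _, hd, e => by simp at hd
  | x :: l, y :: m, K, hK, hl, hm, hd, e => by
    simp only [List.map_cons, List.cons.injEq] at hd
    rw [compList_cons, compList_cons, comp_assoc] at e
    have hy := (hm y (by simp)).1
    have hlp : ∀ p ∈ l, Indecomposable p := fun p hp ↦ hl p (by simp [hp])
    have hmp : ∀ p ∈ m, Indecomposable p := fun p hp ↦ hm p (by simp [hp])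
    obtain ⟨K', hK', hKe⟩ := exists_linear_of_comp_eq (natDegree_compList_pos hmp) (by omega)
      (by rw [natDegree_comp_linear hK, hd.1]) e
    rw [hKe, ← comp_assoc] at e
    obtain ⟨L, h0, h1, h2, h3⟩ := linearEquivalent_aux l m K' hK' hlp hmp hd.2
      (comp_right_cancel (by omega) e)
    refine ⟨fun i ↦ Nat.casesOn i K L, rfl, h1, ?_, ?_⟩
    · rintro (_ | i)
      · exact hK
      · exact h2 i
    · rintro (_ | i) hi
      · simpa [h0] using hKe.symm
      · simpa using h3 i (by simpa using hi)

/-- Two decompositions of the same polynomial with the same sequence of degrees are linearly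
equivalent. -/
theorem linearEquivalent_of_degrees {l m : List ℂ[X]} (hl : ∀ p ∈ l, Indecomposable p)
    (hm : ∀ p ∈ m, Indecomposable p) (hd : l.map natDegree = m.map natDegree)
    (e : compList l = compList m) : LinearEquivalent l m := by
  obtain ⟨L, h0, h1, h2, h3⟩ := linearEquivalent_aux l m X isLinearPoly_X hl hm hd
    (by rw [comp_X, e])
  exact ⟨by simpa using congrArg List.length hd, L, h0, h1, fun i _ _ ↦ h2 i, h3⟩

/-- `SwapChain n l m` says that `m` is obtained from `l` by `n` Ritt swaps. -/
inductive SwapChain : ℕ → List ℂ[X] → List ℂ[X] → Prop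
  | refl (l : List ℂ[X]) : SwapChain 0 l l
  | step {n j : ℕ} {l l' m : List ℂ[X]} : RittSwapAt j l l' → SwapChain n l' m →
      SwapChain (n + 1) l m

theorem SwapChain.trans {n n' : ℕ} {l m m' : List ℂ[X]} (h : SwapChain n l m)
    (h' : SwapChain n' m m') : SwapChain (n' + n) l m' := by
  induction h with
  | refl => exact h'
  | step hs _ ih => exact .step hs (ih h')

theorem rittSwapAt_cons {j : ℕ} {l m : List ℂ[X]} (a : ℂ[X]) (h : RittSwapAt j l m) :
    RittSwapAt (j + 1) (a :: l) (a :: m) := by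
  obtain ⟨h1, h2, h3, h4⟩ := h
  refine ⟨by simp [h1], by simpa using h2, ?_, by simpa using h4⟩
  rintro (_ | i) hi hi'
  · simp
  · simpa using h3 i (by omega) (by omega)

theorem SwapChain.cons {n : ℕ} {l m : List ℂ[X]} (a : ℂ[X]) (h : SwapChain n l m) :
    SwapChain n (a :: l) (a :: m) := by
  induction h with
  | refl => exact .refl _
  | step hs _ ih => exact .step (rittSwapAt_cons a hs) ih

theorem SwapChain.length_eq {n : ℕ} {l m : List ℂ[X]} (h : SwapChain n l m) :
    l.length = m.length := by
  induction h with
  | refl => rfl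
  | step hs _ ih => exact hs.1.trans ih

theorem SwapChain.exists_fun {n : ℕ} {l m : List ℂ[X]} (h : SwapChain n l m) :
    ∃ c : ℕ → List ℂ[X], c 0 = l ∧ (∀ i < n, ∃ j, RittSwapAt j (c i) (c (i + 1))) ∧ c n = m := by
  induction h with
  | refl l => exact ⟨fun _ ↦ l, rfl, by simp, rfl⟩
  | @step n j l l' m hs _ ih =>
    obtain ⟨c, h0, h1, h2⟩ := ih
    refine ⟨fun i ↦ Nat.casesOn i l c, rfl, ?_, h2⟩
    rintro (_ | i) hi
    · exact ⟨j, by simpa [h0] using hs⟩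
    · exact h1 i (by omega)

theorem exists_swap_head {a b c d : ℂ[X]} (ha : Indecomposable a) (hb : Indecomposable b)
    (hc : Indecomposable c) (hd : Indecomposable d) (e : a.comp b = c.comp d)
    (hcop : Nat.Coprime a.natDegree b.natDegree) (had : a.natDegree = d.natDegree) :
    ∃ c' d' : ℂ[X], (∀ s, RittSwapAt 0 (b :: a :: s) (d' :: c' :: s)) ∧
      Indecomposable c' ∧ Indecomposable d' ∧ d'.natDegree = a.natDegree ∧
      c'.natDegree = b.natDegree ∧ c'.comp d' = a.comp b := by
  obtain ⟨L, M, N, A, B, R, S, hL, hM, hN, hA, hB, hI, hS⟩ :=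
    exists_basicRittIdentity ha hb hc hd e hcop had
  obtain ⟨N', hN', hNN', hN'N⟩ := IsLinearPoly.exists_inv hN
  have ha2 := ha.1
  have hc2 := hc.1
  have hd2 := hd.1
  have hcb : c.natDegree = b.natDegree :=
    natDegree_eq_of_comp_eq e had (by omega)
  have hcomp : (L.comp R).comp (S.comp N') = c.comp d := by
    rw [← e, ← comp_assoc, comp_assoc L, ← hI.1, ← comp_assoc, hA, comp_assoc a, hB,
      comp_assoc, comp_assoc, hNN', comp_X]
  have hSN : (S.comp N').natDegree = d.natDegree := by rw [natDegree_comp_linear hN', hS]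
  obtain ⟨K, hK, hKe⟩ := exists_linear_of_comp_eq (g := c)
    (g' := L.comp R) (by omega) (by omega) hSN.symm hcomp.symm
  have hdec : Indecomposable (S.comp N') := hKe ▸ indecomposable_linear_comp hK hd
  have hR : (L.comp R).comp K = c := by
    apply comp_right_cancel (h := d) (by omega)
    rw [comp_assoc, ← hKe, hcomp]
  obtain ⟨K', hK', hKK', -⟩ := IsLinearPoly.exists_inv hK
  have hR' : L.comp R = c.comp K' := by rw [← hR, comp_assoc, hKK', comp_X]
  refine ⟨L.comp R, S.comp N', fun s ↦ ⟨by simp, by simp, ?_, L, M, N, A, B, R, S, hL, hM, hN,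
    by simpa using hA, by simpa using hB, hI, by simp, ?_⟩, hR' ▸ indecomposable_comp_linear hK' hc, hdec,
    hSN.trans had.symm, ?_, hcomp.trans e.symm⟩
  · rintro (_ | _ | i) h0 h1
    · simp at h0
    · simp at h1
    · simp
  · simp [comp_assoc, hN'N]
  · rw [hR', natDegree_comp_linear hK', hcb]

/-- An indecomposable right factor of a composition of indecomposables can be moved to the
innermost position by Ritt swaps. -/
theorem exists_move : ∀ (l : List ℂ[X]) (g h : ℂ[X]), (∀ p ∈ l, Indecomposable p) →
    Indecomposable h → compList l = g.comp h →
    ∃ (n : ℕ) (h' : ℂ[X]) (t : List ℂ[X]), n + 1 ≤ l.length ∧ SwapChain n l (h' :: t) ∧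
      h'.natDegree = h.natDegree ∧ (∀ p ∈ h' :: t, Indecomposable p) ∧
      compList (h' :: t) = compList l ∧
      ((h' :: t).map natDegree).Perm (l.map natDegree)
  | [], g, h, _, hh, e => by
    have := congrArg natDegree e
    rw [compList, List.foldr_nil, natDegree_X, natDegree_comp] at this
    have h2 := hh.1
    rw [Nat.eq_one_of_mul_eq_one_left this.symm] at h2
    omega
  | f :: t, g, h, hl, hh, e => by
    by_cases hd : f.natDegree = h.natDegree
    · exact ⟨0, f, t, by simp, .refl _, hd, hl, rfl, .refl _⟩
    have hf := hl f (by simp)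
    have hf2 := hf.1
    have hh2 := hh.1
    have ht : ∀ p ∈ t, Indecomposable p := fun p hp ↦ hl p (by simp [hp])
    obtain ⟨u, v, w, huv, hu, hv, hw, hui, hvi, hcop⟩ :=
      exists_square hf hh (natDegree_compList_pos hl) (compList_cons f t) e hd
    rw [← comp_assoc, compList_cons] at hw
    have htw := comp_right_cancel (by omega) hw
    obtain ⟨n, u', s, hn, hch, hu', hs, hcs, hperm⟩ := exists_move t w u ht hui htw
    rw [← hcs, compList_cons] at htw
    have hsi : ∀ p ∈ s, Indecomposable p := fun p hp ↦ hs p (by simp [hp])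
    have hu'i := hs u' (by simp)
    obtain ⟨M, hM, hMe⟩ := exists_linear_of_comp_eq (natDegree_compList_pos hsi) (by omega) hu' htw
    obtain ⟨M', hM', hMM', hM'M⟩ := IsLinearPoly.exists_inv hM
    have hsq : u'.comp f = (M'.comp v).comp h := by
      rw [comp_assoc, ← huv, hMe, comp_assoc, ← comp_assoc M', hM'M, X_comp]
    obtain ⟨c', d', hsw, hc', hd', hdd, hcd, hcd'⟩ := exists_swap_head hu'i hf
      (indecomposable_linear_comp hM' hvi) hh hsq (by rw [hu', hu]; exact hcop) (hu'.trans hu)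
    refine ⟨1 + n, d', c' :: s, ?_, ?_, by omega, ?_, ?_, ?_⟩
    · simp; omega
    · exact (hch.cons f).trans (.step (hsw s) (.refl _))
    · simp only [List.mem_cons]
      rintro p (rfl | rfl | hp)
      · exact hd'
      · exact hc'
      · exact hsi p hp
    · rw [compList_cons, compList_cons, comp_assoc, hcd', ← comp_assoc, ← compList_cons, hcs,
        ← compList_cons]
    · simp only [List.map_cons] at hperm ⊢
      rw [hdd, hcd]
      exact (List.Perm.swap _ _ _).trans (hperm.cons _)

theorem exists_chain : ∀ (k : ℕ) (l m : List ℂ[X]), l.length = k → (∀ p ∈ l, Indecomposable p) →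
    (∀ p ∈ m, Indecomposable p) → compList l = compList m →
    ∃ (n : ℕ) (l' : List ℂ[X]), n ≤ k * (k - 1) / 2 ∧ SwapChain n l l' ∧
      (∀ p ∈ l', Indecomposable p) ∧ compList l' = compList l ∧
      l'.map natDegree = m.map natDegree ∧ (l'.map natDegree).Perm (l.map natDegree) := by
  have hnil : ∀ m : List ℂ[X], (∀ p ∈ m, Indecomposable p) → (compList m).natDegree = 1 →
      m = [] := by
    rintro (_ | ⟨y, m⟩) hm e
    · rfl
    · rw [compList_cons, natDegree_comp] at e
      have h1 := (hm y (by simp)).1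
      rw [Nat.eq_one_of_mul_eq_one_left e] at h1
      omega
  intro k
  induction k with
  | zero =>
    intro l m hlen hl hm e
    obtain rfl := List.length_eq_zero_iff.mp hlen
    obtain rfl := hnil m hm (by rw [← e]; exact natDegree_X)
    exact ⟨0, [], le_rfl, .refl _, hl, rfl, rfl, .refl _⟩
  | succ k ih =>
    intro l m hlen hl hm e
    rcases m with _ | ⟨h, tm⟩
    · rw [hnil l hl (by rw [e]; exact natDegree_X)] at hlen
      simp at hlen
    have hh := hm h (by simp)
    have hh2 := hh.1
    have htm : ∀ p ∈ tm, Indecomposable p := fun p hp ↦ hm p (by simp [hp])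
    obtain ⟨n, h', t, hn, hch, hd, ht, hct, hperm⟩ := exists_move l _ h hl hh e
    have hti : ∀ p ∈ t, Indecomposable p := fun p hp ↦ ht p (by simp [hp])
    have e' := hct.trans e
    rw [compList_cons, compList_cons] at e'
    obtain ⟨K, hK, hKe⟩ := exists_linear_of_comp_eq (natDegree_compList_pos hti) (by omega) hd e'
    rw [hKe, ← comp_assoc] at e'
    have e2 := comp_right_cancel (by omega) e'
    have htl : t.length = k := by
      have := hch.length_eq
      simp at this; omega
    obtain ⟨m2, hm2, hm2c, hm2d⟩ : ∃ m2 : List ℂ[X], (∀ p ∈ m2, Indecomposable p) ∧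
        compList t = compList m2 ∧ m2.map natDegree = tm.map natDegree := by
      rcases tm with _ | ⟨y, ys⟩
      · rw [show compList [] = X from rfl, X_comp] at e2
        rw [hnil t hti (by rw [e2]; exact hK)]
        exact ⟨[], by simp, rfl, rfl⟩
      · refine ⟨y.comp K :: ys, ?_, by rw [e2, compList_cons, compList_cons, comp_assoc], ?_⟩
        · simp only [List.mem_cons]
          rintro p (rfl | hp)
          · exact indecomposable_comp_linear hK (htm y (by simp))
          · exact htm p (by simp [hp])
        · simp [natDegree_comp_linear hK]
    obtain ⟨n2, t', hn2, hch2, ht', hct', hdt', hpt'⟩ := ih t m2 htl hti hm2 hm2c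
    refine ⟨n2 + n, h' :: t', ?_, hch.trans (hch2.cons h'), ?_, ?_, ?_, ?_⟩
    · have h1 : (k + 1) * (k + 1 - 1) = k * (k - 1) + 2 * k := by
        rcases k with _ | k
        · simp
        · simp; ring
      rw [h1, Nat.add_mul_div_left _ _ two_pos]
      omega
    · simp only [List.mem_cons]
      rintro p (rfl | hp)
      · exact ht p (by simp)
      · exact ht' p hp
    · rw [compList_cons, hct', ← compList_cons, hct]
    · simp [hd, hdt', hm2d]
    · exact (hpt'.cons _).trans hperm

end Ritt

/-- For a polynomial `P` admitting a decomposition of length `k`, there are at most `k!`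
linear-equivalence classes of decompositions of `P`, and any decomposition of `P` can be
transformed into (a decomposition linearly equivalent to) any other by a sequence of at
most `k(k-1)/2` Ritt swaps. -/
theorem decompositions_finite_and_bounded_chains (P : ℂ[X]) (k : ℕ)
    (l0 : List ℂ[X]) (h0 : IsDecomposition l0 P) (hk : l0.length = k) :
    (∃ reps : List (List ℂ[X]), reps.length ≤ Nat.factorial k ∧
        ∀ m : List ℂ[X], IsDecomposition m P → ∃ l ∈ reps, LinearEquivalent l m) ∧
    (∀ l m : List ℂ[X], IsDecomposition l P → IsDecomposition m P →
        ∃ (n : ℕ) (c : ℕ → List ℂ[X]), n ≤ k * (k - 1) / 2 ∧ c 0 = l ∧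
          (∀ i < n, ∃ j : ℕ, RittSwapAt j (c i) (c (i + 1))) ∧
          LinearEquivalent (c n) m) := by
  simp only [Ritt.isDecomposition_iff] at *
  obtain ⟨-, h0i, h0c⟩ := h0
  classical
  have hperm : ∀ m : List ℂ[X], (∀ p ∈ m, Indecomposable p) → Ritt.compList m = P →
      (m.map natDegree).Perm (l0.map natDegree) := by
    intro m hm hc
    obtain ⟨n, l', -, -, -, -, h1, h2⟩ := Ritt.exists_chain _ l0 m rfl h0i hm (h0c.trans hc.symm)
    exact h1 ▸ h2
  refine ⟨⟨(l0.map natDegree).permutations.map fun D ↦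
    if h : ∃ l : List ℂ[X], (∀ p ∈ l, Indecomposable p) ∧ Ritt.compList l = P ∧
      l.map natDegree = D then h.choose else l0, ?_, ?_⟩, ?_⟩
  · rw [List.length_map, List.length_permutations, List.length_map, hk]
  · rintro m ⟨-, hm, hmc⟩
    have hex : ∃ l : List ℂ[X], (∀ p ∈ l, Indecomposable p) ∧ Ritt.compList l = P ∧
      l.map natDegree = m.map natDegree := ⟨m, hm, hmc, rfl⟩
    obtain ⟨h1, h2, h3⟩ := hex.choose_spec
    refine ⟨hex.choose, List.mem_map.mpr ⟨m.map natDegree,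
      List.mem_permutations.mpr (hperm m hm hmc), dif_pos hex⟩,
      Ritt.linearEquivalent_of_degrees h1 hm h3 (h2.trans hmc.symm)⟩
  · rintro l m ⟨-, hl, hlc⟩ ⟨-, hm, hmc⟩
    have hlk : l.length = k := by
      simpa [hk] using (hperm l hl hlc).length_eq
    obtain ⟨n, l', hn, hch, hl', hc', hd, -⟩ :=
      Ritt.exists_chain k l m hlk hl hm (hlc.trans hmc.symm)
    obtain ⟨c, hc0, hcs, hcn⟩ := hch.exists_fun
    exact ⟨n, c, hn, hc0, hcs, hcn ▸ Ritt.linearEquivalent_of_degrees hl' hm hd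
      (hc'.trans (hlc.trans hmc.symm))⟩
end
end

section
/- If f and g are ritty polynomials over ℂ and there exist linear polynomials L and M with L ∘ f ∘ M = g, then there exist a ritty polynomial h, scalings S₁ and S₂, and translations T₁ and T₂ such that h = S₁ ∘ f ∘ S₂ and g = T₁ ∘ h ∘ T₂. -/
open Polynomial

noncomputable section

/-- A scaling `x ↦ a·x` with `a ≠ 0`. -/
def IsScaling (L : ℂ[X]) : Prop := ∃ a : ℂ, a ≠ 0 ∧ L = Polynomial.C a * X

/-- A translation `x ↦ x + b`. -/
def IsTranslation (L : ℂ[X]) : Prop := ∃ b : ℂ, L = X + Polynomial.C b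

theorem exists_add_inv_eq (y : ℂ) : ∃ x : ℂ, x ≠ 0 ∧ x + x⁻¹ = y := by
  obtain ⟨s, hs⟩ := IsAlgClosed.exists_pow_nat_eq (y ^ 2 - 4) (n := 2) (by norm_num)
  have hmul : (y + s) / 2 * ((y - s) / 2) = 1 := by linear_combination -hs / 4
  refine ⟨(y + s) / 2, left_ne_zero_of_mul_eq_one hmul, ?_⟩
  rw [inv_eq_of_mul_eq_one_right hmul]
  ring

/-- Odd-degree Chebyshev polynomials have the form `X * v(X²)`. -/
theorem exists_isChebyshev_odd (m : ℕ) : ∃ v : ℂ[X], v.Monic ∧ v.natDegree = m ∧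
    v.eval 0 = (-1) ^ m * (2 * m + 1) ∧ IsChebyshev (2 * m + 1) (X * v.comp (X ^ 2)) := by
  induction m using Nat.twoStepInduction with
  | zero => exact ⟨1, monic_one, by simp, by simp, fun x _ => by simp⟩
  | one =>
    refine ⟨X - C 3, monic_X_sub_C 3, natDegree_X_sub_C 3, by norm_num, fun x hx => ?_⟩
    simp
    field_simp
    ring
  | more m ihv ihw =>
    obtain ⟨v, -, hvd, hv0, hv⟩ := ihv
    obtain ⟨w, hwm, hwd, hw0, hw⟩ := ihw
    have hmon : ((X - C 2) * w).Monic := (monic_X_sub_C 2).mul hwm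
    have hnat : ((X - C 2) * w).natDegree = m + 2 := by
      rw [(monic_X_sub_C 2).natDegree_mul hwm, natDegree_X_sub_C, hwd]
      omega
    have hlt : v.natDegree < ((X - C 2) * w).natDegree := by omega
    refine ⟨(X - C 2) * w - v, hmon.sub_of_left (degree_lt_degree hlt), ?_, ?_, fun x hx => ?_⟩
    · rw [natDegree_sub_eq_left_of_natDegree_lt hlt, hnat]
    · simp only [eval_sub, eval_mul, eval_X, eval_C, hv0, hw0]
      push_cast
      ring
    · have h₁ := hv x hx
      have h₂ := hw x hx
      simp only [eval_mul, eval_X, eval_comp, eval_pow, eval_sub, eval_C] at h₁ h₂ ⊢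
      have hinv : x * x⁻¹ = 1 := mul_inv_cancel₀ hx
      generalize x⁻¹ = z at *
      have e : (x + z) ^ 2 - 2 = x ^ 2 + z ^ 2 := by linear_combination 2 * hinv
      have hsq : x ^ 2 * z ^ 2 = 1 := by rw [← mul_pow, hinv, one_pow]
      rw [e]
      have p₁ : x ^ (2 * (m + 2) + 1) = x ^ 4 * x ^ (2 * m + 1) := by ring
      have p₂ : z ^ (2 * (m + 2) + 1) = z ^ 4 * z ^ (2 * m + 1) := by ring
      have p₃ : x ^ (2 * (m + 1) + 1) = x ^ 2 * x ^ (2 * m + 1) := by ring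
      have p₄ : z ^ (2 * (m + 1) + 1) = z ^ 2 * z ^ (2 * m + 1) := by ring
      rw [p₁, p₂]
      rw [p₃, p₄] at h₂
      linear_combination (x ^ 2 + z ^ 2) * h₂ - h₁ +
        (x ^ (2 * m + 1) + z ^ (2 * m + 1)) * hsq

theorem IsChebyshev.unique {n : ℕ} {p q : ℂ[X]} (hp : IsChebyshev n p) (hq : IsChebyshev n q) :
    p = q := by
  refine Polynomial.funext fun y => ?_
  obtain ⟨x, hx, rfl⟩ := exists_add_inv_eq y
  rw [hp x hx, hq x hx]

/-- A ritty polynomial is a power of prime exponent or of the form `x^k · u(x^ℓ)^n`; the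
Chebyshev polynomials of odd prime degree are of the latter form. -/
theorem IsRitty.eq_pow_or_eq_mul {f : ℂ[X]} (hf : IsRitty f) :
    (∃ p : ℕ, p.Prime ∧ f = X ^ p) ∨
    (∃ (k el n : ℕ) (u : ℂ[X]), 1 ≤ k ∧ 1 ≤ el ∧ 1 ≤ n ∧
     Nat.gcd k el = 1 ∧ Nat.gcd k n = 1 ∧
     u.Monic ∧ 0 < u.natDegree ∧ u.eval 0 ≠ 0 ∧ (1 < el ∨ 1 < n) ∧
     f = X ^ k * (u.comp (X ^ el)) ^ n) := by
  obtain ⟨-, hf | ⟨p, hp, -, hf⟩ | ⟨p, hp, ⟨m, rfl⟩, hf⟩ | hf⟩ := hf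
  · exact Or.inl ⟨2, Nat.prime_two, hf⟩
  · exact Or.inl ⟨p, hp, hf⟩
  · obtain ⟨v, hvm, hvd, hv0, hv⟩ := exists_isChebyshev_odd m
    have hm : 0 < m := by
      rcases Nat.eq_zero_or_pos m with rfl | hm
      · exact absurd hp (by norm_num)
      · exact hm
    refine Or.inr ⟨1, 2, 1, v, le_rfl, one_le_two, le_rfl, rfl, rfl, hvm, hvd ▸ hm, ?_,
      Or.inl one_lt_two, by rw [pow_one, pow_one]; exact hf.unique hv⟩
    rw [hv0]
    exact mul_ne_zero (pow_ne_zero _ (by norm_num)) (by exact_mod_cast (2 * m).succ_ne_zero)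
  · exact Or.inr hf

theorem IsRitty.monic {f : ℂ[X]} (hf : IsRitty f) : f.Monic := by
  obtain ⟨p, -, rfl⟩ | ⟨k, el, n, u, -, hel, -, -, -, hu, -, -, -, rfl⟩ := hf.eq_pow_or_eq_mul
  · exact monic_X_pow p
  · refine (monic_X_pow k).mul ((hu.comp (monic_X_pow el) ?_).pow n)
    rw [natDegree_X_pow]
    omega

theorem Indecomposable.comp_scaling {f : ℂ[X]} (hf : Indecomposable f) {a c : ℂ}
    (ha : a ≠ 0) (hc : c ≠ 0) : Indecomposable ((C a * X).comp (f.comp (C c * X))) := by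
  refine ⟨?_, ?_⟩
  · rw [natDegree_comp, natDegree_comp, natDegree_C_mul_X _ ha, natDegree_C_mul_X _ hc, one_mul,
      mul_one]
    exact hf.1
  · rintro ⟨p, q, hp, hq, h⟩
    have hcomp {b : ℂ} (hb : b ≠ 0) : (C b * X).comp (C b⁻¹ * X) = X := by
      simp [← mul_assoc, ← C_mul, hb]
    have hcomp' {b : ℂ} (hb : b ≠ 0) : (C b⁻¹ * X).comp (C b * X) = X := by
      simp [← mul_assoc, ← C_mul, hb]
    refine hf.2 ⟨(C a⁻¹ * X).comp p, q.comp (C c⁻¹ * X), ?_, ?_, ?_⟩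
    · rwa [natDegree_comp, natDegree_C_mul_X _ (inv_ne_zero ha), one_mul]
    · rwa [natDegree_comp, natDegree_C_mul_X _ (inv_ne_zero hc), mul_one]
    · calc f = ((C a⁻¹ * X).comp (C a * X)).comp (f.comp ((C c * X).comp (C c⁻¹ * X))) := by
            rw [hcomp hc, hcomp' ha, comp_X, X_comp]
        _ = (C a⁻¹ * X).comp (((C a * X).comp (f.comp (C c * X))).comp (C c⁻¹ * X)) := by
            simp only [comp_assoc]
        _ = _ := by rw [h]; simp only [comp_assoc]

/-- Rescaling a ritty polynomial gives a ritty polynomial as soon as the result is monic. -/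
theorem IsRitty.comp_scaling {f : ℂ[X]} (hf : IsRitty f) {a c : ℂ} (hc : c ≠ 0)
    (hac : a * c ^ f.natDegree = 1) : IsRitty ((C a * X).comp (f.comp (C c * X))) := by
  have ha : a ≠ 0 := left_ne_zero_of_mul_eq_one hac
  obtain ⟨p, -, rfl⟩ | ⟨k, el, n, u, hk, hel, hn, hkel, hkn, hu, hud, hu0, hor, rfl⟩ :=
    hf.eq_pow_or_eq_mul
  · rw [natDegree_X_pow] at hac
    have : (C a * X).comp ((X ^ p : ℂ[X]).comp (C c * X)) = X ^ p := by
      simp only [mul_comp, C_comp, X_comp, X_pow_comp, mul_pow]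
      rw [← mul_assoc, ← C_pow, ← C_mul, hac, C_1, one_mul]
    rwa [this]
  · refine ⟨hf.1.comp_scaling ha hc, Or.inr (Or.inr (Or.inr ?_))⟩
    set r : ℂ := (c ^ el) ^ u.natDegree with hr
    have hcel : c ^ el ≠ 0 := pow_ne_zero _ hc
    have hr0 : r ≠ 0 := pow_ne_zero _ hcel
    have hdeg : (X ^ k * (u.comp (X ^ el)) ^ n : ℂ[X]).natDegree = k + n * (u.natDegree * el) := by
      have hucomp : u.comp (X ^ el) ≠ 0 := by
        refine (hu.comp (monic_X_pow el) ?_).ne_zero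
        rw [natDegree_X_pow]
        omega
      rw [natDegree_mul (pow_ne_zero _ X_ne_zero) (pow_ne_zero _ hucomp), natDegree_pow,
        natDegree_pow, natDegree_comp, natDegree_X_pow, natDegree_X, mul_one]
    have hacr : a * c ^ k * r ^ n = 1 := by
      rw [← hac, hdeg, hr]
      ring
    refine ⟨k, el, n, C r⁻¹ * u.comp (C (c ^ el) * X), hk, hel, hn, hkel, hkn, ?_, ?_, ?_, hor, ?_⟩
    · rw [Monic, leadingCoeff_mul, leadingCoeff_C,
        leadingCoeff_comp (by rw [natDegree_C_mul_X _ hcel]; exact one_ne_zero), hu.leadingCoeff,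
        leadingCoeff_C_mul_X, one_mul, ← hr, inv_mul_cancel₀ hr0]
    · rwa [natDegree_C_mul (inv_ne_zero hr0), natDegree_comp, natDegree_C_mul_X _ hcel, mul_one]
    · simp [eval_comp, hr0, hu0]
    · refine Polynomial.funext fun x => ?_
      simp only [eval_mul, eval_comp, eval_pow, eval_C, eval_X, mul_pow, inv_pow]
      have hrn : a * c ^ k = (r ^ n)⁻¹ := eq_inv_of_mul_eq_one_left hacr
      rw [← hrn]
      ring

/-- If `f` and `g` are ritty polynomials linearly related via `g = L ∘ f ∘ M`, then
there is a ritty polynomial `h` which is scaling-related to `f` and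
translation-related to `g`. -/
theorem linearly_related_ritty_factorization (f g L M : ℂ[X])
    (hf : IsRitty f) (hg : IsRitty g)
    (hL : IsLinearPoly L) (hM : IsLinearPoly M)
    (h : L.comp (f.comp M) = g) :
    ∃ h' S₁ S₂ T₁ T₂ : ℂ[X], IsRitty h' ∧
      IsScaling S₁ ∧ IsScaling S₂ ∧ IsTranslation T₁ ∧ IsTranslation T₂ ∧
      h' = S₁.comp (f.comp S₂) ∧ g = T₁.comp (h'.comp T₂) := by
  obtain ⟨a, b, rfl⟩ := exists_eq_X_add_C_of_natDegree_le_one (le_of_eq hL)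
  obtain ⟨c, d, rfl⟩ := exists_eq_X_add_C_of_natDegree_le_one (le_of_eq hM)
  have ha : a ≠ 0 := by
    rintro rfl
    simp [IsLinearPoly] at hL
  have hc : c ≠ 0 := by
    rintro rfl
    simp [IsLinearPoly] at hM
  have hac : a * c ^ f.natDegree = 1 := by
    have hlead := hg.monic.leadingCoeff
    have hf2 := hf.1.1
    rwa [← h, leadingCoeff_comp, leadingCoeff_comp, leadingCoeff_linear ha,
      leadingCoeff_linear hc, hL, hf.monic.leadingCoeff, one_mul, pow_one] at hlead
    · rw [hM]
      exact one_ne_zero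
    · rw [natDegree_comp, hM]
      omega
  refine ⟨_, C a * X, C c * X, X + C b, X + C (d / c), hf.comp_scaling hc hac, ⟨a, ha, rfl⟩,
    ⟨c, hc, rfl⟩, ⟨b, rfl⟩, ⟨d / c, rfl⟩, rfl, ?_⟩
  rw [← h]
  refine Polynomial.funext fun x => ?_
  simp only [eval_comp, eval_add, eval_mul, eval_C, eval_X]
  rw [mul_add, mul_div_cancel₀ d hc]
end
end

section
/- Let u, u₂ ∈ ℂ[x] be monic non-constant polynomials with u(0) ≠ 0 and u₂(0) ≠ 0, let k, ℓ, n, k₂, ℓ₂, n₂ be positive integers with k ≥ 1 and k₂ ≥ 1, and let A, B ∈ ℂ with A ≠ 0. If the polynomial identity B + (x+A)^k · u((x+A)^ℓ)^n = x^{k₂} · u₂(x^{ℓ₂})^{n₂} holds in ℂ[x], then ℓ = 1 or ℓ₂ = 1. -/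
open Polynomial

noncomputable section

/-- In `x ^ k * v(x ^ l)` with `2 ≤ l`, the coefficient just below the top degree vanishes. -/
theorem coeff_X_pow_mul_comp_X_pow_eq_zero {R : Type*} [CommSemiring R] (v : R[X])
    {k l m : ℕ} (hl : 2 ≤ l) (hm : 0 < m) :
    (X ^ k * v.comp (X ^ l)).coeff (k + l * m - 1) = 0 := by
  have hlm : 1 ≤ l * m := Nat.mul_pos (by omega) hm
  rw [← expand_eq_comp_X_pow, show k + l * m - 1 = l * m - 1 + k by omega, coeff_X_pow_mul,
    coeff_expand (by omega), if_neg]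
  intro h
  have h1 : l ∣ 1 := by
    simpa [Nat.sub_sub_self hlm] using Nat.dvd_sub (Dvd.intro m rfl : l ∣ l * m) h
  have := Nat.le_of_dvd one_pos h1
  omega

/-- Translating a monic polynomial of degree `N + 1` without `x ^ N` term by `a` creates the
coefficient `(N + 1) * a` in degree `N`. -/
theorem coeff_comp_X_add_C_of_coeff_eq_zero {R : Type*} [CommRing R] {p : R[X]} {N : ℕ}
    (hp : p.Monic) (hdeg : p.natDegree = N + 1) (hN : p.coeff N = 0) (a : R) :
    (p.comp (X + C a)).coeff N = (N + 1) * a := by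
  have hr : (p - X ^ (N + 1)).degree < (N : WithBot ℕ) := by
    rw [degree_lt_iff_coeff_zero]
    intro m hm
    rcases hm.eq_or_lt with rfl | hm
    · simp [hN, coeff_X_pow]
    rcases (Nat.succ_le_of_lt hm).eq_or_lt with rfl | hm
    · have : p.coeff (N + 1) = 1 := hdeg ▸ hp
      simp [this]
    · rw [coeff_sub, coeff_X_pow, if_neg (by omega),
        coeff_eq_zero_of_natDegree_lt (by omega), sub_zero]
  have ht : (taylor a (p - X ^ (N + 1))).coeff N = 0 :=
    coeff_eq_zero_of_degree_lt (by rwa [degree_taylor])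
  rw [map_sub, coeff_sub, sub_eq_zero, taylor_apply, taylor_apply, pow_comp, X_comp,
    coeff_X_add_C_pow] at ht
  rw [ht]
  simp [mul_comm]

/-- If monic non-constant `u, u₂` with `u(0) ≠ 0 ≠ u₂(0)`, positive integers
`k, ℓ, n, k₂, ℓ₂, n₂`, and `A ≠ 0`, `B` satisfy
`B + (x+A)^k · u((x+A)^ℓ)^n = x^{k₂} · u₂(x^{ℓ₂})^{n₂}`, then `ℓ = 1` or `ℓ₂ = 1`. -/
theorem translation_relation_ell_eq_one (u u₂ : ℂ[X]) (k l n k₂ l₂ n₂ : ℕ) (A B : ℂ)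
    (hu : u.Monic) (hund : 0 < u.natDegree) (hu0 : u.eval 0 ≠ 0)
    (hu₂ : u₂.Monic) (hu₂nd : 0 < u₂.natDegree) (hu₂0 : u₂.eval 0 ≠ 0)
    (hk : 0 < k) (hl : 0 < l) (hn : 0 < n)
    (hk₂ : 0 < k₂) (hl₂ : 0 < l₂) (hn₂ : 0 < n₂)
    (hA : A ≠ 0)
    (heq : Polynomial.C B + (X + Polynomial.C A) ^ k *
             (u.comp ((X + Polynomial.C A) ^ l)) ^ n
         = X ^ k₂ * (u₂.comp (X ^ l₂)) ^ n₂) :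
    l = 1 ∨ l₂ = 1 := by
  by_contra! hcon
  obtain ⟨hl1, hl₂1⟩ := hcon
  have monic_pow {v : ℂ[X]} (hv : v.Monic) {j : ℕ} (hj : 0 < j) (a b : ℕ) :
      (X ^ a * (v ^ b).comp (X ^ j)).Monic :=
    (monic_X_pow a).mul ((hv.pow b).comp (monic_X_pow j) (by simp [hj.ne']))
  have natDegree_pow {v : ℂ[X]} (hv : v.Monic) {j : ℕ} (hj : 0 < j) (a b : ℕ) :
      (X ^ a * (v ^ b).comp (X ^ j)).natDegree = a + j * (b * v.natDegree) := by
    rw [(monic_X_pow a).natDegree_mul ((hv.pow b).comp (monic_X_pow j) (by simp [hj.ne'])),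
      natDegree_comp, natDegree_X_pow, natDegree_X_pow, hv.natDegree_pow, mul_comm j]
  set P : ℂ[X] := X ^ k * (u ^ n).comp (X ^ l) with hP
  set Q : ℂ[X] := X ^ k₂ * (u₂ ^ n₂).comp (X ^ l₂) with hQ
  have hPQ : C B + P.comp (X + C A) = Q := by
    simpa [hP, hQ, comp_assoc] using heq
  have hm : 0 < n * u.natDegree := Nat.mul_pos hn hund
  have hm₂ : 0 < n₂ * u₂.natDegree := Nat.mul_pos hn₂ hu₂nd
  have hPdeg : P.natDegree = k + l * (n * u.natDegree) := natDegree_pow hu hl k n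
  have hQdeg : Q.natDegree = k₂ + l₂ * (n₂ * u₂.natDegree) := natDegree_pow hu₂ hl₂ k₂ n₂
  have hdeg : Q.natDegree = P.natDegree := by
    rw [← hPQ, natDegree_C_add, natDegree_comp, natDegree_X_add_C, mul_one]
  have hpos : 0 < l * (n * u.natDegree) := Nat.mul_pos hl hm
  obtain ⟨N, hN⟩ : ∃ N, P.natDegree = N + 1 := ⟨P.natDegree - 1, by omega⟩
  have hPN : P.coeff N = 0 := by
    rw [show N = k + l * (n * u.natDegree) - 1 by omega]
    exact coeff_X_pow_mul_comp_X_pow_eq_zero _ (by omega) hm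
  have hQN : Q.coeff N = 0 := by
    rw [show N = k₂ + l₂ * (n₂ * u₂.natDegree) - 1 by omega]
    exact coeff_X_pow_mul_comp_X_pow_eq_zero _ (by omega) hm₂
  rw [← hPQ, coeff_add, coeff_C_of_ne_zero (by omega), zero_add,
    coeff_comp_X_add_C_of_coeff_eq_zero (monic_pow hu hl k n) hN hPN] at hQN
  exact mul_ne_zero (Nat.cast_add_one_ne_zero N) hA hQN
end
end

section
/- Let k, n, k₂, ℓ₂, n₂ be positive integers with gcd(k,n) = 1, n ≥ 2, gcd(k₂,ℓ₂) = gcd(k₂,n₂) = 1 and ℓ₂·n₂ ≥ 2. Let u, u₂ ∈ ℂ[x] be monic non-constant polynomials with u(0) ≠ 0, u₂(0) ≠ 0, and u(1) = 0, and let B ∈ ℂ. If B + (x+1)^k · u(x+1)^n = x^{k₂} · u₂(x^{ℓ₂})^{n₂} in ℂ[x], then B = 0, ℓ₂ = 1, and there exist positive integers m, m₂ and a monic polynomial U ∈ ℂ[x] such that k = m₂·n₂, k₂ = m·n, gcd(m·n, n₂) = 1, gcd(m₂·n₂, n) = 1, u(x) = (x−1)^m · U(x)^{n₂}, and u₂(x)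 = (x+1)^{m₂} · U(x+1)^n. -/
open Polynomial

noncomputable section

/-- Two monic complex polynomials with a common power of coprime exponents are powers of a common
monic polynomial. -/
lemma exists_monic_pow_eq_of_coprime {w y : ℂ[X]} {n r : ℕ} (hw : w.Monic) (hy : y.Monic)
    (hr : 0 < r) (hnr : Nat.Coprime n r) (h : w ^ n = y ^ r) :
    ∃ U : ℂ[X], U.Monic ∧ w = U ^ r ∧ y = U ^ n := by
  have hroots : n • w.roots = r • y.roots := by
    rw [← roots_pow, ← roots_pow, h]
  have hprod {p : ℂ[X]} (hp : p.Monic) : p = (p.roots.map fun a ↦ X - C a).prod :=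
    (IsAlgClosed.splits p).eq_prod_roots_of_monic hp
  obtain ⟨t, ht⟩ : ∃ t : Multiset ℂ, w.roots = r • t := by
    refine Multiset.exists_smul_of_dvd_count _ fun a _ ↦ ?_
    have h' := congrArg (Multiset.count a) hroots
    rw [Multiset.count_nsmul, Multiset.count_nsmul] at h'
    exact hnr.symm.dvd_of_dvd_mul_left ⟨_, h'⟩
  have ht' : y.roots = n • t := by
    ext a
    have h' := congrArg (Multiset.count a) hroots
    rw [ht] at h'
    simp only [Multiset.count_nsmul] at h' ⊢
    exact Nat.eq_of_mul_eq_mul_left hr (by rw [← h']; ring)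
  refine ⟨(t.map fun a ↦ X - C a).prod, monic_multiset_prod_of_monic _ _ fun a _ ↦ monic_X_sub_C a,
    ?_, ?_⟩
  · rw [hprod hw, ht, Multiset.map_nsmul, Multiset.prod_nsmul]
  · rw [hprod hy, ht', Multiset.map_nsmul, Multiset.prod_nsmul]

lemma rootMultiplicity_pow_eq (p : ℂ[X]) (a : ℂ) (n : ℕ) :
    (p ^ n).rootMultiplicity a = n * p.rootMultiplicity a := by
  simp [← count_roots, roots_pow]

lemma rootMultiplicity_mul_pow_left {p q : ℂ[X]} {a : ℂ} (hp : p.eval a ≠ 0) (hq : q ≠ 0)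
    (k n : ℕ) : (p ^ k * q ^ n).rootMultiplicity a = n * q.rootMultiplicity a := by
  have hp0 : p ≠ 0 := by rintro rfl; simp at hp
  rw [rootMultiplicity_mul (mul_ne_zero (pow_ne_zero _ hp0) (pow_ne_zero _ hq)),
    rootMultiplicity_pow_eq, rootMultiplicity_pow_eq, rootMultiplicity_eq_zero hp]
  simp

lemma rootMultiplicity_X_sub_C_pow_mul_pow {q : ℂ[X]} {a : ℂ} (hq : q.eval a ≠ 0) (k n : ℕ) :
    ((X - C a) ^ k * q ^ n).rootMultiplicity a = k := by
  have hX : (X - C a : ℂ[X]) ≠ 0 := X_sub_C_ne_zero a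
  rw [mul_comm, rootMultiplicity_mul_pow_left hq hX, rootMultiplicity_X_sub_C_self, mul_one]

/-- A monic polynomial splits off the full power of a linear factor. -/
lemma exists_monic_eq_X_sub_C_pow_mul {p : ℂ[X]} (hp : p.Monic) (a : ℂ) :
    ∃ q : ℂ[X], q.Monic ∧ p = (X - C a) ^ p.rootMultiplicity a * q := by
  obtain ⟨q, hq⟩ := pow_rootMultiplicity_dvd p a
  refine ⟨q, ?_, hq⟩
  rw [hq] at hp
  exact ((monic_X_sub_C a).pow _).of_mul_monic_left hp

/-- If `X ^ k₂ * R` with `R` a polynomial in `X ^ l` is of the form `(X + 1) ^ k * v ^ n` with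
`v (-1) ≠ 0` and `k` coprime to `n ≥ 2`, then `l = 1`. -/
lemma eq_one_of_X_add_one_pow_mul_pow_eq {v w : ℂ[X]} {k n k₂ l r : ℕ} (hl : 0 < l) (hn : 2 ≤ n)
    (hkn : Nat.gcd k n = 1) (hv : v.eval (-1) ≠ 0)
    (h : (X + 1) ^ k * v ^ n = X ^ k₂ * (w.comp (X ^ l)) ^ r) : l = 1 := by
  by_contra hl1
  obtain ⟨ζ, hζ⟩ : ∃ ζ : ℂ, IsPrimitiveRoot ζ l := ⟨_, Complex.isPrimitiveRoot_exp l hl.ne'⟩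
  have hζ0 : ζ ≠ 0 := hζ.ne_zero hl.ne'
  have hζ1 : ζ ≠ 1 := hζ.ne_one (by omega)
  have hX : (X + 1 : ℂ[X]) = X - C (-1) := by simp
  have hv0 : v ≠ 0 := by rintro rfl; simp at hv
  have hvζ : v.comp (C ζ * X) ≠ 0 := by
    intro h0
    apply hv0
    have := congrArg (fun p ↦ p.comp (C ζ⁻¹ * X)) h0
    simpa [comp_assoc, ← mul_assoc, ← C_mul, hζ0] using this
  have key : (C ζ * X + 1) ^ k * (v.comp (C ζ * X)) ^ n
      = C (ζ ^ k₂) * ((X + 1) ^ k * v ^ n) := by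
    have h' := congrArg (fun p ↦ p.comp (C ζ * X)) h
    simp only [mul_comp, pow_comp, add_comp, X_comp, one_comp, comp_assoc] at h'
    rw [h', h, mul_pow (C ζ) X l, ← C_pow, hζ.pow_eq_one, mul_pow, C_pow]
    simp [mul_assoc]
  have hmul := congrArg (rootMultiplicity (-1)) key
  rw [rootMultiplicity_mul_pow_left (by simpa [neg_add_eq_zero] using hζ1) hvζ,
    ← count_roots (C (ζ ^ k₂) * _), roots_C_mul _ (pow_ne_zero _ hζ0), count_roots, hX,
    rootMultiplicity_X_sub_C_pow_mul_pow hv] at hmul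
  have : n ∣ Nat.gcd k n := Nat.dvd_gcd ⟨_, hmul.symm⟩ dvd_rfl
  rw [hkn, Nat.dvd_one] at this
  omega

/-- Type J classification: if `u(1) = 0` and
`B + (x+1)^k · u(x+1)^n = x^{k₂} · u₂(x^{ℓ₂})^{n₂}`, then `B = 0`, `ℓ₂ = 1`, and the
data come from a type J ritty polynomial:
`u(x) = (x−1)^m · U(x)^{n₂}` and `u₂(x) = (x+1)^{m₂} · U(x+1)^n` with `k = m₂n₂`,
`k₂ = mn`, `gcd(mn, n₂) = gcd(m₂n₂, n) = 1`. -/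
theorem translation_relation_typeJ (u u₂ : ℂ[X]) (k n k₂ l₂ n₂ : ℕ) (B : ℂ)
    (hk : 0 < k) (hn : 0 < n) (hk₂ : 0 < k₂) (hl₂ : 0 < l₂) (hn₂ : 0 < n₂)
    (hkn : Nat.gcd k n = 1) (hn2 : 2 ≤ n)
    (hk₂l₂ : Nat.gcd k₂ l₂ = 1) (hk₂n₂ : Nat.gcd k₂ n₂ = 1) (hl₂n₂ : 2 ≤ l₂ * n₂)
    (hu : u.Monic) (hund : 0 < u.natDegree) (hu0 : u.eval 0 ≠ 0)
    (hu₂ : u₂.Monic) (hu₂nd : 0 < u₂.natDegree) (hu₂0 : u₂.eval 0 ≠ 0)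
    (hu1 : u.eval 1 = 0)
    (heq : Polynomial.C B + (X + 1) ^ k * (u.comp (X + 1)) ^ n
         = X ^ k₂ * (u₂.comp (X ^ l₂)) ^ n₂) :
    B = 0 ∧ l₂ = 1 ∧
    ∃ (m m₂ : ℕ) (U : ℂ[X]), 0 < m ∧ 0 < m₂ ∧ U.Monic ∧
      k = m₂ * n₂ ∧ k₂ = m * n ∧
      Nat.gcd (m * n) n₂ = 1 ∧ Nat.gcd (m₂ * n₂) n = 1 ∧
      u = (X - 1) ^ m * U ^ n₂ ∧
      u₂ = (X + 1) ^ m₂ * (U.comp (X + 1)) ^ n := by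
  have hB : B = 0 := by
    have := congrArg (eval 0) heq
    simpa [eval_comp, hu1, hk₂.ne', hn.ne'] using this
  subst hB
  simp only [map_zero, zero_add] at heq
  have hv : (u.comp (X + 1)).eval (-1) ≠ 0 := by simpa [eval_comp] using hu0
  obtain rfl := eq_one_of_X_add_one_pow_mul_pow_eq hl₂ hn2 hkn hv heq
  refine ⟨rfl, rfl, ?_⟩
  have hX : (X + 1 : ℂ[X]) = X - C (-1) := by simp
  have hX0 : (X : ℂ[X]) = X - C 0 := by simp
  have hvm : (u.comp (X + 1)).Monic := by simpa using hu.comp_X_add_C 1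
  have huv : u = (u.comp (X + 1)).comp (X - 1) := by simp [comp_assoc]
  generalize u.comp (X + 1) = v at *
  simp only [pow_one, comp_X] at heq
  have hm : k₂ = v.rootMultiplicity 0 * n := by
    have := congrArg (rootMultiplicity 0) heq
    rw [rootMultiplicity_mul_pow_left (by simp) hvm.ne_zero, hX0,
      rootMultiplicity_X_sub_C_pow_mul_pow hu₂0] at this
    rw [← this, mul_comm]
  have hm₂ : k = u₂.rootMultiplicity (-1) * n₂ := by
    have := congrArg (rootMultiplicity (-1)) heq
    rw [rootMultiplicity_mul_pow_left (by simp) hu₂.ne_zero, hX,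
      rootMultiplicity_X_sub_C_pow_mul_pow hv] at this
    rw [this, mul_comm]
  obtain ⟨w, hw, hvw⟩ := exists_monic_eq_X_sub_C_pow_mul hvm 0
  obtain ⟨y, hy, huy⟩ := exists_monic_eq_X_sub_C_pow_mul hu₂ (-1)
  rw [← hX0] at hvw
  rw [← hX] at huy
  generalize v.rootMultiplicity 0 = m at *
  generalize u₂.rootMultiplicity (-1) = m₂ at *
  have hX1 : (X + 1 : ℂ[X]) ≠ 0 := hX ▸ X_sub_C_ne_zero (-1)
  have hwy : w ^ n = y ^ n₂ := by
    rw [hvw, huy, hm, hm₂] at heq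
    refine mul_left_cancel₀ (mul_ne_zero (pow_ne_zero (m₂ * n₂) hX1)
      (pow_ne_zero (m * n) X_ne_zero)) ?_
    linear_combination heq
  have hnn₂ : Nat.Coprime n n₂ := Nat.Coprime.coprime_dvd_left ⟨m, by rw [hm, mul_comm]⟩ hk₂n₂
  obtain ⟨U, hU, rfl, rfl⟩ := exists_monic_pow_eq_of_coprime hw hy hn₂ hnn₂ hwy
  refine ⟨m, m₂, U.comp (X - 1), Nat.pos_of_mul_pos_right (hm ▸ hk₂),
    Nat.pos_of_mul_pos_right (hm₂ ▸ hk), by simpa using hU.comp_X_sub_C 1, hm₂, hm,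
    hm ▸ hk₂n₂, hm₂ ▸ hkn, ?_, ?_⟩
  · rw [huv, hvw]
    simp
  · rw [huy]
    simp [comp_assoc]
end
end

section
/- Let k, n, k₂, ℓ₂, n₂ be positive integers with gcd(k,n) = 1, n ≥ 2, gcd(k₂,ℓ₂) = gcd(k₂,n₂) = 1 and ℓ₂·n₂ ≥ 2. Let u, u₂ ∈ ℂ[x] be monic non-constant polynomials with u(0) ≠ 0, u₂(0) ≠ 0, and u(1) ≠ 0, and let B ∈ ℂ. If B + (x+1)^k · u(x+1)^n = x^{k₂} · u₂(x^{ℓ₂})^{n₂} in ℂ[x], then k = k₂ = 1, n = 2, ℓ₂·n₂ = 2, and both u and u₂ are squarefree (all of their roots are simple). -/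
open Polynomial

noncomputable section

lemma pow_mul_pow_mul_dvd_self_and_derivative {R : Type*} [CommRing R] {L U W : R[X]} {k n : ℕ}
    (hk : 0 < k) (hn : 0 < n) (hWU : W ∣ U) (hWU' : W ∣ derivative U) :
    L ^ (k - 1) * U ^ (n - 1) * W ∣ L ^ k * U ^ n ∧
      L ^ (k - 1) * U ^ (n - 1) * W ∣ derivative (L ^ k * U ^ n) := by
  obtain ⟨k, rfl⟩ := Nat.exists_eq_add_of_lt hk
  obtain ⟨n, rfl⟩ := Nat.exists_eq_add_of_lt hn
  obtain ⟨S, hS⟩ := hWU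
  obtain ⟨T, hT⟩ := hWU'
  simp only [zero_add, Nat.add_sub_cancel]
  constructor
  · exact ⟨L * S, by rw [pow_succ, pow_succ]; nth_rewrite 2 [hS]; ring⟩
  · refine ⟨C ((k + 1 : ℕ) : R) * derivative L * S + C ((n + 1 : ℕ) : R) * L * T, ?_⟩
    rw [derivative_mul, derivative_pow_succ, derivative_pow_succ, hT]
    have hUn : U ^ (n + 1) = U ^ n * (W * S) := by rw [pow_succ, ← hS]
    rw [hUn]
    push_cast
    ring

lemma isCoprime_of_dvd_sub_C {K : Type*} [Field K] {D E Q : K[X]} {a b : K} (hab : a ≠ b)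
    (hD : D ∣ Q - C a) (hE : E ∣ Q - C b) : IsCoprime D E := by
  refine IsCoprime.of_isCoprime_of_dvd_left (IsCoprime.of_isCoprime_of_dvd_right ?_ hE) hD
  refine ⟨C (b - a)⁻¹, -C (b - a)⁻¹, ?_⟩
  calc C (b - a)⁻¹ * (Q - C a) + -C (b - a)⁻¹ * (Q - C b)
      = C ((b - a)⁻¹ * (b - a)) := by simp only [C_mul, C_sub]; ring
    _ = 1 := by rw [inv_mul_cancel₀ (sub_ne_zero.2 hab.symm), C_1]

/-- Critical points of a polynomial `Q` with a rotational symmetry: divisors of `Q'` supported over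
the value `0` and over a nonzero value `B` have bounded total degree, where the fibre over `B` is
repeated along the orbit of `B` under the symmetry. -/
lemma natDegree_add_mul_natDegree_lt {K : Type*} [Field K] [CharZero K] {D E Q : K[X]} {B ζ : K}
    {k l : ℕ} (hζ : IsPrimitiveRoot ζ l) (hkl : k.Coprime l) (hB : B ≠ 0)
    (hQ : 0 < Q.natDegree) (hsymm : Q.comp (C ζ * X) = C (ζ ^ k) * Q)
    (hDQ : D ∣ Q - C B) (hDQ' : D ∣ derivative Q) (hEQ : E ∣ Q) (hEQ' : E ∣ derivative Q) :
    E.natDegree + l * D.natDegree < Q.natDegree := by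
  have h0 : derivative Q ≠ 0 := fun h ↦ hQ.ne' (derivative_eq_zero.1 h)
  rcases Nat.eq_zero_or_pos l with rfl | hl
  · have := natDegree_le_of_dvd hEQ' h0
    have := natDegree_derivative_lt hQ.ne'
    omega
  have hζ0 : ζ ≠ 0 := hζ.ne_zero hl.ne'
  have hsymm_pow : ∀ j : ℕ, Q.comp (C (ζ ^ j) * X) = C ((ζ ^ k) ^ j) * Q := by
    intro j
    induction j with
    | zero => simp
    | succ j ih =>
      have : (C (ζ ^ (j + 1)) * X : K[X]) = (C (ζ ^ j) * X).comp (C ζ * X) := by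
        simp [pow_succ, mul_assoc]
      rw [this, ← comp_assoc, ih, mul_comp, hsymm, C_comp, pow_succ, C_mul, mul_assoc]
  have hdvd : ∀ j : ℕ, D.comp (C (ζ ^ j) * X) ∣ Q - C (((ζ ^ k) ^ j)⁻¹ * B) := by
    intro j
    have hne : (ζ ^ k) ^ j ≠ 0 := pow_ne_zero _ (pow_ne_zero _ hζ0)
    obtain ⟨S, hS⟩ := hDQ
    refine ⟨C (((ζ ^ k) ^ j)⁻¹) * S.comp (C (ζ ^ j) * X), ?_⟩
    have h := congrArg (fun p ↦ p.comp (C (ζ ^ j) * X)) hS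
    simp only [sub_comp, C_comp, mul_comp, hsymm_pow] at h
    rw [mul_left_comm, ← h, mul_sub, ← mul_assoc, ← C_mul, ← C_mul, inv_mul_cancel₀ hne, C_1,
      one_mul]
  have hdvd' : ∀ j : ℕ, D.comp (C (ζ ^ j) * X) ∣ derivative Q := by
    intro j
    have hne : (ζ ^ k) ^ j ≠ 0 := pow_ne_zero _ (pow_ne_zero _ hζ0)
    obtain ⟨S, hS⟩ := hDQ'
    refine ⟨C (((ζ ^ k) ^ j)⁻¹ * ζ ^ j) * S.comp (C (ζ ^ j) * X), ?_⟩
    have h := congrArg derivative (hsymm_pow j)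
    rw [derivative_comp, derivative_C_mul, derivative_C_mul, derivative_X, mul_one, hS,
      mul_comp, ← hS] at h
    calc derivative Q = C (((ζ ^ k) ^ j)⁻¹) * (C ((ζ ^ k) ^ j) * derivative Q) := by
          rw [← mul_assoc, ← C_mul, inv_mul_cancel₀ hne, C_1, one_mul]
      _ = _ := by rw [← h, C_mul]; ring
  have hinj : ∀ i < l, ∀ j < l, i ≠ j → ((ζ ^ k) ^ i)⁻¹ * B ≠ ((ζ ^ k) ^ j)⁻¹ * B := by
    intro i hi j hj hij h
    exact hij ((hζ.pow_of_coprime k hkl).pow_inj hi hj (inv_injective (mul_right_cancel₀ hB h)))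
  have hprod : ∏ j ∈ Finset.range l, D.comp (C (ζ ^ j) * X) ∣ derivative Q := by
    refine Finset.prod_dvd_of_coprime ?_ fun j _ ↦ hdvd' j
    intro i hi j hj hij
    exact isCoprime_of_dvd_sub_C
      (hinj i (by simpa using hi) j (by simpa using hj) hij) (hdvd i) (hdvd j)
  have hcop : IsCoprime E (∏ j ∈ Finset.range l, D.comp (C (ζ ^ j) * X)) := by
    refine IsCoprime.prod_right fun j _ ↦ ?_
    refine isCoprime_of_dvd_sub_C (a := 0) (Ne.symm ?_) (by simpa using hEQ) (hdvd j)
    exact mul_ne_zero (inv_ne_zero (pow_ne_zero _ (pow_ne_zero _ hζ0))) hB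
  have hall := hcop.mul_dvd hEQ' hprod
  have hdeg := natDegree_le_of_dvd hall h0
  have hne := ne_zero_of_dvd_ne_zero h0 hall
  rw [natDegree_mul (left_ne_zero_of_mul hne) (right_ne_zero_of_mul hne),
    natDegree_prod _ _ (Finset.prod_ne_zero_iff.1 (right_ne_zero_of_mul hne))] at hdeg
  have hcomp : ∀ j ∈ Finset.range l, (D.comp (C (ζ ^ j) * X)).natDegree = D.natDegree := by
    intro j _
    rw [natDegree_comp, natDegree_C_mul_X _ (pow_ne_zero _ hζ0), mul_one]
  rw [Finset.sum_congr rfl hcomp, Finset.sum_const, Finset.card_range, smul_eq_mul] at hdeg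
  exact hdeg.trans_lt (natDegree_derivative_lt hQ.ne')

/-- The numerical consequences of the critical point count. -/
lemma exponents_eq_of_count_lt {k n k₂ l₂ n₂ d d₂ a b : ℕ} (hk : 0 < k) (hn : 2 ≤ n)
    (hk₂ : 0 < k₂) (hl₂ : 0 < l₂) (hn₂ : 0 < n₂) (hl₂n₂ : 2 ≤ l₂ * n₂) (hd : 0 < d) (hd₂ : 0 < d₂)
    (hdeg : k + n * d = k₂ + n₂ * (d₂ * l₂))
    (hlt : (k₂ - 1 + (n₂ - 1) * (d₂ * l₂) + b) + l₂ * (k - 1 + (n - 1) * d + a)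
      < k₂ + n₂ * (d₂ * l₂)) :
    k = 1 ∧ k₂ = 1 ∧ n = 2 ∧ l₂ * n₂ = 2 ∧ a = 0 ∧ b = 0 := by
  obtain ⟨k, rfl⟩ := Nat.exists_eq_add_of_lt hk
  obtain ⟨k₂, rfl⟩ := Nat.exists_eq_add_of_lt hk₂
  obtain ⟨n, rfl⟩ := Nat.exists_eq_add_of_le' hn
  simp only [zero_add, Nat.add_sub_cancel, show n + 2 - 1 = n + 1 by omega] at *
  rcases Nat.lt_or_ge 1 l₂ with hl | hl
  · obtain ⟨l, rfl⟩ := Nat.exists_eq_add_of_le' hl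
    obtain ⟨m, rfl⟩ := Nat.exists_eq_add_of_lt hn₂
    simp only [zero_add, Nat.add_sub_cancel] at *
    have h : k₂ + m * (d₂ * (l + 2)) + b + l * (k + n * d + d + a) + k + n * d + 2 * a ≤ 0 := by
      nlinarith
    have hl0 : l = 0 := by
      by_contra hne
      have : 0 < l * (k + n * d + d + a) := by positivity
      omega
    have hm0 : m = 0 := by
      by_contra hne
      have : 0 < m * (d₂ * (l + 2)) := by positivity
      omega
    have hn0 : n = 0 := by
      by_contra hne
      have : 0 < n * d := by positivity
      omega
    subst hl0 hm0 hn0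
    omega
  · obtain rfl : l₂ = 1 := by omega
    obtain ⟨m, rfl⟩ := Nat.exists_eq_add_of_le' (show 2 ≤ n₂ by omega)
    simp only [one_mul, mul_one, show m + 2 - 1 = m + 1 by omega] at *
    have h : k + k₂ + n * d + m * d₂ + 2 * a + 2 * b ≤ 0 := by nlinarith
    have hm0 : m = 0 := by
      by_contra hne
      have : 0 < m * d₂ := by positivity
      omega
    have hn0 : n = 0 := by
      by_contra hne
      have : 0 < n * d := by positivity
      omega
    subst hm0 hn0
    omega

lemma dvd_and_dvd_derivative_comp_of_sq_dvd {R : Type*} [CommRing R] {w u : R[X]} (h : w ^ 2 ∣ u)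
    (p : R[X]) : w.comp p ∣ u.comp p ∧ w.comp p ∣ derivative (u.comp p) := by
  obtain ⟨v, rfl⟩ := h
  constructor
  · exact ⟨w.comp p * v.comp p, by simp only [mul_comp, pow_comp]; ring⟩
  · refine ⟨2 * derivative (w.comp p) * v.comp p + w.comp p * derivative (v.comp p), ?_⟩
    rw [mul_comp, pow_comp, derivative_mul, derivative_sq, C_ofNat]
    ring

/-- If `u(1) ≠ 0` (equivalently `B ≠ 0`) and
`B + (x+1)^k · u(x+1)^n = x^{k₂} · u₂(x^{ℓ₂})^{n₂}`, then `k = k₂ = 1`, `n = 2`,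
`ℓ₂·n₂ = 2`, and all roots of `u` and of `u₂` are simple. -/
theorem translation_relation_B_ne_zero_reduction (u u₂ : ℂ[X]) (k n k₂ l₂ n₂ : ℕ) (B : ℂ)
    (hk : 0 < k) (hn : 0 < n) (hk₂ : 0 < k₂) (hl₂ : 0 < l₂) (hn₂ : 0 < n₂)
    (hkn : Nat.gcd k n = 1) (hn2 : 2 ≤ n)
    (hk₂l₂ : Nat.gcd k₂ l₂ = 1) (hk₂n₂ : Nat.gcd k₂ n₂ = 1) (hl₂n₂ : 2 ≤ l₂ * n₂)
    (hu : u.Monic) (hund : 0 < u.natDegree) (hu0 : u.eval 0 ≠ 0)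
    (hu₂ : u₂.Monic) (hu₂nd : 0 < u₂.natDegree) (hu₂0 : u₂.eval 0 ≠ 0)
    (hu1 : u.eval 1 ≠ 0)
    (heq : Polynomial.C B + (X + 1) ^ k * (u.comp (X + 1)) ^ n
         = X ^ k₂ * (u₂.comp (X ^ l₂)) ^ n₂) :
    k = 1 ∧ k₂ = 1 ∧ n = 2 ∧ l₂ * n₂ = 2 ∧
    (∀ z : ℂ, u.rootMultiplicity z ≤ 1) ∧ (∀ z : ℂ, u₂.rootMultiplicity z ≤ 1) := by
  have hX1 : (X + 1 : ℂ[X]).Monic := by simpa using monic_X_add_C (1 : ℂ)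
  have hX1deg : (X + 1 : ℂ[X]).natDegree = 1 := by simpa using natDegree_X_add_C (1 : ℂ)
  set U : ℂ[X] := u.comp (X + 1) with hU
  set V : ℂ[X] := u₂.comp (X ^ l₂) with hV
  have hUmonic : U.Monic := hu.comp hX1 (by omega)
  have hVmonic : V.Monic := hu₂.comp (monic_X_pow l₂) (by rw [natDegree_X_pow]; omega)
  have hUdeg : U.natDegree = u.natDegree := by rw [hU, natDegree_comp, hX1deg, mul_one]
  have hVdeg : V.natDegree = u₂.natDegree * l₂ := by rw [hV, natDegree_comp, natDegree_X_pow]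
  have hB : B ≠ 0 := by
    rintro rfl
    have h := congrArg (eval 0) heq
    simp [hU, hk₂.ne', hu1] at h
  set Q : ℂ[X] := X ^ k₂ * V ^ n₂ with hQ
  have hQdeg : Q.natDegree = k₂ + n₂ * (u₂.natDegree * l₂) := by
    rw [hQ, (monic_X_pow k₂).natDegree_mul (hVmonic.pow n₂), natDegree_X_pow,
      hVmonic.natDegree_pow, hVdeg]
  have hQdeg' : Q.natDegree = k + n * u.natDegree := by
    rw [← heq, natDegree_C_add, (hX1.pow k).natDegree_mul (hUmonic.pow n),
      hX1.natDegree_pow, hUmonic.natDegree_pow, hX1deg, hUdeg, mul_one]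
  have hQsub : Q - C B = (X + 1) ^ k * U ^ n := by rw [← heq]; ring
  have hQder : derivative Q = derivative ((X + 1) ^ k * U ^ n) := by
    rw [← heq, derivative_add, derivative_C, zero_add]
  obtain ⟨ζ, hζ⟩ : ∃ ζ : ℂ, IsPrimitiveRoot ζ l₂ :=
    ⟨_, Complex.isPrimitiveRoot_exp l₂ hl₂.ne'⟩
  have hsymm : Q.comp (C ζ * X) = C (ζ ^ k₂) * Q := by
    have hVs : V.comp (C ζ * X) = V := by
      rw [hV, comp_assoc, X_pow_comp, mul_pow, ← C_pow, hζ.pow_eq_one, C_1, one_mul]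
    rw [hQ, mul_comp, pow_comp, pow_comp, X_comp, hVs, mul_pow, C_pow, mul_assoc]
  have key : ∀ w w₂ : ℂ[X], w.Monic → w₂.Monic → w ^ 2 ∣ u → w₂ ^ 2 ∣ u₂ →
      k = 1 ∧ k₂ = 1 ∧ n = 2 ∧ l₂ * n₂ = 2 ∧ w.natDegree = 0 ∧ w₂.natDegree * l₂ = 0 := by
    intro w w₂ hw hw₂ hwu hw₂u
    have hWmonic : (w.comp (X + 1)).Monic := hw.comp hX1 (by omega)
    have hZmonic : (w₂.comp (X ^ l₂)).Monic :=
      hw₂.comp (monic_X_pow l₂) (by rw [natDegree_X_pow]; omega)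
    obtain ⟨hW, hW'⟩ := dvd_and_dvd_derivative_comp_of_sq_dvd hwu (X + 1)
    obtain ⟨hZ, hZ'⟩ := dvd_and_dvd_derivative_comp_of_sq_dvd hw₂u (X ^ l₂)
    obtain ⟨hD, hD'⟩ := pow_mul_pow_mul_dvd_self_and_derivative (L := X + 1) hk hn hW hW'
    obtain ⟨hE, hE'⟩ := pow_mul_pow_mul_dvd_self_and_derivative (L := X) hk₂ hn₂ hZ hZ'
    rw [← hU, ← hQsub] at hD
    rw [← hU, ← hQder] at hD'
    rw [← hV] at hE hE'
    have hlt := natDegree_add_mul_natDegree_lt hζ hk₂l₂ hB (by omega) hsymm hD hD' hE hE'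
    rw [((hX1.pow _).mul (hUmonic.pow _)).natDegree_mul hWmonic,
      (hX1.pow _).natDegree_mul (hUmonic.pow _), hX1.natDegree_pow, hUmonic.natDegree_pow,
      (((monic_X_pow _).mul (hVmonic.pow _)).natDegree_mul hZmonic),
      (monic_X_pow _).natDegree_mul (hVmonic.pow _), natDegree_X_pow, hVmonic.natDegree_pow,
      hVdeg, hUdeg, natDegree_comp (p := w), natDegree_comp (p := w₂), hX1deg, natDegree_X_pow,
      hQdeg, mul_one, mul_one] at hlt
    exact exponents_eq_of_count_lt hk hn2 hk₂ hl₂ hn₂ hl₂n₂ hund hu₂nd (hQdeg'.symm.trans hQdeg) hlt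
  obtain ⟨h₁, h₂, h₃, h₄, -⟩ := key 1 1 monic_one monic_one (by simp) (by simp)
  refine ⟨h₁, h₂, h₃, h₄, fun z ↦ ?_, fun z ↦ ?_⟩
  · by_contra! hz
    have h := key (X - C z) 1 (monic_X_sub_C z) monic_one
      ((le_rootMultiplicity_iff hu.ne_zero).1 hz) (by simp)
    simp at h
  · by_contra! hz
    have h := key 1 (X - C z) monic_one (monic_X_sub_C z) (by simp)
      ((le_rootMultiplicity_iff hu₂.ne_zero).1 hz)
    simp [hl₂.ne'] at h
end
end

section
/- For every integer s ≥ 1 there exists exactly one monic polynomial u ∈ ℂ[x] of degree s with the property that there exist B ∈ ℂ with B ≠ 0 and a monic polynomial u₂ ∈ ℂ[x] such that B + (x+1)·u(x+1)² = x·u₂(x)² in ℂ[x]. -/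
open Polynomial

noncomputable section

/-- Monic polynomials `v`, `w` of degree `s` with `x w² - (x+1) v²` a nonzero constant: up to
scaling they are the square-root factors of `T + 1` and `T - 1`, where `T` is the Chebyshev
polynomial of degree `2 s + 1` evaluated at `2 x + 1`. -/
theorem exists_monic_sub_sq_eq_const (s : ℕ) :
    ∃ v w : ℂ[X], v.Monic ∧ v.natDegree = s ∧ w.Monic ∧
      (X + 1) * v ^ 2 - X * w ^ 2 = C ((1 / 16) ^ s) := by
  suffices h : ∃ v w : ℂ[X], v.natDegree ≤ s ∧ v.coeff s = 1 ∧ w.natDegree ≤ s ∧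
      w.coeff s = 1 ∧ (X + 1) * v ^ 2 - X * w ^ 2 = C ((1 / 16) ^ s) by
    obtain ⟨v, w, hv, hv1, hw, hw1, h⟩ := h
    exact ⟨v, w, monic_of_natDegree_le_of_coeff_eq_one s hv hv1,
      natDegree_eq_of_le_of_coeff_ne_zero hv (by simp [hv1]),
      monic_of_natDegree_le_of_coeff_eq_one s hw hw1, h⟩
  induction s with
  | zero => exact ⟨1, 1, by simp, by simp, by simp, by simp, by simp⟩
  | succ s ih =>
    obtain ⟨v, w, hv, hv1, hw, hw1, h⟩ := ih
    have hvs : v.coeff (s + 1) = 0 := coeff_eq_zero_of_natDegree_lt (by omega)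
    have hws : w.coeff (s + 1) = 0 := coeff_eq_zero_of_natDegree_lt (by omega)
    have hX : ((X : ℂ[X]) * (v + w)).natDegree ≤ s + 1 := by
      refine natDegree_mul_le.trans ?_
      have := natDegree_add_le_of_degree_le hv hw
      rw [natDegree_X]
      omega
    refine ⟨C (1 / 4) * (2 * (X * (v + w)) + v), C (1 / 4) * (2 * (X * (v + w)) + w + 2 * v),
      ?_, ?_, ?_, ?_, ?_⟩
    · compute_degree
      omega
    · rw [coeff_C_mul, coeff_add, coeff_ofNat_mul, coeff_X_mul, coeff_add, hv1, hw1, hvs]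
      norm_num
    · compute_degree
      omega
    · rw [coeff_C_mul, coeff_add, coeff_add, coeff_ofNat_mul, coeff_ofNat_mul, coeff_X_mul,
        coeff_add, hv1, hw1, hvs, hws]
      norm_num
    · have h4 : (C (1 / 4) : ℂ[X]) ^ 2 = C (1 / 16) := by
        rw [← C_pow]
        norm_num
      rw [pow_succ (1 / 16 : ℂ), C_mul, ← h, ← h4]
      ring

/-- A multiple of a monic polynomial `p` of no larger degree is a constant multiple of `p`. -/
theorem Polynomial.Monic.eq_C_coeff_mul_of_dvd {R : Type*} [CommRing R] {p q : R[X]}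
    (hp : p.Monic) (hpq : p ∣ q) (hq : q.natDegree ≤ p.natDegree) :
    q = C (q.coeff p.natDegree) * p := by
  obtain ⟨r, rfl⟩ := hpq
  nontriviality R
  obtain rfl | hr := eq_or_ne r 0
  · simp
  rw [hp.natDegree_mul' hr] at hq
  rw [eq_C_of_natDegree_eq_zero (p := r) (by omega), coeff_mul_C, hp.coeff_natDegree,
    one_mul, mul_comm]

theorem natDegree_add_two_mul_mul_derivative_le (p : ℂ[X]) (c : ℂ) :
    (p + 2 * (X + C c) * derivative p).natDegree ≤ p.natDegree := by
  rw [natDegree_le_iff_coeff_eq_zero]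
  intro k hk
  have h0 : p.coeff k = 0 := coeff_eq_zero_of_natDegree_lt hk
  have h1 : p.coeff (k + 1) = 0 := coeff_eq_zero_of_natDegree_lt (by omega)
  rw [mul_assoc, coeff_add, coeff_ofNat_mul, add_mul, coeff_add, coeff_C_mul, coeff_derivative]
  cases k <;> simp [coeff_derivative, h0, h1]

theorem coeff_add_two_mul_mul_derivative (p : ℂ[X]) (c : ℂ) (k : ℕ) :
    (p + 2 * (X + C c) * derivative p).coeff k =
      (2 * k + 1) * p.coeff k + 2 * c * (k + 1) * p.coeff (k + 1) := by
  rw [mul_assoc, coeff_add, coeff_ofNat_mul, add_mul, coeff_add, coeff_C_mul, coeff_derivative]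
  cases k
  · simp
    ring
  · simp [coeff_derivative]
    ring

/-- If `(x+a) v²` and `(x+b) w²` have the same derivative and `v`, `w` are coprime, then `w` is
obtained from `v` by a first-order differential operator. -/
theorem add_two_mul_mul_derivative_eq {s : ℕ} {v w : ℂ[X]} {a b : ℂ} (hv : v.Monic)
    (hw : w.Monic) (hvs : v.natDegree = s) (hws : w.natDegree = s) (hvw : IsCoprime v w)
    (h : v * (v + 2 * (X + C a) * derivative v) = w * (w + 2 * (X + C b) * derivative w)) :
    v + 2 * (X + C a) * derivative v = C (2 * s + 1 : ℂ) * w := by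
  have hdvd : w ∣ v + 2 * (X + C a) * derivative v :=
    hvw.symm.dvd_of_dvd_mul_left (Dvd.intro _ h.symm)
  have hle := natDegree_add_two_mul_mul_derivative_le v a
  have hv0 : v.coeff (s + 1) = 0 := coeff_eq_zero_of_natDegree_lt (by omega)
  have hv1 : v.coeff s = 1 := hvs ▸ hv.coeff_natDegree
  rw [hw.eq_C_coeff_mul_of_dvd hdvd (by omega), hws, coeff_add_two_mul_mul_derivative, hv0, hv1]
  simp

theorem differential_system_of_add_eq {s : ℕ} {v w : ℂ[X]} {B : ℂ} (hB : B ≠ 0) (hv : v.Monic)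
    (hvs : v.natDegree = s) (hw : w.Monic) (h : C B + (X + 1) * v ^ 2 = X * w ^ 2) :
    w.natDegree = s ∧ v + 2 * (X + C 1) * derivative v = C (2 * s + 1 : ℂ) * w ∧
      w + 2 * (X + C 0) * derivative w = C (2 * s + 1 : ℂ) * v := by
  have hws : w.natDegree = s := by
    have h1 : (C B + (X + 1) * v ^ 2).natDegree = 1 + 2 * s := by
      rw [natDegree_C_add, ← C_1, (monic_X_add_C 1).natDegree_mul (hv.pow 2), natDegree_X_add_C,
        hv.natDegree_pow, hvs]
    rw [h, monic_X.natDegree_mul (hw.pow 2), natDegree_X, hw.natDegree_pow] at h1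
    omega
  have hvw : IsCoprime v w := by
    refine ⟨-C B⁻¹ * (X + 1) * v, C B⁻¹ * X * w, ?_⟩
    have hC : C B⁻¹ * C B = 1 := by rw [← C_mul, inv_mul_cancel₀ hB, C_1]
    linear_combination hC - C B⁻¹ * h
  have hd : v * (v + 2 * (X + C 1) * derivative v) = w * (w + 2 * (X + C 0) * derivative w) := by
    have := congrArg derivative h
    simp only [derivative_add, derivative_mul, derivative_C, derivative_X, derivative_one,
      derivative_sq, map_ofNat] at this
    rw [C_1, C_0]
    linear_combination this
  exact ⟨hws, add_two_mul_mul_derivative_eq hv hw hvs hws hvw hd,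
    add_two_mul_mul_derivative_eq hw hv hws hvs hvw.symm hd.symm⟩

theorem eq_zero_of_differential_system {s : ℕ} {d e : ℂ[X]} (hd0 : d.coeff s = 0)
    (hd : d + 2 * (X + C 1) * derivative d = C (2 * s + 1 : ℂ) * e)
    (he : e + 2 * (X + C 0) * derivative e = C (2 * s + 1 : ℂ) * d) : d = 0 := by
  by_contra hne
  set k := d.natDegree with hk
  have hdk : d.coeff k ≠ 0 := leadingCoeff_ne_zero.mpr hne
  have hdk1 : d.coeff (k + 1) = 0 := coeff_eq_zero_of_natDegree_lt (by omega)
  have h1 := congrArg (coeff · k) hd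
  have h2 := congrArg (coeff · k) he
  simp only [coeff_add_two_mul_mul_derivative, coeff_C_mul, hdk1] at h1 h2
  have hsq : ((2 * k + 1 : ℂ) ^ 2) = (2 * s + 1) ^ 2 := by
    refine mul_right_cancel₀ hdk ?_
    linear_combination (2 * k + 1 : ℂ) * h1 + (2 * s + 1 : ℂ) * h2
  have hks : k = s := by
    have : (2 * k + 1) ^ 2 = (2 * s + 1) ^ 2 := by exact_mod_cast hsq
    have := Nat.pow_left_injective two_ne_zero this
    omega
  exact hdk (hks ▸ hd0)

theorem eq_of_add_eq {s : ℕ} {v w v' w' : ℂ[X]} {B B' : ℂ} (hB : B ≠ 0) (hB' : B' ≠ 0)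
    (hv : v.Monic) (hvs : v.natDegree = s) (hw : w.Monic)
    (hv' : v'.Monic) (hvs' : v'.natDegree = s) (hw' : w'.Monic)
    (h : C B + (X + 1) * v ^ 2 = X * w ^ 2) (h' : C B' + (X + 1) * v' ^ 2 = X * w' ^ 2) :
    v = v' := by
  obtain ⟨-, h1, h2⟩ := differential_system_of_add_eq hB hv hvs hw h
  obtain ⟨-, h1', h2'⟩ := differential_system_of_add_eq hB' hv' hvs' hw' h'
  have hv1 : v.coeff s = 1 := hvs ▸ hv.coeff_natDegree
  have hv1' : v'.coeff s = 1 := hvs' ▸ hv'.coeff_natDegree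
  refine sub_eq_zero.mp (eq_zero_of_differential_system (s := s) (e := w - w') ?_ ?_ ?_)
  · rw [coeff_sub, hv1, hv1', sub_self]
  · rw [derivative_sub]
    linear_combination h1 - h1'
  · rw [derivative_sub]
    linear_combination h2 - h2'

/-- For each `s ≥ 1` there is exactly one monic polynomial `u` of degree `s` for which
there exist `B ≠ 0` and a monic `u₂` with `B + (x+1)·u(x+1)² = x·u₂(x)²`. -/
theorem unique_typeW_solution (s : ℕ) (hs : 1 ≤ s) :
    ∃! u : ℂ[X], u.Monic ∧ u.natDegree = s ∧
      ∃ (B : ℂ) (u₂ : ℂ[X]), B ≠ 0 ∧ u₂.Monic ∧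
        Polynomial.C B + (X + 1) * (u.comp (X + 1)) ^ 2 = X * u₂ ^ 2 := by
  refine existsUnique_of_exists_of_unique ?_ ?_
  · obtain ⟨v, w, hv, hvs, hw, h⟩ := exists_monic_sub_sq_eq_const s
    refine ⟨v.comp (X - C 1), hv.comp_X_sub_C 1, by rw [natDegree_comp, natDegree_X_sub_C, mul_one, hvs],
      -(1 / 16) ^ s, w, by simp, hw, ?_⟩
    have hcomp : (v.comp (X - C 1)).comp (X + 1) = v := by simp [comp_assoc]
    rw [hcomp, C_neg]
    linear_combination h
  · rintro u u' ⟨hu, hus, B, w, hB, hw, h⟩ ⟨hu', hus', B', w', hB', hw', h'⟩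
    rw [← C_1] at h h'
    refine taylor_injective (1 : ℂ) ?_
    simp only [taylor_apply]
    exact eq_of_add_eq hB hB' (hu.comp_X_add_C 1) (by rw [natDegree_comp, natDegree_X_add_C, mul_one, hus]) hw
      (hu'.comp_X_add_C 1) (by rw [natDegree_comp, natDegree_X_add_C, mul_one, hus']) hw' h h'
end
end
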